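/- arXiv:1311.2322 — 3 statements merged into one kernel-verified Lean document; each statement's English description precedes it below -/
import Mathlib

section
/- (Fefferman-type lower bound.) Fix a nonnegative smooth compactly supported ρ : ℝ → ℝ with ∫_ℝ ρ = 1, and for N ≥ 1 set χ̃_N(x) = (ρ * χ_{[−1,1]})(x/N) and g_N^{±}(x) = e^{±2πix²} χ̃_N(x). Define T(f_1,f_2,f_3)(x) = ∫_{x_1<x_2<x_3} f_1(x_1) f_2(x_2) f_3(x_3) e^{2πix(x_1 − x_2 + x_3)} dx_1 dx_2 dx_3 (absolutely convergent for bounded compactly supported inputs). Then for every q > 0 there exist constants c_q, C_q > 0 (also depending on ρ) and N_0 such that for all N ≥ N_0, c_q (log N) N^{1/q} ≤ ‖T(g_N^{+}, g_N^{−}, g_N^{+})‖_{L^q(ℝ)} ≤ C_q (log N) N^{1/q}. -/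
open MeasureTheory Complex
open scoped Real ENNReal

/-- The trilinear operator
`T(f₁,f₂,f₃)(x) = ∫_{x₁<x₂<x₃} f₁(x₁)f₂(x₂)f₃(x₃) e^{2πix(x₁-x₂+x₃)} dx⃗`. -/
noncomputable def Tfef (f₁ f₂ f₃ : ℝ → ℂ) (x : ℝ) : ℂ :=
  ∫ t in {t : Fin 3 → ℝ | StrictMono t},
    f₁ (t 0) * f₂ (t 1) * f₃ (t 2) *
      Complex.exp (2 * π * Complex.I * x * (t 0 - t 1 + t 2))

/-- The mollified dilated indicator `χ̃_N(x) = (ρ * χ_{[-1,1]})(x/N)`. -/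
noncomputable def chiT (ρ : ℝ → ℝ) (N x : ℝ) : ℝ :=
  ∫ t : ℝ, ρ t * Set.indicator (Set.Icc (-1 : ℝ) 1) (fun _ => (1 : ℝ)) (x / N - t)

/-- The chirp `g_N^{s}(x) = e^{2πisx²} χ̃_N(x)` (with `s = ±1`). -/
noncomputable def gN (ρ : ℝ → ℝ) (N s x : ℝ) : ℂ :=
  Complex.exp (2 * π * Complex.I * s * x ^ 2) * chiT ρ N x

open Filter Topology

/-- The character `y ↦ e^{2πiy}`. -/
noncomputable def ch (y : ℝ) : ℂ := Complex.exp (2 * π * y * Complex.I)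

lemma norm_ch (y : ℝ) : ‖ch y‖ = 1 := by
  have : (2 * π * y * Complex.I : ℂ) = ((2 * π * y : ℝ) : ℂ) * Complex.I := by push_cast; ring
  rw [ch, this, Complex.norm_exp_ofReal_mul_I]

lemma ch_zero : ch 0 = 1 := by simp [ch]

lemma ch_add (x y : ℝ) : ch (x + y) = ch x * ch y := by
  simp only [ch, ← Complex.exp_add]; congr 1; push_cast; ring

lemma hasDerivAt_ch (y : ℝ) : HasDerivAt ch (2 * π * Complex.I * ch y) y := by
  have h : HasDerivAt (fun y : ℝ => (2 * π * y * Complex.I : ℂ)) (2 * π * 1 * Complex.I) y :=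
    ((Complex.ofRealCLM.hasDerivAt (x := y)).const_mul (2 * π : ℂ)).mul_const Complex.I
  exact h.cexp.congr_deriv (by rw [ch]; ring)

lemma continuous_ch : Continuous ch :=
  continuous_iff_continuousAt.2 fun y => (hasDerivAt_ch y).continuousAt

lemma HasDerivAt.ch_comp {g : ℝ → ℝ} {g' x : ℝ} (hg : HasDerivAt g g' x) :
    HasDerivAt (fun x => ch (g x)) (2 * π * Complex.I * g' * ch (g x)) x := by
  exact ((hasDerivAt_ch (g x)).scomp x hg).congr_deriv (by rw [Complex.real_smul]; ring)

lemma four_pi_I_ne : (4 * π * Complex.I : ℂ) ≠ 0 := by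
  simp [Real.pi_ne_zero]

/-- The Fresnel integral `∫₀ʷ e^{2πiv²} dv`. -/
noncomputable def fresnel (w : ℝ) : ℂ := ∫ v in (0 : ℝ)..w, ch (v ^ 2)

lemma hasDerivAt_fresnel (w : ℝ) : HasDerivAt fresnel (ch (w ^ 2)) w := by
  have hc : Continuous fun v : ℝ => ch (v ^ 2) := continuous_ch.comp (continuous_pow 2)
  exact intervalIntegral.integral_hasDerivAt_right (hc.intervalIntegrable _ _)
    (hc.stronglyMeasurableAtFilter _ _) hc.continuousAt

lemma continuous_fresnel : Continuous fresnel :=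
  continuous_iff_continuousAt.2 fun y => (hasDerivAt_fresnel y).continuousAt

lemma fresnel_neg (w : ℝ) : fresnel (-w) = -fresnel w := by
  have h := intervalIntegral.integral_comp_neg (a := 0) (b := w) (fun v : ℝ => ch (v ^ 2))
  simp only [neg_sq, neg_zero] at h
  rw [fresnel, intervalIntegral.integral_symm, ← h, fresnel]

lemma integrableOn_inv_sq_Ioi : IntegrableOn (fun v : ℝ => (v ^ 2)⁻¹) (Set.Ioi 1) := by
  have := integrableOn_Ioi_rpow_of_lt (a := -2) (c := 1) (by norm_num) (by norm_num)
  refine this.congr_fun (fun v hv => ?_) measurableSet_Ioi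
  have hv : (0 : ℝ) < v := lt_trans one_pos hv
  simp [Real.rpow_neg hv.le]

lemma integrableOn_div_sq_Ioi {g : ℝ → ℂ} (hg : Continuous g) (h1 : ∀ v, ‖g v‖ ≤ 1) :
    IntegrableOn (fun v : ℝ => g v / v ^ 2) (Set.Ioi 1) := by
  refine Integrable.mono' integrableOn_inv_sq_Ioi ?_ ?_
  · refine ContinuousOn.aestronglyMeasurable ?_ measurableSet_Ioi
    intro v hv
    have hv : (v : ℂ) ^ 2 ≠ 0 := by
      have : (0 : ℝ) < v := lt_trans one_pos hv
      simp [this.ne']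
    exact ContinuousAt.continuousWithinAt (hg.continuousAt.div (by fun_prop) hv)
  · filter_upwards with v
    rw [norm_div, norm_pow, Complex.norm_real, Real.norm_eq_abs, sq_abs, div_eq_mul_inv]
    exact mul_le_of_le_one_left (by positivity) (h1 v)

lemma norm_integral_div_sq_le {g : ℝ → ℂ} (h1 : ∀ v, ‖g v‖ ≤ 1) {w : ℝ}
    (hw : 1 ≤ w) : ‖∫ v in (1 : ℝ)..w, g v / v ^ 2‖ ≤ ∫ v in Set.Ioi (1 : ℝ), (v ^ 2)⁻¹ := by
  rw [intervalIntegral.integral_of_le hw]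
  refine (norm_integral_le_of_norm_le (integrableOn_inv_sq_Ioi.mono_set Set.Ioc_subset_Ioi_self)
    ?_).trans (setIntegral_mono_set integrableOn_inv_sq_Ioi ?_
      Set.Ioc_subset_Ioi_self.eventuallyLE)
  · filter_upwards with v
    rw [norm_div, norm_pow, Complex.norm_real, Real.norm_eq_abs, sq_abs, div_eq_mul_inv]
    exact mul_le_of_le_one_left (by positivity) (h1 v)
  · filter_upwards with v
    positivity

lemma fresnel_eq {w : ℝ} (hw : 1 ≤ w) :
    fresnel w = fresnel 1 + (4 * π * Complex.I)⁻¹ *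
      (ch (w ^ 2) / w - ch 1 + ∫ v in (1 : ℝ)..w, ch (v ^ 2) / v ^ 2) := by
  have hpos : ∀ v ∈ Set.uIcc 1 w, (v : ℂ) ≠ 0 := by
    intro v hv
    rw [Set.uIcc_of_le hw] at hv
    exact_mod_cast (lt_of_lt_of_le one_pos hv.1).ne'
  have hcont : ContinuousOn (fun v : ℝ => ch (v ^ 2) / (v : ℂ) ^ 2) (Set.uIcc 1 w) :=
    ContinuousOn.div (continuous_ch.comp (continuous_pow 2)).continuousOn
      (by fun_prop) (fun v hv => pow_ne_zero _ (hpos v hv))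
  have hc : Continuous fun v : ℝ => ch (v ^ 2) := continuous_ch.comp (continuous_pow 2)
  have key := intervalIntegral.integral_eq_sub_of_hasDerivAt (a := 1) (b := w)
    (f := fun v : ℝ => ch (v ^ 2) / v)
    (f' := fun v : ℝ => 4 * π * Complex.I * ch (v ^ 2) - ch (v ^ 2) / v ^ 2) ?_ ?_
  · rw [intervalIntegral.integral_sub ((hc.const_mul _).intervalIntegrable _ _)
      hcont.intervalIntegrable, intervalIntegral.integral_const_mul] at key
    have hsplit : fresnel w = fresnel 1 + ∫ v in (1 : ℝ)..w, ch (v ^ 2) :=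
      (intervalIntegral.integral_add_adjacent_intervals (hc.intervalIntegrable _ _)
        (hc.intervalIntegrable _ _)).symm
    rw [hsplit]
    congr 1
    rw [eq_inv_mul_iff_mul_eq₀ four_pi_I_ne]
    simp only [one_pow, Complex.ofReal_one, div_one] at key
    linear_combination key
  · intro v hv
    have h1 := (hasDerivAt_pow 2 v).ch_comp
    have h2 := h1.div (Complex.ofRealCLM.hasDerivAt (x := v)) (hpos v hv)
    refine h2.congr_deriv ?_
    have := hpos v hv
    simp only [Complex.ofRealCLM_apply]
    field_simp
    push_cast
    ring
  · exact ((hc.const_mul _).intervalIntegrable _ _).sub hcont.intervalIntegrable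

lemma exists_tendsto_fresnel : ∃ c : ℂ, Tendsto fresnel atTop (𝓝 c) := by
  refine ⟨fresnel 1 + (4 * π * Complex.I)⁻¹ * (0 - ch 1 +
    ∫ v in Set.Ioi (1 : ℝ), ch (v ^ 2) / v ^ 2), ?_⟩
  have hc : Continuous fun v : ℝ => ch (v ^ 2) := continuous_ch.comp (continuous_pow 2)
  have h1 : Tendsto (fun w : ℝ => ch (w ^ 2) / w) atTop (𝓝 0) := by
    rw [tendsto_zero_iff_norm_tendsto_zero]
    have : (fun w : ℝ => ‖ch (w ^ 2) / w‖) = fun w : ℝ => |w|⁻¹ := by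
      ext w; simp [norm_ch]
    rw [this]
    exact tendsto_inv_atTop_zero.comp tendsto_abs_atTop_atTop
  have h2 := intervalIntegral_tendsto_integral_Ioi (b := id) 1
    (integrableOn_div_sq_Ioi hc fun v => (norm_ch _).le) tendsto_id
  have := ((((h1.sub_const (ch 1)).add h2).const_mul (4 * π * Complex.I : ℂ)⁻¹)).const_add
    (fresnel 1)
  refine this.congr' ?_
  filter_upwards [eventually_ge_atTop 1] with w hw
  simp only [id]
  rw [fresnel_eq hw]

lemma exists_norm_fresnel_le : ∃ C : ℝ, ∀ w, ‖fresnel w‖ ≤ C := by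
  obtain ⟨c, hc⟩ := exists_tendsto_fresnel
  obtain ⟨W, hW⟩ := eventually_atTop.1 (hc.norm.eventually (eventually_le_nhds (lt_add_one ‖c‖)))
  obtain ⟨C, hC⟩ := (isCompact_Icc (a := 0) (b := W)).exists_bound_of_continuousOn
    continuous_fresnel.continuousOn
  have hpos : ∀ w, 0 ≤ w → ‖fresnel w‖ ≤ max C (‖c‖ + 1) := by
    intro w hw
    rcases le_total w W with h | h
    · exact (hC w ⟨hw, h⟩).trans (le_max_left _ _)
    · exact (hW w h).trans (le_max_right _ _)
  refine ⟨max C (‖c‖ + 1), fun w => ?_⟩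
  rcases le_total 0 w with h | h
  · exact hpos w h
  · rw [← norm_neg, ← fresnel_neg]
    exact hpos (-w) (by linarith)

lemma hasDerivAt_fresnel_comp (N u z : ℝ) :
    HasDerivAt (fun z => fresnel (N * (z - u))) (N * ch (N ^ 2 * (z - u) ^ 2)) z := by
  have h : HasDerivAt (fun z : ℝ => N * (z - u)) N z := by
    simpa using ((hasDerivAt_id z).sub_const u).const_mul N
  exact ((hasDerivAt_fresnel (N * (z - u))).scomp z h).congr_deriv
    (by rw [Complex.real_smul, mul_pow])

lemma integral_ch_mul_eq {f f' : ℝ → ℂ} (hf : ∀ z, HasDerivAt f (f' z) z) (hi : Integrable f)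
    (hi' : Integrable f') (N u : ℝ) :
    ∫ z : ℝ, (N * ch (N ^ 2 * (z - u) ^ 2)) * f z = -∫ z : ℝ, fresnel (N * (z - u)) * f' z := by
  obtain ⟨C, hC⟩ := exists_norm_fresnel_le
  have hcF : Continuous fun z : ℝ => fresnel (N * (z - u)) := continuous_fresnel.comp (by fun_prop)
  have hcc : Continuous fun z : ℝ => (N * ch (N ^ 2 * (z - u) ^ 2) : ℂ) :=
    continuous_const.mul (continuous_ch.comp (by fun_prop))
  have := integral_mul_deriv_eq_deriv_mul_of_integrable (u := fun z : ℝ => fresnel (N * (z - u)))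
    (v := f) (u' := fun z : ℝ => (N * ch (N ^ 2 * (z - u) ^ 2) : ℂ)) (v' := f')
    (fun z _ => hasDerivAt_fresnel_comp N u z) (fun z _ => hf z)
    (hi'.bdd_mul hcF.aestronglyMeasurable (c := C) (by filter_upwards with z using hC _))
    (hi.bdd_mul hcc.aestronglyMeasurable (c := |N|) (by
      filter_upwards with z
      simp [norm_ch]))
    (hi.bdd_mul hcF.aestronglyMeasurable (c := C) (by filter_upwards with z using hC _))
  rw [this, neg_neg]

lemma tendsto_integral_ch_mul {c : ℂ} (hc : Tendsto fresnel atTop (𝓝 c))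
    {f f' : ℝ → ℂ} (hf : ∀ z, HasDerivAt f (f' z) z) (hi : Integrable f)
    (hi' : Integrable f') (u : ℝ) :
    Tendsto (fun p : ℝ × ℝ => ∫ z : ℝ, (p.1 * ch (p.1 ^ 2 * (z - p.2) ^ 2)) * f z)
      (atTop ×ˢ 𝓝 u) (𝓝 (2 * c * f u)) := by
  obtain ⟨C, hC⟩ := exists_norm_fresnel_le
  have hlim : Tendsto (fun p : ℝ × ℝ => ∫ z : ℝ, fresnel (p.1 * (z - p.2)) * f' z) (atTop ×ˢ 𝓝 u)
      (𝓝 (∫ z : ℝ, (if u < z then c else -c) * f' z)) := by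
    refine tendsto_integral_filter_of_dominated_convergence (fun z => C * ‖f' z‖) ?_ ?_
      (hi'.norm.const_mul C) ?_
    · filter_upwards with p
      exact (continuous_fresnel.comp (by fun_prop)).aestronglyMeasurable.mul
        hi'.aestronglyMeasurable
    · filter_upwards with p
      filter_upwards with z
      rw [norm_mul]
      exact mul_le_mul_of_nonneg_right (hC _) (norm_nonneg _)
    · have h0 : ∀ᵐ z : ℝ, z ≠ u := by
        simp [ae_iff]
      filter_upwards [h0] with z hz
      refine Tendsto.mul_const _ ?_
      have hz' : Tendsto (fun p : ℝ × ℝ => z - p.2) (atTop ×ˢ 𝓝 u) (𝓝 (z - u)) :=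
        tendsto_const_nhds.sub tendsto_snd
      rcases lt_or_gt_of_ne hz with h | h
      · rw [if_neg h.not_gt]
        have : Tendsto (fun p : ℝ × ℝ => -fresnel (p.1 * -(z - p.2))) (atTop ×ˢ 𝓝 u) (𝓝 (-c)) :=
          (hc.comp (tendsto_fst.atTop_mul_pos (by linarith : 0 < -(z - u)) hz'.neg)).neg
        refine this.congr fun p => ?_
        rw [← fresnel_neg]; congr 1; ring
      · rw [if_pos h]
        exact hc.comp (tendsto_fst.atTop_mul_pos (sub_pos.2 h) hz')
  have hval : ∫ z : ℝ, (if u < z then c else -c) * f' z = -(2 * c * f u) := by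
    have hint : Integrable fun z : ℝ => (if u < z then c else -c) * f' z := by
      refine hi'.bdd_mul (c := ‖c‖) ?_ ?_
      · exact (Measurable.ite measurableSet_Ioi measurable_const
          measurable_const).aestronglyMeasurable
      · filter_upwards with z
        split_ifs <;> simp
    rw [← intervalIntegral.integral_Iic_add_Ioi (b := u) hint.integrableOn hint.integrableOn]
    have h1 : ∫ z in Set.Iic u, (if u < z then c else -c) * f' z = -c * f u := by
      rw [setIntegral_congr_fun (g := fun z => -c * f' z) measurableSet_Iic (fun z hz => by
        simp [not_lt.2 (Set.mem_Iic.1 hz)]), integral_const_mul]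
      rw [integral_Iic_of_hasDerivAt_of_tendsto' (m := 0) (fun x _ => hf x) hi'.integrableOn
        (tendsto_zero_of_hasDerivAt_of_integrableOn_Iic (a := u) (fun x _ => hf x)
          hi'.integrableOn hi.integrableOn), sub_zero]
    have h2 : ∫ z in Set.Ioi u, (if u < z then c else -c) * f' z = -c * f u := by
      rw [setIntegral_congr_fun (g := fun z => c * f' z) measurableSet_Ioi (fun z hz => by
        simp only [Set.mem_Ioi] at hz; simp [hz]), integral_const_mul]
      rw [integral_Ioi_of_hasDerivAt_of_tendsto' (m := 0) (fun x _ => hf x) hi'.integrableOn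
        (tendsto_zero_of_hasDerivAt_of_integrableOn_Ioi (a := u) (fun x _ => hf x)
          hi'.integrableOn hi.integrableOn)]
      ring
    rw [h1, h2]; ring
  have := hlim.neg
  rw [hval, neg_neg] at this
  exact this.congr fun p => (integral_ch_mul_eq hf hi hi' p.1 p.2).symm

lemma fresnel_limit_ne_zero {c : ℂ} (hc : Tendsto fresnel atTop (𝓝 c)) : c ≠ 0 := by
  rintro rfl
  have hg : Integrable fun z : ℝ => Complex.exp (-1 * (z : ℂ) ^ 2) :=
    integrable_cexp_neg_mul_sq (by simp)
  have hg' : Integrable fun z : ℝ => (-2 * z : ℂ) * Complex.exp (-1 * (z : ℂ) ^ 2) := by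
    have := (integrable_mul_cexp_neg_mul_sq (b := 1) (by simp)).const_mul (-2 : ℂ)
    simpa [mul_assoc] using this
  have hd : ∀ z : ℝ, HasDerivAt (fun z : ℝ => Complex.exp (-1 * (z : ℂ) ^ 2))
      ((-2 * z : ℂ) * Complex.exp (-1 * (z : ℂ) ^ 2)) z := by
    intro z
    have h := (((Complex.ofRealCLM.hasDerivAt (x := z)).pow 2).const_mul (-1 : ℂ)).cexp
    exact h.congr_deriv (by simp; ring)
  have hlim := (tendsto_integral_ch_mul hc hd hg hg' 0).comp
    (tendsto_id.prodMk (tendsto_const_nhds (x := (0 : ℝ))))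
  simp only [mul_zero, zero_mul, Function.comp_def, id, sub_zero] at hlim
  have hval : ∀ N : ℝ, ∫ z : ℝ, (N * ch (N ^ 2 * z ^ 2)) * Complex.exp (-1 * (z : ℂ) ^ 2)
      = N * (π / (1 - 2 * π * N ^ 2 * Complex.I)) ^ (1 / 2 : ℂ) := by
    intro N
    rw [← integral_gaussian_complex (b := 1 - 2 * π * N ^ 2 * Complex.I), ← integral_const_mul]
    · congr 1; ext z
      rw [ch, mul_assoc, ← Complex.exp_add]
      congr 2; push_cast; ring
    · have : (1 - 2 * π * N ^ 2 * Complex.I : ℂ) = 1 - ((2 * π * N ^ 2 : ℝ) : ℂ) * Complex.I := by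
        push_cast; ring
      rw [this, Complex.sub_re, Complex.re_ofReal_mul]
      simp
  have hpow : Tendsto (fun N : ℝ => ‖∫ z : ℝ, (N * ch (N ^ 2 * z ^ 2)) *
      Complex.exp (-1 * (z : ℂ) ^ 2)‖ ^ 2) atTop (𝓝 0) := by
    simpa using hlim.norm.pow 2
  have hlow : ∀ᶠ N : ℝ in atTop, (1 / 4 : ℝ) ≤ ‖∫ z : ℝ, (N * ch (N ^ 2 * z ^ 2)) *
      Complex.exp (-1 * (z : ℂ) ^ 2)‖ ^ 2 := by
    filter_upwards [eventually_ge_atTop 1] with N hN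
    rw [hval, norm_mul, mul_pow, ← norm_pow, ← norm_pow, ← Complex.cpow_nat_mul]
    norm_num
    have h2 : ‖(1 - 2 * π * N ^ 2 * Complex.I : ℂ)‖ ≤ 1 + 2 * π * N ^ 2 := by
      refine (norm_sub_le _ _).trans ?_
      simp [abs_of_pos Real.pi_pos]
    have h3 : 0 < ‖(1 - 2 * π * N ^ 2 * Complex.I : ℂ)‖ := by
      rw [norm_pos_iff]
      intro h
      have := congrArg Complex.re h
      have h' : (1 - 2 * π * N ^ 2 * Complex.I : ℂ) =
          1 - ((2 * π * N ^ 2 : ℝ) : ℂ) * Complex.I := by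
        push_cast; ring
      rw [h', Complex.sub_re, Complex.re_ofReal_mul] at this
      simp at this
    rw [abs_of_pos Real.pi_pos, ← mul_div_assoc, div_le_div_iff₀ (by norm_num) h3]
    have := Real.pi_gt_three
    nlinarith [mul_pos (sub_pos.2 this) (show 0 < N ^ 2 by positivity), sq_nonneg (N - 1)]
  have := hpow.eventually (gt_mem_nhds (show (0 : ℝ) < 1 / 4 by norm_num))
  obtain ⟨N, h1, h2⟩ := (hlow.and this).exists
  linarith

/-- The continuous function equal to `(e^{4πiβ} - 1) / (4πiβ)` away from `0`. -/
noncomputable def logKernel (β : ℝ) : ℂ :=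
  dslope (fun β : ℝ => ch (2 * β) / (4 * π * Complex.I)) 0 β

lemma hasDerivAt_ch_two_mul (β : ℝ) :
    HasDerivAt (fun β : ℝ => ch (2 * β) / (4 * π * Complex.I)) (ch (2 * β)) β := by
  have h := (((hasDerivAt_id β).const_mul 2).ch_comp).div_const (4 * π * Complex.I : ℂ)
  refine h.congr_deriv ?_
  have := four_pi_I_ne
  rw [div_eq_iff this]
  push_cast [id]
  ring

lemma continuous_logKernel : Continuous logKernel := by
  rw [continuous_iff_continuousAt]
  intro β
  rcases eq_or_ne β 0 with rfl | h
  · exact continuousAt_dslope_same.2 (hasDerivAt_ch_two_mul 0).differentiableAt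
  · exact (continuousAt_dslope_of_ne h).2 (hasDerivAt_ch_two_mul β).continuousAt

lemma mul_logKernel (β : ℝ) : β * logKernel β = (ch (2 * β) - 1) / (4 * π * Complex.I) := by
  have := sub_smul_dslope (fun β : ℝ => ch (2 * β) / (4 * π * Complex.I)) 0 β
  rw [sub_zero, Complex.real_smul] at this
  rw [logKernel, this, mul_zero, ch_zero, sub_div]

/-- The primitive of `logKernel` vanishing at `0`. -/
noncomputable def logInt (μ : ℝ) : ℂ := ∫ β in (0 : ℝ)..μ, logKernel β

lemma hasDerivAt_logInt (μ : ℝ) : HasDerivAt logInt (logKernel μ) μ :=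
  intervalIntegral.integral_hasDerivAt_right (continuous_logKernel.intervalIntegrable _ _)
    (continuous_logKernel.stronglyMeasurableAtFilter _ _) continuous_logKernel.continuousAt

lemma continuous_logInt : Continuous logInt :=
  continuous_iff_continuousAt.2 fun y => (hasDerivAt_logInt y).continuousAt

lemma logInt_zero : logInt 0 = 0 := by simp [logInt]

lemma integral_ch_div {w : ℝ} (hw : 1 ≤ w) :
    ∫ β in (1 : ℝ)..w, ch (2 * β) / β = (4 * π * Complex.I)⁻¹ *
      (ch (2 * w) / w - ch 2 + ∫ v in (1 : ℝ)..w, ch (2 * v) / v ^ 2) := by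
  have hpos : ∀ v ∈ Set.uIcc 1 w, (v : ℂ) ≠ 0 := by
    intro v hv
    rw [Set.uIcc_of_le hw] at hv
    exact_mod_cast (lt_of_lt_of_le one_pos hv.1).ne'
  have hc : Continuous fun v : ℝ => ch (2 * v) := continuous_ch.comp (by fun_prop)
  have hcont : ContinuousOn (fun v : ℝ => ch (2 * v) / (v : ℂ) ^ 2) (Set.uIcc 1 w) :=
    hc.continuousOn.div (by fun_prop) (fun v hv => pow_ne_zero _ (hpos v hv))
  have hcont1 : ContinuousOn (fun v : ℝ => ch (2 * v) / (v : ℂ)) (Set.uIcc 1 w) :=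
    hc.continuousOn.div (by fun_prop) hpos
  have key := intervalIntegral.integral_eq_sub_of_hasDerivAt (a := 1) (b := w)
    (f := fun v : ℝ => ch (2 * v) / v)
    (f' := fun v : ℝ => 4 * π * Complex.I * (ch (2 * v) / v) - ch (2 * v) / v ^ 2) ?_ ?_
  · rw [intervalIntegral.integral_sub (hcont1.intervalIntegrable.const_mul _)
      hcont.intervalIntegrable, intervalIntegral.integral_const_mul] at key
    rw [eq_inv_mul_iff_mul_eq₀ four_pi_I_ne]
    simp only [mul_one, Complex.ofReal_one, div_one] at key
    linear_combination key
  · intro v hv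
    have h1 := ((hasDerivAt_id v).const_mul 2).ch_comp
    have h2 := h1.div (Complex.ofRealCLM.hasDerivAt (x := v)) (hpos v hv)
    refine h2.congr_deriv ?_
    have := hpos v hv
    simp only [Complex.ofRealCLM_apply, id]
    field_simp
    push_cast
    ring
  · exact (hcont1.intervalIntegrable.const_mul _).sub hcont.intervalIntegrable

lemma logInt_add_log {w : ℝ} (hw : 1 ≤ w) :
    logInt w + Real.log w / (4 * π * Complex.I) =
      logInt 1 + (4 * π * Complex.I)⁻¹ * ∫ β in (1 : ℝ)..w, ch (2 * β) / β := by
  have hsplit : logInt w = logInt 1 + ∫ v in (1 : ℝ)..w, logKernel v :=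
    (intervalIntegral.integral_add_adjacent_intervals
      (continuous_logKernel.intervalIntegrable _ _)
      (continuous_logKernel.intervalIntegrable _ _)).symm
  have hpos : ∀ v ∈ Set.uIcc 1 w, v ≠ 0 := by
    intro v hv
    rw [Set.uIcc_of_le hw] at hv
    exact (lt_of_lt_of_le one_pos hv.1).ne'
  have hlog : (Real.log w : ℂ) = ∫ v in (1 : ℝ)..w, ((v⁻¹ : ℝ) : ℂ) := by
    rw [intervalIntegral.integral_ofReal, integral_inv_of_pos one_pos (by linarith), div_one]
  have hc : Continuous fun v : ℝ => ch (2 * v) := continuous_ch.comp (by fun_prop)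
  have hinv : ContinuousOn (fun v : ℝ => ((v⁻¹ : ℝ) : ℂ)) (Set.uIcc 1 w) :=
    Complex.continuous_ofReal.comp_continuousOn (continuousOn_inv₀.mono hpos)
  have hcont1 : ContinuousOn (fun v : ℝ => ch (2 * v) / (v : ℂ)) (Set.uIcc 1 w) :=
    hc.continuousOn.div (by fun_prop) (fun v hv => by exact_mod_cast hpos v hv)
  rw [hsplit, hlog, add_assoc]
  congr 1
  rw [div_eq_inv_mul, ← intervalIntegral.integral_const_mul,
    ← intervalIntegral.integral_const_mul, ← intervalIntegral.integral_add
      (continuous_logKernel.intervalIntegrable _ _) (hinv.intervalIntegrable.const_mul _)]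
  refine intervalIntegral.integral_congr fun v hv => ?_
  have hv0 : (v : ℂ) ≠ 0 := by exact_mod_cast hpos v hv
  have h4 := four_pi_I_ne
  have hk := mul_logKernel v
  have : logKernel v = (ch (2 * v) - 1) / (4 * π * Complex.I) / v := by
    rw [← hk]; field_simp
  simp only [this]
  push_cast
  rw [div_div, inv_mul_eq_div, div_eq_mul_inv (v : ℂ)⁻¹]
  field_simp
  ring

lemma norm_four_pi_I_inv_le : ‖(4 * π * Complex.I : ℂ)⁻¹‖ ≤ 1 := by
  rw [norm_inv]
  refine inv_le_one_of_one_le₀ ?_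
  simp only [norm_mul, Complex.norm_I, Complex.norm_real, Real.norm_eq_abs,
    abs_of_pos Real.pi_pos]
  have := Real.pi_gt_three
  norm_num
  linarith

lemma exists_norm_logInt_add_log_le :
    ∃ C : ℝ, 0 ≤ C ∧ ∀ μ : ℝ, 1 ≤ μ → ‖logInt μ + Real.log μ / (4 * π * Complex.I)‖ ≤ C := by
  refine ⟨‖logInt 1‖ + 1 * (1 * (1 + 1 + ∫ v in Set.Ioi (1 : ℝ), (v ^ 2)⁻¹)), ?_, ?_⟩
  · have : 0 ≤ ∫ v in Set.Ioi (1 : ℝ), (v ^ 2)⁻¹ := integral_nonneg fun v => by positivity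
    positivity
  intro μ hμ
  rw [logInt_add_log hμ, integral_ch_div hμ]
  refine (norm_add_le _ _).trans (add_le_add le_rfl ?_)
  have h0 : 0 ≤ ∫ v in Set.Ioi (1 : ℝ), (v ^ 2)⁻¹ := integral_nonneg fun v => by positivity
  rw [norm_mul, norm_mul]
  refine mul_le_mul norm_four_pi_I_inv_le (mul_le_mul norm_four_pi_I_inv_le ?_ (norm_nonneg _)
    zero_le_one) (by positivity) zero_le_one
  refine (norm_add_le _ _).trans (add_le_add ((norm_sub_le _ _).trans (add_le_add ?_ ?_)) ?_)
  · rw [norm_div, norm_ch, Complex.norm_real, Real.norm_eq_abs, abs_of_pos (by linarith)]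
    exact div_le_one_of_le₀ hμ (by linarith)
  · rw [norm_ch]
  · exact norm_integral_div_sq_le (g := fun v => ch (2 * v)) (fun v => (norm_ch _).le) hμ

lemma exists_norm_logInt_sub_le :
    ∃ C : ℝ, 0 ≤ C ∧ ∀ l a b : ℝ, 1 ≤ l → 0 < a → 0 < b →
      ‖logInt (l * (a * b)) + Real.log l / (4 * π * Complex.I)‖ ≤
        C + |Real.log a| + |Real.log b| := by
  obtain ⟨C₁, hC₁0, hC₁⟩ := exists_norm_logInt_add_log_le
  obtain ⟨C₂, hC₂⟩ := (isCompact_Icc (a := (0 : ℝ)) (b := 1)).exists_bound_of_continuousOn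
    continuous_logInt.continuousOn
  refine ⟨max C₁ C₂, le_max_of_le_left hC₁0, fun l a b hl ha hb => ?_⟩
  have hl0 : 0 < l := by linarith
  have hlog : Real.log (l * (a * b)) = Real.log l + (Real.log a + Real.log b) := by
    rw [Real.log_mul hl0.ne' (mul_pos ha hb).ne', Real.log_mul ha.ne' hb.ne']
  have hdiv : ∀ r : ℝ, ‖(r / (4 * π * Complex.I) : ℂ)‖ ≤ |r| := by
    intro r
    rw [div_eq_mul_inv, norm_mul, Complex.norm_real, Real.norm_eq_abs]
    exact mul_le_of_le_one_right (abs_nonneg _) norm_four_pi_I_inv_le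
  rw [add_assoc]
  rcases le_total 1 (l * (a * b)) with h | h
  · have h1 := hC₁ _ h
    have h2 : logInt (l * (a * b)) + Real.log l / (4 * π * Complex.I) =
        (logInt (l * (a * b)) + Real.log (l * (a * b)) / (4 * π * Complex.I)) -
          ((Real.log a + Real.log b : ℝ) : ℂ) / (4 * π * Complex.I) := by
      rw [hlog]; push_cast; ring
    rw [h2]
    exact (norm_sub_le _ _).trans (add_le_add (h1.trans (le_max_left _ _))
      ((hdiv _).trans (abs_add_le _ _)))
  · have h1 := hC₂ _ ⟨by positivity, h⟩
    refine (norm_add_le _ _).trans (add_le_add (h1.trans (le_max_right _ _)) ((hdiv _).trans ?_))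
    have h3 : Real.log (l * (a * b)) ≤ 0 := Real.log_nonpos (by positivity) h
    rw [abs_of_nonneg (Real.log_nonneg hl)]
    linarith [neg_abs_le (Real.log a), neg_abs_le (Real.log b)]

lemma intervalIntegral_swap_of_continuous {F : ℝ → ℝ → ℂ} (hF : Continuous (Function.uncurry F))
    (a b c d : ℝ) :
    ∫ x in a..b, ∫ y in c..d, F x y = ∫ y in c..d, ∫ x in a..b, F x y := by
  refine intervalIntegral_intervalIntegral_swap ?_
  exact (hF.continuousOn.integrableOn_compact (isCompact_uIcc.prod isCompact_uIcc)).mono_set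
    (Set.prod_mono Set.uIoc_subset_uIcc Set.uIoc_subset_uIcc)

lemma intervalIntegral_swap_three {F : ℝ → ℝ → ℝ → ℂ}
    (hF : Continuous fun p : ℝ × ℝ × ℝ => F p.1 p.2.1 p.2.2) (z₀ z₁ a₀ a₁ b₀ b₁ : ℝ) :
    ∫ z in z₀..z₁, ∫ a in a₀..a₁, ∫ b in b₀..b₁, F z a b =
      ∫ a in a₀..a₁, ∫ b in b₀..b₁, ∫ z in z₀..z₁, F z a b := by
  rw [intervalIntegral_swap_of_continuous]
  · refine intervalIntegral.integral_congr fun a _ => ?_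
    refine intervalIntegral_swap_of_continuous ?_ _ _ _ _
    exact hF.comp (f := fun q : ℝ × ℝ => (q.1, a, q.2)) (by fun_prop)
  · refine intervalIntegral.continuous_parametric_intervalIntegral_of_continuous'
      (f := fun q : ℝ × ℝ => F q.1 q.2) ?_ _ _
    exact hF.comp (f := fun q : (ℝ × ℝ) × ℝ => (q.1.1, q.1.2, q.2)) (by fun_prop)

/-- Smooth functions of `(z, a, b)` supported in the open cube of half-side `R`. -/
structure SmoothInBox (R : ℝ) (f : ℝ × ℝ × ℝ → ℂ) : Prop where
  smooth : ContDiff ℝ (⊤ : ℕ∞) f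
  supp : tsupport f ⊆ {p | |p.1| < R ∧ |p.2.1| < R ∧ |p.2.2| < R}

namespace SmoothInBox

variable {R : ℝ} {f : ℝ × ℝ × ℝ → ℂ}

lemma fderiv_apply (hf : SmoothInBox R f) (v : ℝ × ℝ × ℝ) :
    SmoothInBox R (fun p => fderiv ℝ f p v) where
  smooth := (hf.smooth.fderiv_right (m := (⊤ : ℕ∞)) (by simp)).clm_apply contDiff_const
  supp := (tsupport_fderiv_apply_subset ℝ v).trans hf.supp

lemma continuous (hf : SmoothInBox R f) : Continuous f := hf.smooth.continuous

lemma eq_zero (hf : SmoothInBox R f) {p : ℝ × ℝ × ℝ}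
    (hp : ¬(|p.1| < R ∧ |p.2.1| < R ∧ |p.2.2| < R)) : f p = 0 :=
  image_eq_zero_of_notMem_tsupport fun h => hp (hf.supp h)

lemma exists_norm_le (hf : SmoothInBox R f) : ∃ C : ℝ, 0 ≤ C ∧ ∀ p, ‖f p‖ ≤ C := by
  obtain ⟨C, hC⟩ := ((isCompact_Icc (a := -R) (b := R)).prod
    ((isCompact_Icc (a := -R) (b := R)).prod
      (isCompact_Icc (a := -R) (b := R)))).exists_bound_of_continuousOn hf.continuous.continuousOn
  refine ⟨max C 0, le_max_right _ _, fun p => ?_⟩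
  by_cases hp : |p.1| < R ∧ |p.2.1| < R ∧ |p.2.2| < R
  · obtain ⟨h1, h2, h3⟩ := hp
    refine (hC p ⟨?_, ?_, ?_⟩).trans (le_max_left _ _)
    · exact ⟨(abs_lt.1 h1).1.le, (abs_lt.1 h1).2.le⟩
    · exact ⟨(abs_lt.1 h2).1.le, (abs_lt.1 h2).2.le⟩
    · exact ⟨(abs_lt.1 h3).1.le, (abs_lt.1 h3).2.le⟩
  · rw [hf.eq_zero hp, norm_zero]; exact le_max_right _ _

lemma hasDerivAt_line (hf : SmoothInBox R f) {g : ℝ → ℝ × ℝ × ℝ} {v : ℝ × ℝ × ℝ} {t : ℝ}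
    (hg : HasDerivAt g v t) : HasDerivAt (fun t => f (g t)) (fderiv ℝ f (g t) v) t :=
  ((hf.smooth.differentiable (by simp)).differentiableAt.hasFDerivAt).comp_hasDerivAt t hg

lemma hasDerivAt_fst (hf : SmoothInBox R f) (z a b : ℝ) :
    HasDerivAt (fun z => f (z, a, b)) (fderiv ℝ f (z, a, b) (1, 0, 0)) z :=
  hf.hasDerivAt_line ((hasDerivAt_id z).prodMk
    ((hasDerivAt_const z a).prodMk (hasDerivAt_const z b)))

lemma hasDerivAt_snd (hf : SmoothInBox R f) (z a b : ℝ) :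
    HasDerivAt (fun a => f (z, a, b)) (fderiv ℝ f (z, a, b) (0, 1, 0)) a :=
  hf.hasDerivAt_line ((hasDerivAt_const a z).prodMk
    ((hasDerivAt_id a).prodMk (hasDerivAt_const a b)))

lemma hasDerivAt_trd (hf : SmoothInBox R f) (z a b : ℝ) :
    HasDerivAt (fun b => f (z, a, b)) (fderiv ℝ f (z, a, b) (0, 0, 1)) b :=
  hf.hasDerivAt_line ((hasDerivAt_const b z).prodMk
    ((hasDerivAt_const b a).prodMk (hasDerivAt_id b)))

lemma eq_zero_fst (hf : SmoothInBox R f) {z a b : ℝ} (hz : R ≤ |z|) : f (z, a, b) = 0 :=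
  hf.eq_zero fun h => absurd h.1 hz.not_gt

lemma eq_zero_snd (hf : SmoothInBox R f) {z a b : ℝ} (ha : R ≤ |a|) : f (z, a, b) = 0 :=
  hf.eq_zero fun h => absurd h.2.1 ha.not_gt

lemma eq_zero_trd (hf : SmoothInBox R f) {z a b : ℝ} (hb : R ≤ |b|) : f (z, a, b) = 0 :=
  hf.eq_zero fun h => absurd h.2.2 hb.not_gt

lemma half_abs_le {u z : ℝ} (hu : 2 * R ≤ |u|) (hz : |z| ≤ R) : |u| / 2 ≤ |z - u| := by
  have := abs_sub_abs_le_abs_sub u z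
  rw [abs_sub_comm u z] at this
  linarith

lemma nonstationary_step (hR : 1 ≤ R) (hf : SmoothInBox R f) (m : ℕ) {N u : ℝ}
    (hu : 2 * R ≤ |u|) (a b : ℝ) :
    4 * π * Complex.I * N ^ 2 *
        (∫ z in -R..R, ch (N ^ 2 * (z - u) ^ 2) * (f (z, a, b) * ((z - u : ℂ)⁻¹) ^ m)) =
      (m + 1) * (∫ z in -R..R, ch (N ^ 2 * (z - u) ^ 2) *
          (f (z, a, b) * ((z - u : ℂ)⁻¹) ^ (m + 2))) -
        ∫ z in -R..R, ch (N ^ 2 * (z - u) ^ 2) *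
          (fderiv ℝ f (z, a, b) (1, 0, 0) * ((z - u : ℂ)⁻¹) ^ (m + 1)) := by
  have hne : ∀ z ∈ Set.uIcc (-R) R, (z - u : ℂ) ≠ 0 := by
    intro z hz
    rw [Set.uIcc_of_le (by linarith)] at hz
    have h := half_abs_le hu (abs_le.2 hz)
    have : (z - u : ℝ) ≠ 0 := by
      intro h0
      rw [h0, abs_zero] at h
      linarith
    exact_mod_cast this
  have hinv : ContinuousOn (fun z : ℝ => (z - u : ℂ)⁻¹) (Set.uIcc (-R) R) :=
    ContinuousOn.inv₀ (by fun_prop) hne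
  have hcc : Continuous fun z : ℝ => ch (N ^ 2 * (z - u) ^ 2) := continuous_ch.comp (by fun_prop)
  have hint : ∀ (g : ℝ × ℝ × ℝ → ℂ) (j : ℕ), Continuous g → IntervalIntegrable
      (fun z : ℝ => ch (N ^ 2 * (z - u) ^ 2) * (g (z, a, b) * ((z - u : ℂ)⁻¹) ^ j))
      volume (-R) R := by
    intro g j hg
    refine ContinuousOn.intervalIntegrable ?_
    exact hcc.continuousOn.mul
      ((hg.comp (by fun_prop : Continuous fun z : ℝ => (z, a, b))).continuousOn.mul (hinv.pow j))
  have hfz := hf.fderiv_apply (1, 0, 0)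
  have key := intervalIntegral.integral_eq_sub_of_hasDerivAt (a := -R) (b := R)
    (f := fun z : ℝ => ch (N ^ 2 * (z - u) ^ 2) * (f (z, a, b) * ((z - u : ℂ)⁻¹) ^ (m + 1)))
    (f' := fun z : ℝ => 4 * π * Complex.I * N ^ 2 *
        (ch (N ^ 2 * (z - u) ^ 2) * (f (z, a, b) * ((z - u : ℂ)⁻¹) ^ m)) +
      (ch (N ^ 2 * (z - u) ^ 2) *
        (fderiv ℝ f (z, a, b) (1, 0, 0) * ((z - u : ℂ)⁻¹) ^ (m + 1)) -
      (m + 1) * (ch (N ^ 2 * (z - u) ^ 2) *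
          (f (z, a, b) * ((z - u : ℂ)⁻¹) ^ (m + 2))))) ?_ ?_
  · rw [intervalIntegral.integral_add ((hint _ _ hf.continuous).const_mul _)
      ((hint _ _ hfz.continuous).sub ((hint _ _ hf.continuous).const_mul _)),
      intervalIntegral.integral_sub (hint _ _ hfz.continuous)
        ((hint _ _ hf.continuous).const_mul _), intervalIntegral.integral_const_mul,
      intervalIntegral.integral_const_mul,
      hf.eq_zero_fst (z := R) (by rw [abs_of_nonneg (by linarith)]),
      hf.eq_zero_fst (z := -R) (by rw [abs_neg, abs_of_nonneg (by linarith)])] at key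
    simp only [zero_mul, mul_zero, sub_zero] at key
    linear_combination key
  · intro z hz
    have h0 := hne z hz
    have h1 : HasDerivAt (fun z : ℝ => N ^ 2 * (z - u) ^ 2) (N ^ 2 * (2 * (z - u))) z := by
      have := (((hasDerivAt_id z).sub_const u).pow 2).const_mul (N ^ 2)
      exact this.congr_deriv (by simp)
    have h2 : HasDerivAt (fun z : ℝ => (z - u : ℂ)) 1 z :=
      (Complex.ofRealCLM.hasDerivAt (x := z)).sub_const (u : ℂ)
    have h3 := h1.ch_comp.mul ((hf.hasDerivAt_fst z a b).mul ((h2.inv h0).pow (m + 1)))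
    refine h3.congr_deriv ?_
    simp only [Pi.mul_apply, Pi.pow_apply, Pi.inv_apply]
    have hw : (z - u : ℂ) * (z - u : ℂ)⁻¹ = 1 := mul_inv_cancel₀ h0
    have hd : -1 / (z - u : ℂ) ^ 2 = -((z - u : ℂ)⁻¹) ^ 2 := by rw [inv_pow, div_eq_mul_inv]; ring
    rw [hd, Nat.add_sub_cancel]
    push_cast
    linear_combination (4 * π * Complex.I * N ^ 2 * ch (N ^ 2 * (z - u) ^ 2) *
      f (z, a, b) * ((z - u : ℂ)⁻¹) ^ m) * hw
  · exact ((hint _ _ hf.continuous).const_mul _).add ((hint _ _ hfz.continuous).sub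
      ((hint _ _ hf.continuous).const_mul _))

lemma exists_nonstationary_bound (hR : 1 ≤ R) (k : ℕ) :
    ∀ (m : ℕ) {f : ℝ × ℝ × ℝ → ℂ}, SmoothInBox R f →
      ∃ C : ℝ, 0 ≤ C ∧ ∀ N u a b : ℝ, 1 ≤ N → 2 * R ≤ |u| →
        ‖∫ z in -R..R, ch (N ^ 2 * (z - u) ^ 2) * (f (z, a, b) * ((z - u : ℂ)⁻¹) ^ m)‖ ≤
          C * ((N ^ 2 * |u|)⁻¹) ^ k * (|u|⁻¹) ^ m := by
  induction k with
  | zero =>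
    intro m f hf
    obtain ⟨C, hC0, hC⟩ := hf.exists_norm_le
    refine ⟨C * 2 ^ m * (2 * R), by positivity, fun N u a b hN hu => ?_⟩
    have hu0 : 0 < |u| := by linarith
    have := intervalIntegral.norm_integral_le_of_norm_le_const (a := -R) (b := R)
      (f := fun z : ℝ => ch (N ^ 2 * (z - u) ^ 2) * (f (z, a, b) * ((z - u : ℂ)⁻¹) ^ m))
      (C := C * (2 * |u|⁻¹) ^ m) ?_
    · refine this.trans (le_of_eq ?_)
      rw [mul_pow, abs_of_nonneg (by linarith : (0 : ℝ) ≤ R - -R)]; ring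
    · intro z hz
      rw [Set.uIoc_of_le (by linarith)] at hz
      have h := half_abs_le hu (abs_le.2 ⟨hz.1.le, hz.2⟩)
      rw [norm_mul, norm_ch, one_mul, norm_mul, norm_pow, norm_inv, ← Complex.ofReal_sub,
        Complex.norm_real, Real.norm_eq_abs]
      refine mul_le_mul (hC _) (pow_le_pow_left₀ (by positivity) ?_ m) (by positivity) hC0
      rw [show 2 * |u|⁻¹ = (|u| / 2)⁻¹ by rw [inv_div]; rfl]
      exact inv_anti₀ (by positivity) h
  | succ k ih =>
    intro m f hf
    obtain ⟨C₁, hC₁0, hC₁⟩ := ih (m + 2) hf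
    obtain ⟨C₂, hC₂0, hC₂⟩ := ih (m + 1) (hf.fderiv_apply (1, 0, 0))
    refine ⟨(m + 1) * C₁ + C₂, by positivity, fun N u a b hN hu => ?_⟩
    have hu1 : 1 ≤ |u| := by linarith
    have hu0 : 0 < |u| := by linarith
    have hN0 : 0 < N := by linarith
    have step := nonstationary_step hR hf m (N := N) hu a b
    have h1 := hC₁ N u a b hN hu
    have h2 := hC₂ N u a b hN hu
    have hN2 : (N ^ 2 : ℂ) ≠ 0 := by exact_mod_cast (pow_pos hN0 2).ne'
    rw [mul_assoc, ← eq_inv_mul_iff_mul_eq₀ four_pi_I_ne, ← eq_inv_mul_iff_mul_eq₀ hN2] at step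
    rw [step]
    have hNn : ‖((N : ℂ) ^ 2)⁻¹‖ = (N ^ 2)⁻¹ := by
      rw [norm_inv, norm_pow, Complex.norm_real, Real.norm_eq_abs, sq_abs]
    rw [norm_mul, norm_mul, hNn]
    have hm : ‖(m + 1 : ℂ)‖ = m + 1 := by
      exact_mod_cast Complex.norm_natCast (m + 1)
    set X := (N ^ 2 * |u|)⁻¹ with hX
    have hX0 : 0 < X := by positivity
    have hXu : (N ^ 2)⁻¹ * |u|⁻¹ = X := by rw [hX, mul_inv]
    have hle : |u|⁻¹ ≤ 1 := inv_le_one_of_one_le₀ hu1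
    calc _ ≤ (N ^ 2)⁻¹ * (1 * ((m + 1) * (C₁ * X ^ k * (|u|⁻¹) ^ (m + 2)) +
          C₂ * X ^ k * (|u|⁻¹) ^ (m + 1))) := by
          refine mul_le_mul_of_nonneg_left ?_ (by positivity)
          refine mul_le_mul norm_four_pi_I_inv_le ?_ (norm_nonneg _) zero_le_one
          refine (norm_sub_le _ _).trans (add_le_add ?_ h2)
          rw [norm_mul, hm]
          exact mul_le_mul_of_nonneg_left h1 (by positivity)
      _ = ((N ^ 2)⁻¹ * |u|⁻¹) * X ^ k * (|u|⁻¹) ^ m * ((m + 1) * C₁ * |u|⁻¹ + C₂) := by ring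
      _ ≤ ((N ^ 2)⁻¹ * |u|⁻¹) * X ^ k * (|u|⁻¹) ^ m * ((m + 1) * C₁ * 1 + C₂) := by gcongr
      _ = _ := by rw [hXu]; ring

/-- The oscillatory integral of a compactly supported smooth function in the first variable
is uniformly bounded and decays rapidly in the location of the stationary point. -/
lemma exists_stationary_bound (hR : 1 ≤ R) (hf : SmoothInBox R f) (k : ℕ) :
    ∃ C : ℝ, 0 ≤ C ∧ ∀ N u a b : ℝ, 1 ≤ N →
      ‖∫ z in -R..R, (N * ch (N ^ 2 * (z - u) ^ 2)) * f (z, a, b)‖ ≤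
        C * ((1 + |u|)⁻¹) ^ k := by
  obtain ⟨C₁, hC₁0, hC₁⟩ := exists_nonstationary_bound hR (k + 1) 0 hf
  obtain ⟨C₂, hC₂0, hC₂⟩ := (hf.fderiv_apply (1, 0, 0)).exists_norm_le
  obtain ⟨C₃, hC₃⟩ := exists_norm_fresnel_le
  have hC₃0 : 0 ≤ C₃ := (norm_nonneg _).trans (hC₃ 0)
  refine ⟨C₁ * 2 ^ k + C₃ * C₂ * (2 * R) * (1 + 2 * R) ^ k, by positivity,
    fun N u a b hN => ?_⟩
  have hu0 : 0 < 1 + |u| := by positivity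
  rw [add_mul]
  rcases le_total (2 * R) |u| with hu | hu
  · refine le_add_of_le_of_nonneg ?_ (by positivity)
    have h := hC₁ N u a b hN hu
    have hup : 1 ≤ |u| := by linarith
    simp only [pow_zero, mul_one] at h
    simp only [mul_assoc (N : ℂ)]
    rw [intervalIntegral.integral_const_mul, norm_mul, Complex.norm_real, Real.norm_eq_abs,
      abs_of_pos (by linarith)]
    have hN0 : 0 < N := by linarith
    have hX : N * (N ^ 2 * |u|)⁻¹ ≤ 1 := by
      rw [← div_eq_mul_inv]
      refine div_le_one_of_le₀ ?_ (by positivity)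
      nlinarith [mul_le_mul hN hup zero_le_one (by linarith)]
    have hY : (N ^ 2 * |u|)⁻¹ ≤ 2 * (1 + |u|)⁻¹ := by
      rw [show 2 * (1 + |u|)⁻¹ = ((1 + |u|) / 2)⁻¹ by rw [inv_div]; rfl]
      refine inv_anti₀ (by positivity) ?_
      nlinarith [mul_le_mul hN hN zero_le_one (by linarith)]
    calc _ ≤ N * (C₁ * ((N ^ 2 * |u|)⁻¹) ^ (k + 1)) := mul_le_mul_of_nonneg_left h hN0.le
      _ = C₁ * ((N * (N ^ 2 * |u|)⁻¹) * ((N ^ 2 * |u|)⁻¹) ^ k) := by ring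
      _ ≤ C₁ * (1 * (2 * (1 + |u|)⁻¹) ^ k) := by gcongr
      _ = _ := by rw [mul_pow]; ring
  · refine le_add_of_nonneg_of_le (by positivity) ?_
    have hfz := hf.fderiv_apply (1, 0, 0)
    have hc : Continuous fun z : ℝ => (N * ch (N ^ 2 * (z - u) ^ 2) : ℂ) :=
      continuous_const.mul (continuous_ch.comp (by fun_prop))
    have ibp := intervalIntegral.integral_mul_deriv_eq_deriv_mul (a := -R) (b := R)
      (u := fun z => f (z, a, b)) (v := fun z => fresnel (N * (z - u)))
      (fun z _ => hf.hasDerivAt_fst z a b) (fun z _ => hasDerivAt_fresnel_comp N u z)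
      ((hfz.continuous.comp (by fun_prop : Continuous fun z : ℝ => (z, a, b))).intervalIntegrable
        _ _) (hc.intervalIntegrable _ _)
    simp only [mul_comm (f _)] at ibp
    rw [ibp, hf.eq_zero_fst (z := R) (by rw [abs_of_nonneg (by linarith)]),
      hf.eq_zero_fst (z := -R) (by rw [abs_neg, abs_of_nonneg (by linarith)])]
    simp only [mul_zero, sub_zero, zero_sub, norm_neg]
    have := intervalIntegral.norm_integral_le_of_norm_le_const (a := -R) (b := R)
      (f := fun z : ℝ => fderiv ℝ f (z, a, b) (1, 0, 0) * fresnel (N * (z - u)))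
      (C := C₃ * C₂) (fun z _ => by
        rw [norm_mul, mul_comm]
        exact mul_le_mul (hC₃ _) (hC₂ _) (norm_nonneg _) hC₃0)
    refine this.trans ?_
    rw [abs_of_nonneg (by linarith), mul_assoc (C₃ * C₂ * (2 * R)), ← mul_pow, sub_neg_eq_add,
      ← two_mul]
    refine le_mul_of_one_le_right (by positivity) (one_le_pow₀ ?_)
    rw [← div_eq_mul_inv, one_le_div hu0]
    linarith

/-- Integration by parts in the hyperbolic variables. -/
lemma integral_hyperbolic (hR : 1 ≤ R) (hf : SmoothInBox R f) (l z : ℝ) :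
    ∫ a in (0 : ℝ)..R, ∫ b in (0 : ℝ)..R, (l * ch (2 * (l * (a * b)))) * f (z, a, b) =
      ∫ a in (0 : ℝ)..R, ∫ b in (0 : ℝ)..R, logInt (l * (a * b)) *
        fderiv ℝ (fun p => fderiv ℝ f p (0, 0, 1)) (z, a, b) (0, 1, 0) := by
  have hfb := hf.fderiv_apply (0, 0, 1)
  have hfab := hfb.fderiv_apply (0, 1, 0)
  have hRabs : R ≤ |R| := le_abs_self R
  have first : ∀ a, 0 < a →
      ∫ b in (0 : ℝ)..R, (l * ch (2 * (l * (a * b)))) * f (z, a, b) =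
        ∫ b in (0 : ℝ)..R, -((l * b * logKernel (l * (a * b))) *
          fderiv ℝ f (z, a, b) (0, 0, 1)) := by
    intro a ha
    have ha' : (a : ℂ) ≠ 0 := by exact_mod_cast ha.ne'
    have hd : ∀ b : ℝ, HasDerivAt (fun b : ℝ => (l * b * logKernel (l * (a * b)) : ℂ))
        (l * ch (2 * (l * (a * b)))) b := by
      intro b
      have heq : (fun b : ℝ => (l * b * logKernel (l * (a * b)) : ℂ)) =
          fun b : ℝ => (ch (2 * (l * (a * b))) / (4 * π * Complex.I) - 1 / (4 * π * Complex.I)) /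
            a := by
        ext b
        rw [← sub_div, ← mul_logKernel, eq_div_iff ha']
        push_cast; ring
      rw [heq]
      have hin : HasDerivAt (fun b : ℝ => l * (a * b)) (l * a) b :=
        (((hasDerivAt_id b).const_mul a).const_mul l).congr_deriv (by ring)
      have := (((hasDerivAt_ch_two_mul (l * (a * b))).scomp b hin).sub_const
        (1 / (4 * π * Complex.I) : ℂ)).div_const (a : ℂ)
      refine this.congr_deriv ?_
      rw [Complex.real_smul, div_eq_iff ha']
      push_cast; ring
    have hc : Continuous fun b : ℝ => (l * ch (2 * (l * (a * b))) : ℂ) :=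
      continuous_const.mul (continuous_ch.comp (by fun_prop))
    have ibp := intervalIntegral.integral_mul_deriv_eq_deriv_mul (a := 0) (b := R)
      (u := fun b => f (z, a, b)) (fun b _ => hf.hasDerivAt_trd z a b) (fun b _ => hd b)
      ((hfb.continuous.comp (by fun_prop : Continuous fun b : ℝ => (z, a, b))).intervalIntegrable
        _ _) (hc.intervalIntegrable _ _)
    rw [intervalIntegral.integral_neg]
    rw [hf.eq_zero_trd hRabs] at ibp
    simp only [mul_comm (f _)] at ibp
    rw [ibp]
    simp only [Complex.ofReal_zero, mul_zero, zero_mul, sub_zero, zero_sub]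
    congr 1
    exact intervalIntegral.integral_congr fun b _ => mul_comm _ _
  have second : ∀ b, ∫ a in (0 : ℝ)..R, -((l * b * logKernel (l * (a * b))) *
        fderiv ℝ f (z, a, b) (0, 0, 1)) = ∫ a in (0 : ℝ)..R, logInt (l * (a * b)) *
        fderiv ℝ (fun p => fderiv ℝ f p (0, 0, 1)) (z, a, b) (0, 1, 0) := by
    intro b
    have hd : ∀ a : ℝ, HasDerivAt (fun a : ℝ => logInt (l * (a * b)))
        (l * b * logKernel (l * (a * b))) a := by
      intro a
      have hin : HasDerivAt (fun a : ℝ => l * (a * b)) (l * b) a :=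
        (((hasDerivAt_id a).mul_const b).const_mul l).congr_deriv (by ring)
      refine ((hasDerivAt_logInt (l * (a * b))).scomp a hin).congr_deriv ?_
      rw [Complex.real_smul]; push_cast; ring
    have hc : Continuous fun a : ℝ => (l * b * logKernel (l * (a * b)) : ℂ) :=
      continuous_const.mul (continuous_logKernel.comp (by fun_prop))
    have ibp := intervalIntegral.integral_mul_deriv_eq_deriv_mul (a := 0) (b := R)
      (u := fun a => fderiv ℝ f (z, a, b) (0, 0, 1)) (fun a _ => hfb.hasDerivAt_snd z a b)
      (fun a _ => hd a)
      ((hfab.continuous.comp (by fun_prop : Continuous fun a : ℝ => (z, a, b))).intervalIntegrable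
        _ _) (hc.intervalIntegrable _ _)
    have h0 : fderiv ℝ f (z, R, b) (0, 0, 1) = 0 := hfb.eq_zero_snd hRabs
    rw [h0] at ibp
    simp only [zero_mul, logInt_zero, mul_zero, sub_zero, zero_sub] at ibp
    rw [intervalIntegral.integral_neg]
    simp only [mul_comm (_ * logKernel _)]
    rw [ibp, neg_neg]
    exact intervalIntegral.integral_congr fun b _ => mul_comm _ _
  have hae : ∫ a in (0 : ℝ)..R, ∫ b in (0 : ℝ)..R, (l * ch (2 * (l * (a * b)))) * f (z, a, b) =
      ∫ a in (0 : ℝ)..R, ∫ b in (0 : ℝ)..R, -((l * b * logKernel (l * (a * b))) *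
          fderiv ℝ f (z, a, b) (0, 0, 1)) := by
    refine intervalIntegral.integral_congr_ae ?_
    filter_upwards with a ha
    rw [Set.uIoc_of_le (by linarith)] at ha
    exact first a ha.1
  rw [hae, intervalIntegral_swap_of_continuous, intervalIntegral.integral_congr fun b _ => second b,
    intervalIntegral_swap_of_continuous]
  · have h1 : Continuous fun q : ℝ × ℝ => logInt (l * (q.2 * q.1)) :=
      continuous_logInt.comp (by fun_prop)
    exact h1.mul (hfab.continuous.comp (by fun_prop : Continuous fun q : ℝ × ℝ => (z, q.2, q.1)))
  · have h1 : Continuous fun q : ℝ × ℝ => logKernel (l * (q.1 * q.2)) :=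
      continuous_logKernel.comp (by fun_prop)
    have h2 : Continuous fun q : ℝ × ℝ => fderiv ℝ f (z, q.1, q.2) (0, 0, 1) :=
      hfb.continuous.comp (by fun_prop : Continuous fun q : ℝ × ℝ => (z, q.1, q.2))
    exact (((by fun_prop : Continuous fun q : ℝ × ℝ => (l * q.2 : ℂ)).mul h1).mul h2).neg

end SmoothInBox

lemma continuous_intervalIntegral {X : Type*} [TopologicalSpace X] {F : X → ℝ → ℂ}
    (hF : Continuous (Function.uncurry F)) (a b : ℝ) : Continuous fun x => ∫ t in a..b, F x t :=
  intervalIntegral.continuous_parametric_intervalIntegral_of_continuous' hF a b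

lemma intervalIntegral_add_mul {F G : ℝ → ℂ} (hF : Continuous F) (hG : Continuous G) (c : ℂ)
    (a b : ℝ) : ∫ t in a..b, (F t + c * G t) = (∫ t in a..b, F t) + c * ∫ t in a..b, G t := by
  rw [← intervalIntegral.integral_const_mul]
  exact intervalIntegral.integral_add (hF.intervalIntegrable _ _)
    ((continuous_const.mul hG).intervalIntegrable _ _)

lemma norm_integral_integral_le_of_log_le {R C B : ℝ} (hR : 0 ≤ R) {F : ℝ → ℝ → ℂ}
    (hF : ∀ a b, 0 < a → 0 < b → ‖F a b‖ ≤ (C + |Real.log a| + |Real.log b|) * B) :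
    ‖∫ a in (0 : ℝ)..R, ∫ b in (0 : ℝ)..R, F a b‖ ≤
      (R * (R * C) + 2 * (R * ∫ t in (0 : ℝ)..R, |Real.log t|)) * B := by
  have hlog : IntervalIntegrable (fun t => |Real.log t|) volume 0 R :=
    intervalIntegral.intervalIntegrable_log'.abs
  have inner : ∀ a, 0 < a → ‖∫ b in (0 : ℝ)..R, F a b‖ ≤
      ((R * C + ∫ t in (0 : ℝ)..R, |Real.log t|) + R * |Real.log a|) * B := by
    intro a ha
    refine (intervalIntegral.norm_integral_le_of_norm_le hR (g := fun b =>
      ((C + |Real.log a|) + |Real.log b|) * B) ?_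
      ((intervalIntegrable_const.add hlog).mul_const B)).trans_eq ?_
    · filter_upwards with b hb using hF a b ha hb.1
    · rw [intervalIntegral.integral_mul_const,
        intervalIntegral.integral_add intervalIntegrable_const hlog,
        intervalIntegral.integral_const]
      simp only [smul_eq_mul]; ring
  refine (intervalIntegral.norm_integral_le_of_norm_le hR (g := fun a =>
    ((R * C + ∫ t in (0 : ℝ)..R, |Real.log t|) + R * |Real.log a|) * B) ?_
      ((intervalIntegrable_const.add (hlog.const_mul R)).mul_const B)).trans_eq ?_
  · filter_upwards with a ha using inner a ha.1
  · rw [intervalIntegral.integral_mul_const,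
      intervalIntegral.integral_add intervalIntegrable_const (hlog.const_mul R),
      intervalIntegral.integral_const, intervalIntegral.integral_const_mul]
    simp only [smul_eq_mul]; ring

/-- The model oscillatory integral to which the trilinear form reduces. -/
noncomputable def chirpIntegral (R : ℝ) (f : ℝ × ℝ × ℝ → ℂ) (N u : ℝ) : ℂ :=
  ∫ z in -R..R, (N * ch (N ^ 2 * (z - u) ^ 2)) *
    ∫ a in (0 : ℝ)..R, ∫ b in (0 : ℝ)..R,
      ((N ^ 2 : ℝ) * ch (2 * (N ^ 2 * (a * b)))) * f (z, a, b)

namespace SmoothInBox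

variable {R : ℝ} {f : ℝ × ℝ × ℝ → ℂ}

lemma integral_mixed (hf : SmoothInBox R f) (z : ℝ) :
    ∫ a in (0 : ℝ)..R, ∫ b in (0 : ℝ)..R,
      fderiv ℝ (fun p => fderiv ℝ f p (0, 0, 1)) (z, a, b) (0, 1, 0) = f (z, 0, 0) := by
  have hfb := hf.fderiv_apply (0, 0, 1)
  have hfab := hfb.fderiv_apply (0, 1, 0)
  have hRabs : R ≤ |R| := le_abs_self R
  rw [intervalIntegral_swap_of_continuous
    (F := fun a b => fderiv ℝ (fun p => fderiv ℝ f p (0, 0, 1)) (z, a, b) (0, 1, 0))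
    (hfab.continuous.comp (by fun_prop : Continuous fun q : ℝ × ℝ => (z, q.1, q.2)))]
  have h1 : ∀ b, ∫ a in (0 : ℝ)..R,
      fderiv ℝ (fun p => fderiv ℝ f p (0, 0, 1)) (z, a, b) (0, 1, 0) =
        -fderiv ℝ f (z, 0, b) (0, 0, 1) := by
    intro b
    rw [intervalIntegral.integral_eq_sub_of_hasDerivAt (fun a _ => hfb.hasDerivAt_snd z a b)
      ((hfab.continuous.comp (by fun_prop : Continuous fun a : ℝ => (z, a, b))).intervalIntegrable
        _ _), hfb.eq_zero_snd hRabs, zero_sub]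
  simp only [h1]
  rw [intervalIntegral.integral_neg,
    intervalIntegral.integral_eq_sub_of_hasDerivAt (fun b _ => hf.hasDerivAt_trd z 0 b)
      ((hfb.continuous.comp
        (by fun_prop : Continuous fun b : ℝ => (z, (0 : ℝ), b))).intervalIntegrable _ _), hf.eq_zero_trd hRabs]
  ring

lemma integral_hyperbolic_add (hR : 1 ≤ R) (hf : SmoothInBox R f) (l z : ℝ) (c : ℂ) :
    (∫ a in (0 : ℝ)..R, ∫ b in (0 : ℝ)..R, (l * ch (2 * (l * (a * b)))) * f (z, a, b)) +
      c * f (z, 0, 0) =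
      ∫ a in (0 : ℝ)..R, ∫ b in (0 : ℝ)..R, (logInt (l * (a * b)) + c) *
        fderiv ℝ (fun p => fderiv ℝ f p (0, 0, 1)) (z, a, b) (0, 1, 0) := by
  have hfab := (hf.fderiv_apply (0, 0, 1)).fderiv_apply (0, 1, 0)
  have hG : Continuous fun q : ℝ × ℝ =>
      fderiv ℝ (fun p => fderiv ℝ f p (0, 0, 1)) (z, q.1, q.2) (0, 1, 0) :=
    hfab.continuous.comp (by fun_prop : Continuous fun q : ℝ × ℝ => (z, q.1, q.2))
  have hF : Continuous fun q : ℝ × ℝ => logInt (l * (q.1 * q.2)) *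
      fderiv ℝ (fun p => fderiv ℝ f p (0, 0, 1)) (z, q.1, q.2) (0, 1, 0) :=
    (continuous_logInt.comp (by fun_prop)).mul hG
  rw [integral_hyperbolic hR hf, ← integral_mixed hf z,
    ← intervalIntegral_add_mul (continuous_intervalIntegral hF _ _)
      (continuous_intervalIntegral hG _ _)]
  refine intervalIntegral.integral_congr fun a _ => ?_
  refine (intervalIntegral_add_mul (hF.comp (by fun_prop : Continuous fun b : ℝ => (a, b)))
    (hG.comp (by fun_prop : Continuous fun b : ℝ => (a, b))) c 0 R).symm.trans ?_
  simp only [Function.comp_def, add_mul]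

lemma exists_chirpIntegral_add_log_le (hR : 1 ≤ R) (hf : SmoothInBox R f) (k : ℕ) :
    ∃ C : ℝ, 0 ≤ C ∧ ∀ N u : ℝ, 1 ≤ N →
      ‖chirpIntegral R f N u + Real.log (N ^ 2) / (4 * π * Complex.I) *
        ∫ z in -R..R, (N * ch (N ^ 2 * (z - u) ^ 2)) * f (z, 0, 0)‖ ≤ C * ((1 + |u|)⁻¹) ^ k := by
  have hfab := (hf.fderiv_apply (0, 0, 1)).fderiv_apply (0, 1, 0)
  obtain ⟨C₁, hC₁0, hC₁⟩ := exists_norm_logInt_sub_le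
  obtain ⟨C₂, hC₂0, hC₂⟩ := exists_stationary_bound hR hfab k
  have hK : 0 ≤ ∫ t in (0 : ℝ)..R, |Real.log t| :=
    intervalIntegral.integral_nonneg (by linarith) fun t _ => abs_nonneg _
  set K := R * (R * C₁) + 2 * (R * ∫ t in (0 : ℝ)..R, |Real.log t|)
  refine ⟨C₂ * K, by positivity, fun N u hN => ?_⟩
  set c : ℂ := Real.log (N ^ 2) / (4 * π * Complex.I)
  set B := C₂ * ((1 + |u|)⁻¹) ^ k
  have hB : 0 ≤ B := by positivity
  have hch : Continuous fun z : ℝ => (N * ch (N ^ 2 * (z - u) ^ 2) : ℂ) :=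
    continuous_const.mul (continuous_ch.comp (by fun_prop))
  have hlog : Continuous fun q : ℝ × ℝ => logInt (N ^ 2 * (q.1 * q.2)) + c :=
    (continuous_logInt.comp (by fun_prop)).add continuous_const
  have hin : Continuous fun z : ℝ => ∫ a in (0 : ℝ)..R, ∫ b in (0 : ℝ)..R,
      ((N ^ 2 : ℝ) * ch (2 * (N ^ 2 * (a * b)))) * f (z, a, b) := by
    refine continuous_intervalIntegral (F := fun z a => ∫ b in (0 : ℝ)..R,
      ((N ^ 2 : ℝ) * ch (2 * (N ^ 2 * (a * b)))) * f (z, a, b)) ?_ _ _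
    refine continuous_intervalIntegral (X := ℝ × ℝ) (F := fun q b =>
      ((N ^ 2 : ℝ) * ch (2 * (N ^ 2 * (q.2 * b)))) * f (q.1, q.2, b)) ?_ _ _
    exact (continuous_const.mul (continuous_ch.comp (by fun_prop))).mul
      (hf.continuous.comp (by fun_prop))
  have key : chirpIntegral R f N u + c *
      ∫ z in -R..R, (N * ch (N ^ 2 * (z - u) ^ 2)) * f (z, 0, 0) =
      ∫ a in (0 : ℝ)..R, ∫ b in (0 : ℝ)..R, (logInt (N ^ 2 * (a * b)) + c) *
        ∫ z in -R..R, (N * ch (N ^ 2 * (z - u) ^ 2)) *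
          fderiv ℝ (fun p => fderiv ℝ f p (0, 0, 1)) (z, a, b) (0, 1, 0) := by
    rw [chirpIntegral]
    refine (intervalIntegral_add_mul (hch.mul hin) (hch.mul (hf.continuous.comp
      (by fun_prop : Continuous fun z : ℝ => (z, (0 : ℝ), (0 : ℝ))))) c (-R) R).symm.trans ?_
    have : ∀ z : ℝ, (N * ch (N ^ 2 * (z - u) ^ 2)) * (∫ a in (0 : ℝ)..R, ∫ b in (0 : ℝ)..R,
        ((N ^ 2 : ℝ) * ch (2 * (N ^ 2 * (a * b)))) * f (z, a, b)) +
        c * ((N * ch (N ^ 2 * (z - u) ^ 2)) * f (z, 0, 0)) =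
        ∫ a in (0 : ℝ)..R, ∫ b in (0 : ℝ)..R, (logInt (N ^ 2 * (a * b)) + c) *
          ((N * ch (N ^ 2 * (z - u) ^ 2)) *
            fderiv ℝ (fun p => fderiv ℝ f p (0, 0, 1)) (z, a, b) (0, 1, 0)) := by
      intro z
      rw [mul_left_comm c, ← mul_add, integral_hyperbolic_add hR hf,
        ← intervalIntegral.integral_const_mul]
      refine intervalIntegral.integral_congr fun a _ => ?_
      rw [← intervalIntegral.integral_const_mul]
      refine intervalIntegral.integral_congr fun b _ => ?_
      ring
    simp only [Pi.mul_apply, Function.comp_def, this]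
    rw [intervalIntegral_swap_three]
    · simp only [intervalIntegral.integral_const_mul]
    · refine (hlog.comp (by fun_prop : Continuous fun p : ℝ × ℝ × ℝ => (p.2.1, p.2.2))).mul
        ((hch.comp continuous_fst).mul (hfab.continuous))
  rw [key]
  refine (norm_integral_integral_le_of_log_le (C := C₁) (B := B) (by linarith)
    fun a b ha hb => ?_).trans_eq ?_
  · rw [norm_mul]
    exact mul_le_mul (hC₁ _ _ _ (one_le_pow₀ hN) ha hb) (hC₂ N u a b hN) (norm_nonneg _)
      (by positivity)
  · simp only [B, K]; ring

lemma exists_norm_chirpIntegral_le (hR : 1 ≤ R) (hf : SmoothInBox R f) (k : ℕ) :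
    ∃ C : ℝ, 0 < C ∧ ∀ N u : ℝ, 3 ≤ N →
      ‖chirpIntegral R f N u‖ ≤ C * Real.log N * ((1 + |u|)⁻¹) ^ k := by
  obtain ⟨C₁, hC₁0, hC₁⟩ := exists_chirpIntegral_add_log_le hR hf k
  obtain ⟨C₂, hC₂0, hC₂⟩ := exists_stationary_bound hR hf k
  refine ⟨C₁ + 2 * C₂ + 1, by positivity, fun N u hN => ?_⟩
  have h1 := hC₁ N u (by linarith)
  have h2 := hC₂ N u 0 0 (by linarith)
  have hlog : 1 ≤ Real.log N := by
    rw [Real.le_log_iff_exp_le (by linarith)]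
    exact (Real.exp_one_lt_d9.le.trans (by norm_num)).trans hN
  set W := ((1 + |u|)⁻¹) ^ k
  have hW : 0 ≤ W := by positivity
  set S := ∫ z in -R..R, (N * ch (N ^ 2 * (z - u) ^ 2)) * f (z, 0, 0)
  have h3 : ‖(Real.log (N ^ 2) / (4 * π * Complex.I) : ℂ)‖ ≤ 2 * Real.log N := by
    rw [div_eq_mul_inv, norm_mul, Complex.norm_real, Real.norm_eq_abs, Real.log_pow,
      abs_of_nonneg (by push_cast; linarith)]
    push_cast
    exact mul_le_of_le_one_right (by linarith) norm_four_pi_I_inv_le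
  have h4 : ‖(Real.log (N ^ 2) / (4 * π * Complex.I) : ℂ) * S‖ ≤ 2 * Real.log N * (C₂ * W) := by
    rw [norm_mul]
    exact mul_le_mul h3 h2 (norm_nonneg _) (by linarith)
  have h5 := norm_sub_le (chirpIntegral R f N u + Real.log (N ^ 2) / (4 * π * Complex.I) * S)
    (Real.log (N ^ 2) / (4 * π * Complex.I) * S)
  rw [add_sub_cancel_right] at h5
  have h6 : C₁ * W ≤ Real.log N * (C₁ * W) := le_mul_of_one_le_left (by positivity) hlog
  have h7 : 0 ≤ Real.log N * W := by positivity
  linarith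

lemma exists_le_norm_chirpIntegral (hR : 1 ≤ R) (hf : SmoothInBox R f) {u₀ : ℝ}
    (hu : f (u₀, 0, 0) ≠ 0) :
    ∃ c δ N₀ : ℝ, 0 < c ∧ 0 < δ ∧ 1 ≤ N₀ ∧ ∀ N u : ℝ, N₀ ≤ N → |u - u₀| < δ →
      c * Real.log N ≤ ‖chirpIntegral R f N u‖ := by
  obtain ⟨C₁, hC₁0, hC₁⟩ := exists_chirpIntegral_add_log_le hR hf 0
  obtain ⟨c, hc⟩ := exists_tendsto_fresnel
  have hc0 := fresnel_limit_ne_zero hc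
  have hint : ∀ {g : ℝ × ℝ × ℝ → ℂ}, SmoothInBox R g → Integrable fun z : ℝ => g (z, 0, 0) := by
    intro g hg
    refine (hg.continuous.comp
      (by fun_prop : Continuous fun z : ℝ => (z, (0 : ℝ), (0 : ℝ)))).integrable_of_hasCompactSupport
      (HasCompactSupport.intro (isCompact_Icc (a := -R) (b := R)) fun z hz => ?_)
    exact hg.eq_zero_fst (le_of_lt (lt_of_not_ge fun h => hz (abs_le.1 h)))
  have hlim := tendsto_integral_ch_mul hc (fun z => hf.hasDerivAt_fst z 0 0) (hint hf)
    (hint (hf.fderiv_apply (1, 0, 0))) u₀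
  have hL : 0 < ‖2 * c * f (u₀, 0, 0)‖ := by
    rw [norm_pos_iff]
    exact mul_ne_zero (mul_ne_zero two_ne_zero hc0) hu
  set L := ‖2 * c * f (u₀, 0, 0)‖
  have hev := hlim.norm.eventually (lt_mem_nhds (half_lt_self hL))
  rw [((atTop_basis (α := ℝ)).prod (Metric.nhds_basis_ball (x := u₀))).eventually_iff] at hev
  obtain ⟨⟨N₁, δ⟩, ⟨-, hδ⟩, hN₁⟩ := hev
  have hev2 : ∀ᶠ N : ℝ in atTop, C₁ ≤ L / (8 * π) * Real.log N :=
    (Real.tendsto_log_atTop.const_mul_atTop (by positivity)).eventually_ge_atTop C₁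
  obtain ⟨N₂, hN₂⟩ := eventually_atTop.1 hev2
  refine ⟨L / (8 * π), δ, max 1 (max N₁ N₂), by positivity, hδ, le_max_left _ _,
    fun N u hN hu => ?_⟩
  obtain ⟨h1N, h2N, h3N⟩ : 1 ≤ N ∧ N₁ ≤ N ∧ N₂ ≤ N := by simpa using hN
  have h1 := hC₁ N u h1N
  have h2 : L / 2 < ‖∫ z : ℝ, (N * ch (N ^ 2 * (z - u) ^ 2)) * f (z, 0, 0)‖ :=
    hN₁ (show (N, u) ∈ Set.Ici N₁ ×ˢ Metric.ball u₀ δ from ⟨h2N, hu⟩)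
  have h3 := hN₂ N h3N
  have heq : ∫ z in -R..R, (N * ch (N ^ 2 * (z - u) ^ 2)) * f (z, 0, 0) =
      ∫ z : ℝ, (N * ch (N ^ 2 * (z - u) ^ 2)) * f (z, 0, 0) := by
    refine intervalIntegral.integral_eq_integral_of_support_subset fun z hz => ?_
    have : |z| < R := lt_of_not_ge fun h => hz (by simp [hf.eq_zero_fst h])
    exact ⟨(abs_lt.1 this).1, (abs_lt.1 this).2.le⟩
  rw [heq, pow_zero, mul_one] at h1
  set S := ∫ z : ℝ, (N * ch (N ^ 2 * (z - u) ^ 2)) * f (z, 0, 0)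
  have hlog : 0 ≤ Real.log N := Real.log_nonneg h1N
  have h4 : ‖(Real.log (N ^ 2) / (4 * π * Complex.I) : ℂ) * S‖ =
      Real.log N / (2 * π) * ‖S‖ := by
    rw [norm_mul, norm_div, Complex.norm_real, Real.norm_eq_abs, Real.log_pow,
      abs_of_nonneg (by push_cast; linarith)]
    simp [abs_of_pos Real.pi_pos]
    field_simp
    exact Or.inl (by ring)
  have h5 : Real.log N / (2 * π) * (L / 2) ≤ Real.log N / (2 * π) * ‖S‖ :=
    mul_le_mul_of_nonneg_left h2.le (by positivity)
  have h6 : Real.log N / (2 * π) * (L / 2) = 2 * (L / (8 * π) * Real.log N) := by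
    field_simp; norm_num
  have h7 := norm_sub_le (chirpIntegral R f N u + Real.log (N ^ 2) / (4 * π * Complex.I) * S)
    (chirpIntegral R f N u)
  rw [add_sub_cancel_left] at h7
  linarith

end SmoothInBox

lemma chiT_eq_div (ρ : ℝ → ℝ) (N x : ℝ) : chiT ρ N x = chiT ρ 1 (x / N) := by
  simp [chiT]

lemma chiT_one_eq_convolution (ρ : ℝ → ℝ) :
    chiT ρ 1 = convolution ρ (Set.indicator (Set.Icc (-1 : ℝ) 1) fun _ => (1 : ℝ))
      (ContinuousLinearMap.mul ℝ ℝ) volume := by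
  ext x
  simp [chiT, convolution]

lemma integrable_indicator_Icc :
    Integrable (Set.indicator (Set.Icc (-1 : ℝ) 1) fun _ => (1 : ℝ)) :=
  (integrable_indicator_iff measurableSet_Icc).2 (by simp)

lemma contDiff_chiT_one {ρ : ℝ → ℝ} (hs : ContDiff ℝ (⊤ : ℕ∞) ρ) (hc : HasCompactSupport ρ) :
    ContDiff ℝ (⊤ : ℕ∞) (chiT ρ 1) := by
  rw [chiT_one_eq_convolution]
  exact hc.contDiff_convolution_left _ hs integrable_indicator_Icc.locallyIntegrable

lemma hasCompactSupport_chiT_one {ρ : ℝ → ℝ} (hc : HasCompactSupport ρ) :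
    HasCompactSupport (chiT ρ 1) := by
  rw [chiT_one_eq_convolution]
  exact hc.convolution _ (HasCompactSupport.intro isCompact_Icc fun x hx =>
    Set.indicator_of_notMem hx _)

lemma exists_chiT_one_ne_zero {ρ : ℝ → ℝ} (hi : ∫ x, ρ x = 1) : ∃ u, chiT ρ 1 u ≠ 0 := by
  by_contra! h
  have hρ : Integrable ρ := by
    by_contra hn
    rw [integral_undef hn] at hi
    exact zero_ne_one hi
  have := integral_convolution (ContinuousLinearMap.mul ℝ ℝ) hρ integrable_indicator_Icc
  rw [← chiT_one_eq_convolution, hi, integral_indicator measurableSet_Icc] at this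
  norm_num [h] at this

/-- The product of the three cutoffs in the coordinates `x₁ = N (z - b)`, `x₂ = N (z + a - b)`,
`x₃ = N (z + a)`. -/
noncomputable def cutoffProd (ρ : ℝ → ℝ) (p : ℝ × ℝ × ℝ) : ℂ :=
  (chiT ρ 1 (p.1 - p.2.2) * chiT ρ 1 (p.1 + p.2.1 - p.2.2) * chiT ρ 1 (p.1 + p.2.1) : ℝ)

lemma exists_smoothInBox_cutoffProd {ρ : ℝ → ℝ} (hs : ContDiff ℝ (⊤ : ℕ∞) ρ)
    (hc : HasCompactSupport ρ) : ∃ R, 1 ≤ R ∧ SmoothInBox R (cutoffProd ρ) := by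
  obtain ⟨M, hM0, hM⟩ := (hasCompactSupport_chiT_one hc).exists_pos_le_norm
  have hM' : ∀ y, chiT ρ 1 y ≠ 0 → |y| < M := fun y hy =>
    lt_of_not_ge fun h => hy (hM y h)
  refine ⟨3 * M + 1, by linarith, ?_, ?_⟩
  · have h := contDiff_chiT_one hs hc
    exact Complex.ofRealCLM.contDiff.comp (((h.comp (by fun_prop)).mul (h.comp (by fun_prop))).mul
      (h.comp (by fun_prop)))
  · have hcl : IsClosed {p : ℝ × ℝ × ℝ | |p.1| ≤ 3 * M ∧ |p.2.1| ≤ 3 * M ∧ |p.2.2| ≤ 3 * M} :=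
      (isClosed_le (f := fun p : ℝ × ℝ × ℝ => |p.1|) (by fun_prop) continuous_const).inter
        ((isClosed_le (f := fun p : ℝ × ℝ × ℝ => |p.2.1|) (by fun_prop) continuous_const).inter
          (isClosed_le (f := fun p : ℝ × ℝ × ℝ => |p.2.2|) (by fun_prop) continuous_const))
    refine (closure_minimal (fun p hp => ?_) hcl).trans fun p hp =>
      ⟨hp.1.trans_lt (by linarith), hp.2.1.trans_lt (by linarith), hp.2.2.trans_lt (by linarith)⟩
    have hp' : chiT ρ 1 (p.1 - p.2.2) * chiT ρ 1 (p.1 + p.2.1 - p.2.2) *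
        chiT ρ 1 (p.1 + p.2.1) ≠ 0 := fun h => hp (by simp only [cutoffProd, h, ofReal_zero])
    have h1 := abs_lt.1 (hM' _ (left_ne_zero_of_mul (left_ne_zero_of_mul hp')))
    have h2 := abs_lt.1 (hM' _ (right_ne_zero_of_mul (left_ne_zero_of_mul hp')))
    have h3 := abs_lt.1 (hM' _ (right_ne_zero_of_mul hp'))
    refine ⟨abs_le.2 ⟨?_, ?_⟩, abs_le.2 ⟨?_, ?_⟩, abs_le.2 ⟨?_, ?_⟩⟩ <;> linarith

lemma setIntegral_pi_three_eq {R : ℝ} (hR : 0 ≤ R) {H : ℝ × ℝ × ℝ → ℂ} (hH : Continuous H)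
    (h0 : ∀ p, ¬(|p.1| < R ∧ |p.2.1| < R ∧ |p.2.2| < R) → H p = 0) :
    ∫ v in {v : Fin 3 → ℝ | 0 < v 1 ∧ 0 < v 2}, H (v 0, v 1, v 2) =
      ∫ z in -R..R, ∫ a in (0 : ℝ)..R, ∫ b in (0 : ℝ)..R, H (z, a, b) := by
  have e1 := volume_preserving_piFinSuccAbove (fun _ : Fin 3 => ℝ) 0
  have e2 := (MeasurePreserving.id (volume : Measure ℝ)).prod (volume_preserving_finTwoArrow ℝ)
  have hemb : MeasurableEmbedding (Prod.map id (MeasurableEquiv.finTwoArrow (α := ℝ)) ∘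
      MeasurableEquiv.piFinSuccAbove (fun _ : Fin 3 => ℝ) 0) :=
    (((MeasurableEquiv.refl ℝ).prodCongr MeasurableEquiv.finTwoArrow).measurableEmbedding).comp
      (MeasurableEquiv.measurableEmbedding _)
  have h1 := (e2.comp e1).setIntegral_preimage_emb hemb H
    (Set.univ ×ˢ (Set.Ioi 0 ×ˢ Set.Ioi 0))
  have hset : (Prod.map id (MeasurableEquiv.finTwoArrow (α := ℝ)) ∘
      MeasurableEquiv.piFinSuccAbove (fun _ : Fin 3 => ℝ) 0) ⁻¹'
        (Set.univ ×ˢ (Set.Ioi 0 ×ˢ Set.Ioi 0)) = {v : Fin 3 → ℝ | 0 < v 1 ∧ 0 < v 2} := by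
    ext v
    simp [MeasurableEquiv.piFinSuccAbove, MeasurableEquiv.finTwoArrow, Fin.tail]
  rw [hset] at h1
  refine Eq.trans ?_ (h1.trans ?_)
  · rfl
  have hint : ∀ s : Set (ℝ × ℝ × ℝ), IntegrableOn H s := fun s => by
    refine (hH.integrable_of_hasCompactSupport (HasCompactSupport.intro
      ((isCompact_Icc (a := -R) (b := R)).prod ((isCompact_Icc (a := -R) (b := R)).prod
      (isCompact_Icc (a := -R) (b := R)))) fun p hp => h0 p fun h => hp ?_)).integrableOn
    exact ⟨abs_le.1 h.1.le, abs_le.1 h.2.1.le, abs_le.1 h.2.2.le⟩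
  rw [setIntegral_eq_of_subset_of_forall_sdiff_eq_zero
    (s := Set.Ioc (-R) R ×ˢ (Set.Ioc 0 R ×ˢ Set.Ioc 0 R))]
  · rw [intervalIntegral.integral_of_le (by linarith), setIntegral_prod _ (hint _)]
    refine setIntegral_congr_fun measurableSet_Ioc fun z _ => ?_
    rw [intervalIntegral.integral_of_le hR, Measure.volume_eq_prod, setIntegral_prod]
    · refine setIntegral_congr_fun measurableSet_Ioc fun a _ => ?_
      rw [intervalIntegral.integral_of_le hR]
    · refine (Continuous.integrableOn_Icc (μ := volume.prod volume)
        (f := fun q : ℝ × ℝ => H (z, q)) (a := ((0 : ℝ), (0 : ℝ))) (b := (R, R))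
        (by fun_prop)).mono_set ?_
      rw [← Set.Icc_prod_Icc]
      exact Set.prod_mono Set.Ioc_subset_Icc_self Set.Ioc_subset_Icc_self
  · exact MeasurableSet.univ.prod (measurableSet_Ioi.prod measurableSet_Ioi)
  · exact Set.prod_mono (Set.subset_univ _) (Set.prod_mono Set.Ioc_subset_Ioi_self
      Set.Ioc_subset_Ioi_self)
  · rintro ⟨z, a, b⟩ ⟨⟨-, ha, hb⟩, hn⟩
    refine h0 _ fun h => hn ?_
    exact ⟨⟨(abs_lt.1 h.1).1, (abs_lt.1 h.1).2.le⟩, ⟨ha, (abs_lt.1 h.2.1).2.le⟩,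
      ⟨hb, (abs_lt.1 h.2.2).2.le⟩⟩

/-- The linear change of variables `(z, a, b) ↦ N (z - b, z + a - b, z + a)`. -/
noncomputable def orderedCoords (N : ℝ) : (Fin 3 → ℝ) →L[ℝ] (Fin 3 → ℝ) :=
  LinearMap.toContinuousLinearMap
    (Matrix.toLin' !![N, 0, -N; N, N, -N; N, N, 0])

lemma orderedCoords_apply (N : ℝ) (v : Fin 3 → ℝ) :
    orderedCoords N v 0 = N * (v 0 - v 2) ∧ orderedCoords N v 1 = N * (v 0 + v 1 - v 2) ∧
      orderedCoords N v 2 = N * (v 0 + v 1) := by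
  refine ⟨?_, ?_, ?_⟩ <;>
    simp [orderedCoords, Matrix.mulVec, dotProduct, Fin.sum_univ_three] <;> ring

lemma det_orderedCoords (N : ℝ) : (orderedCoords N).det = N ^ 3 := by
  rw [orderedCoords, ContinuousLinearMap.det, LinearMap.coe_toContinuousLinearMap,
    LinearMap.det_toLin', Matrix.det_fin_three]
  simp
  ring

lemma setOf_strictMono_eq_image {N : ℝ} (hN : 0 < N) :
    {t : Fin 3 → ℝ | StrictMono t} = orderedCoords N '' {v | 0 < v 1 ∧ 0 < v 2} := by
  ext t
  constructor
  · intro ht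
    have h01 : t 0 < t 1 := ht (by decide)
    have h12 : t 1 < t 2 := ht (by decide)
    refine ⟨![(t 0 - t 1 + t 2) / N, (t 1 - t 0) / N, (t 2 - t 1) / N], ?_, ?_⟩
    · exact ⟨div_pos (sub_pos.2 h01) hN, div_pos (sub_pos.2 h12) hN⟩
    · obtain ⟨h0, h1, h2⟩ := orderedCoords_apply N
        ![(t 0 - t 1 + t 2) / N, (t 1 - t 0) / N, (t 2 - t 1) / N]
      ext i
      fin_cases i
      · refine h0.trans ?_
        simp; field_simp; ring
      · refine h1.trans ?_
        simp; field_simp; ring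
      · refine h2.trans ?_
        simp; field_simp; ring
  · rintro ⟨v, ⟨h1, h2⟩, rfl⟩
    obtain ⟨e0, e1, e2⟩ := orderedCoords_apply N v
    refine Fin.strictMono_iff_lt_succ.2 fun i => ?_
    fin_cases i
    · change orderedCoords N v 0 < orderedCoords N v 1
      rw [e0, e1]; exact mul_lt_mul_of_pos_left (by linarith) hN
    · change orderedCoords N v 1 < orderedCoords N v 2
      rw [e1, e2]; exact mul_lt_mul_of_pos_left (by linarith) hN

lemma injective_orderedCoords {N : ℝ} (hN : 0 < N) : Function.Injective (orderedCoords N) := by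
  have : LinearMap.det (orderedCoords N : (Fin 3 → ℝ) →ₗ[ℝ] (Fin 3 → ℝ)) ≠ 0 := by
    have := det_orderedCoords N
    rw [ContinuousLinearMap.det] at this
    rw [this]; positivity
  exact (LinearEquiv.ofIsUnitDet (f := (orderedCoords N : (Fin 3 → ℝ) →ₗ[ℝ] (Fin 3 → ℝ)))
    (v := Pi.basisFun ℝ (Fin 3)) (v' := Pi.basisFun ℝ (Fin 3))
    (by rw [LinearMap.det_toMatrix]; exact isUnit_iff_ne_zero.2 this)).injective

lemma gN_mul_eq (ρ : ℝ → ℝ) {N : ℝ} (hN : 0 < N) (s y : ℝ) :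
    gN ρ N s (N * y) = ch (s * (N * y) ^ 2) * chiT ρ 1 y := by
  rw [gN, chiT_eq_div, mul_div_cancel_left₀ _ hN.ne', ch]
  congr 2; push_cast; ring

lemma Tfef_gN_eq {ρ : ℝ → ℝ} {R N : ℝ} (hN : 0 < N) (hR : 1 ≤ R)
    (hf : SmoothInBox R (cutoffProd ρ)) (x : ℝ) :
    Tfef (gN ρ N 1) (gN ρ N (-1)) (gN ρ N 1) x =
      ch (-(N ^ 2 * (-x / (2 * N)) ^ 2)) *
        chirpIntegral R (cutoffProd ρ) N (-x / (2 * N)) := by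
  set u := -x / (2 * N) with hu
  have hx : x = -(2 * N * u) := by rw [hu]; field_simp
  have hmeas : MeasurableSet {v : Fin 3 → ℝ | 0 < v 1 ∧ 0 < v 2} :=
    (measurableSet_lt measurable_const (measurable_pi_apply 1)).inter
      (measurableSet_lt measurable_const (measurable_pi_apply 2))
  rw [Tfef, setOf_strictMono_eq_image hN,
    integral_image_eq_integral_abs_det_fderiv_smul (s := {v : Fin 3 → ℝ | 0 < v 1 ∧ 0 < v 2})
      (f' := fun _ => orderedCoords N) volume
      hmeas
      (fun v _ => (orderedCoords N).hasFDerivAt.hasFDerivWithinAt)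
      (injective_orderedCoords hN).injOn]
  set H : ℝ × ℝ × ℝ → ℂ := fun p => ch (N ^ 2 * (p.1 - u) ^ 2) *
    (ch (2 * (N ^ 2 * (p.2.1 * p.2.2))) * cutoffProd ρ p) with hHdef
  have hHc : Continuous H := (continuous_ch.comp (by fun_prop)).mul
    ((continuous_ch.comp (by fun_prop)).mul hf.continuous)
  have hH0 : ∀ p : ℝ × ℝ × ℝ, ¬(|p.1| < R ∧ |p.2.1| < R ∧ |p.2.2| < R) → H p = 0 := fun p hp => by
    simp only [hHdef, hf.eq_zero hp, mul_zero]
  have hpt : ∀ v : Fin 3 → ℝ, |(orderedCoords N).det| • (gN ρ N 1 (orderedCoords N v 0) *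
      gN ρ N (-1) (orderedCoords N v 1) * gN ρ N 1 (orderedCoords N v 2) *
      Complex.exp (2 * π * Complex.I * x * (orderedCoords N v 0 - orderedCoords N v 1 +
        orderedCoords N v 2))) =
      (ch (-(N ^ 2 * u ^ 2)) * (N ^ 3 : ℝ)) * H (v 0, v 1, v 2) := by
    intro v
    obtain ⟨e0, e1, e2⟩ := orderedCoords_apply N v
    have hexp : Complex.exp (2 * π * Complex.I * x * (orderedCoords N v 0 - orderedCoords N v 1 +
        orderedCoords N v 2)) = ch (x * (N * v 0)) := by
      rw [ch, e0, e1, e2]; congr 1; push_cast; ring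
    have hphase : ch (1 * (N * (v 0 - v 2)) ^ 2) * ch (-1 * (N * (v 0 + v 1 - v 2)) ^ 2) *
        ch (1 * (N * (v 0 + v 1)) ^ 2) * ch (x * (N * v 0)) = ch (-(N ^ 2 * u ^ 2)) *
          (ch (N ^ 2 * (v 0 - u) ^ 2) * ch (2 * (N ^ 2 * (v 1 * v 2)))) := by
      simp only [← ch_add]
      congr 1
      rw [hx]; ring
    rw [hexp, e0, e1, e2, gN_mul_eq ρ hN, gN_mul_eq ρ hN, gN_mul_eq ρ hN, det_orderedCoords,
      abs_of_pos (by positivity), Complex.real_smul]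
    simp only [hHdef, cutoffProd]
    push_cast at hphase ⊢
    linear_combination (N ^ 3 * chiT ρ 1 (v 0 - v 2) * chiT ρ 1 (v 0 + v 1 - v 2) *
      chiT ρ 1 (v 0 + v 1) : ℂ) * hphase
  simp only [hpt]
  rw [integral_const_mul, setIntegral_pi_three_eq (by linarith) hHc hH0, mul_assoc, chirpIntegral,
    ← intervalIntegral.integral_const_mul]
  congr 1
  refine intervalIntegral.integral_congr fun z _ => ?_
  simp only [hHdef, mul_assoc, intervalIntegral.integral_const_mul]
  push_cast
  ring

lemma ofReal_mul_rpow_le_eLpNorm {q : ℝ} (hq : 0 < q) {f : ℝ → ℂ} {A a b : ℝ} (hA : 0 ≤ A)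
    (hab : a ≤ b) (hf : ∀ x ∈ Set.Ioo a b, A ≤ ‖f x‖) :
    ENNReal.ofReal (A * (b - a) ^ (1 / q)) ≤ eLpNorm f (ENNReal.ofReal q) volume := by
  have h := eLpNorm_indicator_const (c := A) (μ := (volume : Measure ℝ)) (p := ENNReal.ofReal q)
    (measurableSet_Ioo (a := a) (b := b)) (by simpa using hq) ENNReal.ofReal_ne_top
  rw [ENNReal.toReal_ofReal hq.le, Real.volume_Ioo, Real.enorm_eq_ofReal hA,
    ENNReal.ofReal_rpow_of_nonneg (sub_nonneg.2 hab) (by positivity), ← ENNReal.ofReal_mul hA] at h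
  rw [← h]
  refine eLpNorm_mono fun x => ?_
  by_cases hx : x ∈ Set.Ioo a b
  · rw [Set.indicator_of_mem hx, Real.norm_of_nonneg hA]
    exact hf x hx
  · rw [Set.indicator_of_notMem hx, norm_zero]
    exact norm_nonneg _

lemma exists_eLpNorm_le_of_decay {q : ℝ} (hq : 0 < q) {k : ℕ} (hk : 1 < k * q) :
    ∃ K : ℝ, 0 < K ∧ ∀ (f : ℝ → ℂ) (A M : ℝ), 0 ≤ A → 0 < M →
      (∀ x, ‖f x‖ ≤ A * ((1 + |x / M|)⁻¹) ^ k) →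
      eLpNorm f (ENNReal.ofReal q) volume ≤ ENNReal.ofReal (A * (K * M ^ (1 / q))) := by
  have hint : Integrable fun y : ℝ => (1 + ‖y‖) ^ (-(k * q)) :=
    integrable_one_add_norm (by simpa using hk)
  set W := ∫ y : ℝ, (1 + ‖y‖) ^ (-(k * q)) with hWdef
  have hW : 0 ≤ W := integral_nonneg fun y => by positivity
  refine ⟨(W + 1) ^ (1 / q), by positivity, fun f A M hA hM hf => ?_⟩
  refine (eLpNorm_mono_real hf).trans ?_
  rw [eLpNorm_eq_lintegral_rpow_enorm_toReal (by simpa using hq) ENNReal.ofReal_ne_top,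
    ENNReal.toReal_ofReal hq.le]
  have hpt : ∀ x : ℝ, ‖A * ((1 + |x / M|)⁻¹) ^ k‖ₑ ^ q =
      ENNReal.ofReal (A ^ q * (1 + ‖x / M‖) ^ (-(k * q))) := by
    intro x
    have h1 : 0 ≤ 1 + |x / M| := by positivity
    rw [Real.enorm_eq_ofReal (by positivity), ENNReal.ofReal_rpow_of_nonneg (by positivity) hq.le,
      Real.mul_rpow hA (by positivity), ← Real.rpow_natCast, ← Real.rpow_mul (by positivity),
      Real.inv_rpow h1, ← Real.rpow_neg h1, Real.norm_eq_abs]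
  simp only [hpt]
  rw [← ofReal_integral_eq_lintegral_ofReal ((hint.comp_div hM.ne').const_mul _)
    (Eventually.of_forall fun x => by positivity), integral_const_mul,
    Measure.integral_comp_div (fun y : ℝ => (1 + ‖y‖) ^ (-(k * q))), ← hWdef, smul_eq_mul,
    abs_of_pos hM, ENNReal.ofReal_rpow_of_nonneg (by positivity) (by positivity)]
  refine ENNReal.ofReal_le_ofReal ?_
  rw [Real.mul_rpow (by positivity) (by positivity), Real.mul_rpow hM.le hW, ← Real.rpow_mul hA,
    mul_one_div_cancel hq.ne', Real.rpow_one, mul_comm (M ^ (1 / q))]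
  gcongr
  linarith

/-- Fefferman-type lower (and upper) bound
`‖T(g_N^+, g_N^-, g_N^+)‖_{L^q} ≃ (log N) N^{1/q}`. -/
theorem stmt5 (ρ : ℝ → ℝ) (hρs : ContDiff ℝ (⊤ : ℕ∞) ρ) (hρc : HasCompactSupport ρ)
    (hρ0 : ∀ x, 0 ≤ ρ x) (hρ1 : ∫ x, ρ x = 1) (q : ℝ) (hq : 0 < q) :
    ∃ c C N₀ : ℝ, 0 < c ∧ 0 < C ∧ 1 ≤ N₀ ∧ ∀ N : ℝ, N₀ ≤ N →
      ENNReal.ofReal (c * Real.log N * N ^ (1 / q)) ≤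
          eLpNorm (Tfef (gN ρ N 1) (gN ρ N (-1)) (gN ρ N 1)) (ENNReal.ofReal q) volume ∧
        eLpNorm (Tfef (gN ρ N 1) (gN ρ N (-1)) (gN ρ N 1)) (ENNReal.ofReal q) volume ≤
          ENNReal.ofReal (C * Real.log N * N ^ (1 / q)) := by
  obtain ⟨R, hR, hf⟩ := exists_smoothInBox_cutoffProd hρs hρc
  obtain ⟨u₀, hu₀⟩ := exists_chiT_one_ne_zero hρ1
  have hF : cutoffProd ρ (u₀, 0, 0) ≠ 0 := by simp [cutoffProd, hu₀]
  obtain ⟨c, δ, N₁, hc, hδ, hN₁, hlow⟩ := hf.exists_le_norm_chirpIntegral hR hF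
  obtain ⟨k, hk⟩ := exists_nat_gt (1 / q)
  rw [div_lt_iff₀ hq] at hk
  obtain ⟨C, hC, hup⟩ := hf.exists_norm_chirpIntegral_le hR k
  obtain ⟨K, hK, hdecay⟩ := exists_eLpNorm_le_of_decay hq hk
  have hnorm : ∀ N x : ℝ, 0 < N → ‖Tfef (gN ρ N 1) (gN ρ N (-1)) (gN ρ N 1) x‖ =
      ‖chirpIntegral R (cutoffProd ρ) N (-x / (2 * N))‖ := fun N x hN => by
    rw [Tfef_gN_eq hN hR hf, norm_mul, norm_ch, one_mul]
  refine ⟨c * (4 * δ) ^ (1 / q), C * (K * 2 ^ (1 / q)), max N₁ 3, by positivity, by positivity,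
    hN₁.trans (le_max_left _ _), fun N hN => ?_⟩
  obtain ⟨h1, h3⟩ := max_le_iff.1 hN
  have hN0 : 0 < N := by linarith
  have hlog : 0 ≤ Real.log N := Real.log_nonneg (by linarith)
  constructor
  · have h := ofReal_mul_rpow_le_eLpNorm hq (f := Tfef (gN ρ N 1) (gN ρ N (-1)) (gN ρ N 1))
      (A := c * Real.log N) (a := -(2 * N * (u₀ + δ))) (b := -(2 * N * (u₀ - δ))) (by positivity)
      (by nlinarith) fun x hx => by
        rw [hnorm N x hN0]
        refine hlow N _ h1 (abs_lt.2 ⟨?_, ?_⟩)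
        · rw [lt_sub_iff_add_lt, lt_div_iff₀ (by positivity)]
          linarith [hx.2]
        · rw [sub_lt_iff_lt_add, div_lt_iff₀ (by positivity)]
          linarith [hx.1]
    refine (ENNReal.ofReal_le_ofReal (le_of_eq ?_)).trans h
    rw [show -(2 * N * (u₀ - δ)) - -(2 * N * (u₀ + δ)) = 4 * δ * N by ring,
      Real.mul_rpow (by positivity) hN0.le]
    ring
  · refine (hdecay _ (C * Real.log N) (2 * N) (by positivity) (by positivity) fun x => ?_).trans
      (ENNReal.ofReal_le_ofReal (le_of_eq ?_))
    · rw [hnorm N x hN0, ← abs_neg (x / (2 * N)), ← neg_div]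
      exact hup N _ h3
    · rw [Real.mul_rpow (by positivity) hN0.le]
      ring
end

section
/- Let F_c denote the class of Schwartz functions on ℝ whose Fourier transform has compact support. For all exponents p, q, r ≥ 1 the operator C_3^{(1,−1,1)} is not bounded from (F_c ∩ L^p) × (F_c ∩ L^q) × (F_c ∩ L^r) into L^{1/(1/p+1/q+1/r)}: for every constant C > 0 there exist f, g, h ∈ F_c with ‖C_3^{(1,−1,1)}(f,g,h)‖_{L^{1/(1/p+1/q+1/r)}(ℝ)} > C ‖f‖_{L^p} ‖g‖_{L^q} ‖h‖_{L^r}. -/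
open MeasureTheory Complex
open scoped FourierTransform Real ENNReal

/-- The multilinear oscillatory integral operator `C_n^ε`. -/
noncomputable def Cop {n : ℕ} (ε : Fin n → ℝ) (f : Fin n → ℝ → ℂ) (x : ℝ) : ℂ :=
  ∫ t in {t : Fin n → ℝ | StrictMono t},
    (∏ i, 𝓕 (f i) (t i)) * Complex.exp (2 * π * Complex.I * x * ∑ i, ε i * t i)

/-- Second-order integration by parts against a purely imaginary exponential on a half-line. -/
theorem norm_integral_exp_mul_add_le {θ : ℂ} (hθ : θ ≠ 0) (hθre : θ.re = 0) {W W₁ W₂ : ℝ → ℂ}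
    (hW : ∀ v, HasDerivAt W (W₁ v) v) (hW₁ : ∀ v, HasDerivAt W₁ (W₂ v) v)
    (hi : IntegrableOn W (Set.Ioi 0)) (hi₂ : IntegrableOn W₂ (Set.Ioi 0))
    (hl : Filter.Tendsto W Filter.atTop (nhds 0))
    (hl₁ : Filter.Tendsto W₁ Filter.atTop (nhds 0)) :
    ‖(∫ v in Set.Ioi (0 : ℝ), cexp (θ * v) * W v) + W 0 / θ‖
      ≤ (‖W₁ 0‖ + ∫ v in Set.Ioi (0 : ℝ), ‖W₂ v‖) / ‖θ‖ ^ 2 := by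
  have hn : ∀ v : ℝ, ‖cexp (θ * v)‖ = 1 := fun v => by simp [Complex.norm_exp, hθre]
  have hc : Continuous fun v : ℝ => cexp (θ * v) := by fun_prop
  have hmul : ∀ {G : ℝ → ℂ}, IntegrableOn G (Set.Ioi 0) →
      IntegrableOn (fun v : ℝ => cexp (θ * v) * G v) (Set.Ioi 0) := fun {G} hG =>
    Integrable.bdd_mul (c := 1) hG hc.aestronglyMeasurable
      (Filter.Eventually.of_forall fun v => (hn v).le)
  have hder : ∀ v : ℝ, HasDerivAt (fun v : ℝ => cexp (θ * v) * (W v / θ - W₁ v / θ ^ 2))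
      (cexp (θ * v) * W v - θ⁻¹ ^ 2 * (cexp (θ * v) * W₂ v)) v := by
    intro v
    have h1 : HasDerivAt (fun v : ℝ => cexp (θ * v)) (cexp (θ * v) * θ) v := by
      have := ((hasDerivAt_id v).ofReal_comp.const_mul θ).cexp
      simpa using this
    refine (h1.mul (((hW v).div_const θ).sub ((hW₁ v).div_const (θ ^ 2)))).congr_deriv ?_
    simp only [Pi.sub_apply]
    field_simp
    ring
  have hint := integral_Ioi_of_hasDerivAt_of_tendsto (a := (0 : ℝ)) (m := (0 : ℂ))
    (hder 0).continuousAt.continuousWithinAt (fun v _ => hder v)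
    ((hmul hi).sub ((hmul hi₂).const_mul _)) (by
      have h0 : Filter.Tendsto (fun v => W v / θ - W₁ v / θ ^ 2) Filter.atTop (nhds 0) := by
        simpa using (hl.div_const θ).sub (hl₁.div_const (θ ^ 2))
      rw [tendsto_zero_iff_norm_tendsto_zero] at h0 ⊢
      refine h0.congr fun v => ?_
      rw [norm_mul, hn, one_mul])
  rw [integral_sub (hmul hi) ((hmul hi₂).const_mul _), integral_const_mul] at hint
  have e : (∫ v in Set.Ioi (0 : ℝ), cexp (θ * v) * W v) + W 0 / θ
      = θ⁻¹ ^ 2 * (W₁ 0 + ∫ v in Set.Ioi (0 : ℝ), cexp (θ * v) * W₂ v) := by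
    simp only [ofReal_zero, mul_zero, Complex.exp_zero, one_mul, zero_sub, neg_sub] at hint
    linear_combination hint
  rw [e, norm_mul, norm_pow, norm_inv, inv_pow, inv_mul_eq_div]
  gcongr
  refine (norm_add_le _ _).trans ?_
  gcongr
  refine (norm_integral_le_integral_norm _).trans (le_of_eq ?_)
  simp [hn]

/-- The Gaussian amplitude left after integrating out the central frequency. -/
noncomputable def gaussAmp (γ σ : ℂ) (u v : ℝ) : ℂ :=
  cexp (π * (-(2 - γ) * (u ^ 2 + v ^ 2) + 2 * (1 - γ) * u * v + σ * (v - u)))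

theorem one_add_sq_mul_exp_le {s : ℝ} (hs : 0 ≤ s) :
    (1 + s) ^ 2 * rexp (π * (-s ^ 2 + 4 * s)) ≤ rexp (9 * π) * rexp (-s) := by
  have h1 : (1 + s) ^ 2 ≤ rexp (2 * s) := by
    have : 1 + s ≤ rexp s := by linarith [Real.add_one_le_exp s]
    calc (1 + s) ^ 2 ≤ rexp s ^ 2 := by gcongr
      _ = rexp (2 * s) := by rw [← Real.exp_nat_mul]; norm_num
  refine (mul_le_mul_of_nonneg_right h1 (Real.exp_pos _).le).trans ?_
  rw [← Real.exp_add, ← Real.exp_add, Real.exp_le_exp]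
  have h3 := Real.pi_gt_three
  nlinarith [mul_nonneg Real.pi_pos.le (sq_nonneg (s - 3)), mul_nonneg (sub_nonneg.2 h3.le) hs]

section amplitude

variable {γ σ : ℂ}

theorem norm_gaussAmp_le (hγ : ‖γ‖ ≤ 1 / 2) (hσ : ‖σ‖ ≤ 4) {u v : ℝ} (hu : 0 ≤ u) (hv : 0 ≤ v) :
    (1 + u) ^ 2 * (1 + v) ^ 2 * ‖gaussAmp γ σ u v‖
      ≤ rexp (9 * π) ^ 2 * (rexp (-u) * rexp (-v)) := by
  have h1 : ‖gaussAmp γ σ u v‖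
      ≤ rexp (π * (-u ^ 2 + 4 * u)) * rexp (π * (-v ^ 2 + 4 * v)) := by
    rw [gaussAmp, Complex.norm_exp, ← Real.exp_add, Real.exp_le_exp, ← mul_add, re_ofReal_mul]
    refine mul_le_mul_of_nonneg_left ?_ Real.pi_pos.le
    have e : (-(2 - γ) * ((u : ℂ) ^ 2 + (v : ℂ) ^ 2) + 2 * (1 - γ) * u * v + σ * (v - u)).re
        = -(u ^ 2 + v ^ 2) - (1 - γ.re) * (u - v) ^ 2 + σ.re * (v - u) := by
      simp [← ofReal_pow, ← ofReal_sub, ← ofReal_add]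
      ring
    rw [e]
    have hg := (abs_le.1 ((Complex.abs_re_le_norm γ).trans hγ)).2
    have hs := abs_le.1 ((Complex.abs_re_le_norm σ).trans hσ)
    nlinarith [mul_nonneg (by linarith : 0 ≤ 1 - γ.re) (sq_nonneg (u - v)),
      mul_nonneg (sub_nonneg.2 hs.2) hv, mul_nonneg (sub_nonneg.2 hs.1) hu,
      mul_nonneg (sub_nonneg.2 hs.2) hu, mul_nonneg (sub_nonneg.2 hs.1) hv]
  calc _ ≤ (1 + u) ^ 2 * (1 + v) ^ 2 *
        (rexp (π * (-u ^ 2 + 4 * u)) * rexp (π * (-v ^ 2 + 4 * v))) := by gcongr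
    _ = ((1 + u) ^ 2 * rexp (π * (-u ^ 2 + 4 * u))) *
        ((1 + v) ^ 2 * rexp (π * (-v ^ 2 + 4 * v))) := by ring
    _ ≤ (rexp (9 * π) * rexp (-u)) * (rexp (9 * π) * rexp (-v)) :=
        mul_le_mul (one_add_sq_mul_exp_le hu) (one_add_sq_mul_exp_le hv) (by positivity)
          (by positivity)
    _ = _ := by ring

theorem norm_gaussAmp_le' (hγ : ‖γ‖ ≤ 1 / 2) (hσ : ‖σ‖ ≤ 4) {u v : ℝ} (hu : 0 ≤ u) (hv : 0 ≤ v) :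
    ‖gaussAmp γ σ u v‖ ≤ rexp (9 * π) ^ 2 * (rexp (-u) * rexp (-v)) := by
  refine le_trans ?_ (norm_gaussAmp_le hγ hσ hu hv)
  refine le_mul_of_one_le_left (norm_nonneg _) ?_
  nlinarith [mul_nonneg hu hv, mul_nonneg (mul_nonneg hu hv) (mul_nonneg hu hv),
    mul_nonneg hu (mul_nonneg hu hv), mul_nonneg hv (mul_nonneg hu hv)]

theorem continuous_gaussAmp : Continuous (Function.uncurry (gaussAmp γ σ)) := by
  unfold gaussAmp Function.uncurry
  fun_prop

/-- The logarithmic derivative of the amplitude in its second variable, divided by `π`. -/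
noncomputable def ampSlope (γ σ : ℂ) (u v : ℝ) : ℂ :=
  -2 * (2 - γ) * v + 2 * (1 - γ) * u + σ

theorem hasDerivAt_ampSlope (u v : ℝ) :
    HasDerivAt (ampSlope γ σ u) (-2 * (2 - γ)) v := by
  have h : HasDerivAt (fun v : ℝ => (v : ℂ)) 1 v := (hasDerivAt_id v).ofReal_comp
  exact (((h.const_mul (-2 * (2 - γ))).add_const (2 * (1 - γ) * u)).add_const σ).congr_deriv
    (mul_one _)

theorem hasDerivAt_gaussAmp (u v : ℝ) :
    HasDerivAt (gaussAmp γ σ u) (π * ampSlope γ σ u v * gaussAmp γ σ u v) v := by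
  have h : HasDerivAt (fun v : ℝ => (v : ℂ)) 1 v := (hasDerivAt_id v).ofReal_comp
  have := (((((h.pow 2).const_add ((u : ℂ) ^ 2)).const_mul (-(2 - γ))).add
    (h.const_mul (2 * (1 - γ) * u))).add ((h.sub_const (u : ℂ)).const_mul σ)).const_mul (π : ℂ)
  refine (this.cexp.congr_deriv ?_ :)
  simp only [gaussAmp, ampSlope, Pi.add_apply, Pi.pow_apply]
  ring

theorem hasDerivAt_ampSlope_mul_gaussAmp (u v : ℝ) :
    HasDerivAt (fun v => π * ampSlope γ σ u v * gaussAmp γ σ u v)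
      (((π * ampSlope γ σ u v) ^ 2 - 2 * π * (2 - γ)) * gaussAmp γ σ u v) v := by
  refine (((hasDerivAt_ampSlope u v).const_mul (π : ℂ)).mul (hasDerivAt_gaussAmp u v)).congr_deriv ?_
  ring

theorem norm_ampSlope_le (hγ : ‖γ‖ ≤ 1 / 2) (hσ : ‖σ‖ ≤ 4) {u v : ℝ} (hu : 0 ≤ u) (hv : 0 ≤ v) :
    ‖ampSlope γ σ u v‖ ≤ 5 * ((1 + u) * (1 + v)) := by
  have h2 : ‖2 - γ‖ ≤ 5 / 2 := (norm_sub_le _ _).trans (by norm_num; linarith)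
  have h1 : ‖1 - γ‖ ≤ 3 / 2 := (norm_sub_le _ _).trans (by norm_num; linarith)
  calc ‖ampSlope γ σ u v‖ ≤ 2 * ‖2 - γ‖ * v + 2 * ‖1 - γ‖ * u + ‖σ‖ := by
        refine (norm_add_le _ _).trans <| add_le_add ((norm_add_le _ _).trans (le_of_eq ?_)) le_rfl
        simp [abs_of_nonneg hu, abs_of_nonneg hv]
    _ ≤ 2 * (5 / 2) * v + 2 * (3 / 2) * u + 4 := by gcongr
    _ ≤ _ := by nlinarith [mul_nonneg hu hv]

theorem norm_deriv_gaussAmp_le (hγ : ‖γ‖ ≤ 1 / 2) (hσ : ‖σ‖ ≤ 4) {u v : ℝ}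
    (hu : 0 ≤ u) (hv : 0 ≤ v) :
    ‖π * ampSlope γ σ u v * gaussAmp γ σ u v‖
      ≤ 5 * π * rexp (9 * π) ^ 2 * (rexp (-u) * rexp (-v)) := by
  have h1 : (1 + u) * (1 + v) ≤ (1 + u) ^ 2 * (1 + v) ^ 2 := by
    rw [← mul_pow]
    exact le_self_pow₀ (by nlinarith [mul_nonneg hu hv]) two_ne_zero
  calc ‖π * ampSlope γ σ u v * gaussAmp γ σ u v‖
      = π * ‖ampSlope γ σ u v‖ * ‖gaussAmp γ σ u v‖ := by
        simp [abs_of_pos Real.pi_pos]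
    _ ≤ π * (5 * ((1 + u) * (1 + v))) * ‖gaussAmp γ σ u v‖ := by
        gcongr; exact norm_ampSlope_le hγ hσ hu hv
    _ ≤ π * (5 * ((1 + u) ^ 2 * (1 + v) ^ 2)) * ‖gaussAmp γ σ u v‖ := by gcongr
    _ = 5 * π * ((1 + u) ^ 2 * (1 + v) ^ 2 * ‖gaussAmp γ σ u v‖) := by ring
    _ ≤ 5 * π * (rexp (9 * π) ^ 2 * (rexp (-u) * rexp (-v))) := by
        exact mul_le_mul_of_nonneg_left (norm_gaussAmp_le hγ hσ hu hv) (by positivity)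
    _ = _ := by ring

theorem norm_deriv_deriv_gaussAmp_le (hγ : ‖γ‖ ≤ 1 / 2) (hσ : ‖σ‖ ≤ 4) {u v : ℝ}
    (hu : 0 ≤ u) (hv : 0 ≤ v) :
    ‖((π * ampSlope γ σ u v) ^ 2 - 2 * π * (2 - γ)) * gaussAmp γ σ u v‖
      ≤ (25 * π ^ 2 + 5 * π) * rexp (9 * π) ^ 2 * (rexp (-u) * rexp (-v)) := by
  have h2 : ‖2 - γ‖ ≤ 5 / 2 := (norm_sub_le _ _).trans (by norm_num; linarith)
  have h1 : 1 ≤ (1 + u) ^ 2 * (1 + v) ^ 2 := by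
    rw [← mul_pow]
    exact one_le_pow₀ (by nlinarith [mul_nonneg hu hv])
  calc _ ≤ (π ^ 2 * ‖ampSlope γ σ u v‖ ^ 2 + 2 * π * ‖2 - γ‖) * ‖gaussAmp γ σ u v‖ := by
        rw [norm_mul]
        gcongr
        refine (norm_sub_le _ _).trans (le_of_eq ?_)
        simp [abs_of_pos Real.pi_pos, mul_pow]
    _ ≤ (π ^ 2 * (5 * ((1 + u) * (1 + v))) ^ 2 + 2 * π * (5 / 2)) * ‖gaussAmp γ σ u v‖ := by
        gcongr; exact norm_ampSlope_le hγ hσ hu hv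
    _ = (25 * π ^ 2 * ((1 + u) ^ 2 * (1 + v) ^ 2) + 5 * π * 1) * ‖gaussAmp γ σ u v‖ := by ring
    _ ≤ (25 * π ^ 2 * ((1 + u) ^ 2 * (1 + v) ^ 2) + 5 * π * ((1 + u) ^ 2 * (1 + v) ^ 2)) *
        ‖gaussAmp γ σ u v‖ := by gcongr
    _ = (25 * π ^ 2 + 5 * π) * ((1 + u) ^ 2 * (1 + v) ^ 2 * ‖gaussAmp γ σ u v‖) := by ring
    _ ≤ (25 * π ^ 2 + 5 * π) * (rexp (9 * π) ^ 2 * (rexp (-u) * rexp (-v))) := by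
        exact mul_le_mul_of_nonneg_left (norm_gaussAmp_le hγ hσ hu hv) (by positivity)
    _ = _ := by ring

/-- The inner oscillatory integral, at frequency `lam * u`. -/
noncomputable def innerInt (lam : ℝ) (γ σ : ℂ) (u : ℝ) : ℂ :=
  ∫ v in Set.Ioi (0 : ℝ), cexp (-(2 * π * I * lam * u) * v) * gaussAmp γ σ u v

theorem norm_exp_phase (lam u v : ℝ) : ‖cexp (-(2 * π * I * lam * u) * v)‖ = 1 := by
  simp [Complex.norm_exp]

theorem integrableOn_of_norm_le_exp {F : ℝ → ℂ} (hF : Continuous F) {c : ℝ}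
    (h : ∀ v, 0 ≤ v → ‖F v‖ ≤ c * rexp (-v)) : IntegrableOn F (Set.Ioi 0) :=
  ((integrableOn_exp_neg_Ioi 0).const_mul c).mono' hF.aestronglyMeasurable
    ((ae_restrict_mem measurableSet_Ioi).mono fun v hv => h v (le_of_lt hv))

theorem tendsto_of_norm_le_exp {F : ℝ → ℂ} {c : ℝ}
    (h : ∀ v, 0 ≤ v → ‖F v‖ ≤ c * rexp (-v)) : Filter.Tendsto F Filter.atTop (nhds 0) := by
  refine squeeze_zero_norm' ((Filter.eventually_ge_atTop 0).mono h) ?_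
  simpa using Real.tendsto_exp_neg_atTop_nhds_zero.const_mul c

theorem norm_innerInt_le (hγ : ‖γ‖ ≤ 1 / 2) (hσ : ‖σ‖ ≤ 4) (lam : ℝ) {u : ℝ} (hu : 0 ≤ u) :
    ‖innerInt lam γ σ u‖ ≤ rexp (9 * π) ^ 2 * rexp (-u) := by
  refine (norm_integral_le_of_norm_le
    (g := fun v => rexp (9 * π) ^ 2 * rexp (-u) * rexp (-v))
    ((integrableOn_exp_neg_Ioi 0).const_mul _)
    ((ae_restrict_mem measurableSet_Ioi).mono fun v hv => ?_)).trans (le_of_eq ?_)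
  · rw [norm_mul, norm_exp_phase, one_mul, mul_assoc]
    exact norm_gaussAmp_le' hγ hσ hu (le_of_lt hv)
  · rw [integral_const_mul, integral_exp_neg_Ioi_zero, mul_one]

theorem norm_innerInt_sub_le (hγ : ‖γ‖ ≤ 1 / 2) (hσ : ‖σ‖ ≤ 4) {lam u : ℝ} (hl : 0 < lam)
    (hu : 0 < u) :
    ‖innerInt lam γ σ u - gaussAmp γ σ u 0 / (2 * π * I * lam * u)‖
      ≤ (25 * π ^ 2 + 10 * π) * rexp (9 * π) ^ 2 * rexp (-u) / (lam * u) ^ 2 := by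
  have hne : (2 * π * I * lam * u : ℂ) ≠ 0 := by
    have := Real.pi_ne_zero
    simp [this, hl.ne', hu.ne']
  have hnorm : ‖-(2 * π * I * lam * u : ℂ)‖ = 2 * π * (lam * u) := by
    simp [abs_of_pos, Real.pi_pos, hl, hu]
    ring
  have hW := hasDerivAt_gaussAmp (γ := γ) (σ := σ) u
  have hW1 := hasDerivAt_ampSlope_mul_gaussAmp (γ := γ) (σ := σ) u
  have hcW : Continuous (gaussAmp γ σ u) := continuous_iff_continuousAt.2 fun v =>
    (hW v).continuousAt
  have hcS : Continuous (ampSlope γ σ u) := continuous_iff_continuousAt.2 fun v =>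
    (hasDerivAt_ampSlope u v).continuousAt
  have b0 : ∀ v, 0 ≤ v → ‖gaussAmp γ σ u v‖ ≤ rexp (9 * π) ^ 2 * rexp (-u) * rexp (-v) :=
    fun v hv => (norm_gaussAmp_le' hγ hσ hu.le hv).trans (le_of_eq (by ring))
  have b1 : ∀ v, 0 ≤ v → ‖π * ampSlope γ σ u v * gaussAmp γ σ u v‖
      ≤ 5 * π * rexp (9 * π) ^ 2 * rexp (-u) * rexp (-v) :=
    fun v hv => (norm_deriv_gaussAmp_le hγ hσ hu.le hv).trans (le_of_eq (by ring))
  have b2 : ∀ v, 0 ≤ v → ‖((π * ampSlope γ σ u v) ^ 2 - 2 * π * (2 - γ)) * gaussAmp γ σ u v‖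
      ≤ (25 * π ^ 2 + 5 * π) * rexp (9 * π) ^ 2 * rexp (-u) * rexp (-v) :=
    fun v hv => (norm_deriv_deriv_gaussAmp_le hγ hσ hu.le hv).trans (le_of_eq (by ring))
  have hi2 := integrableOn_of_norm_le_exp (by fun_prop) b2
  have key := norm_integral_exp_mul_add_le (neg_ne_zero.2 hne) (by simp) hW hW1
    (integrableOn_of_norm_le_exp hcW b0) hi2 (tendsto_of_norm_le_exp b0)
    (tendsto_of_norm_le_exp b1)
  rw [hnorm, div_neg, ← sub_eq_add_neg] at key
  refine key.trans ?_
  have h1 : ‖π * ampSlope γ σ u 0 * gaussAmp γ σ u 0‖ ≤ 5 * π * rexp (9 * π) ^ 2 * rexp (-u) := by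
    simpa using b1 0 le_rfl
  have h2 : ∫ v in Set.Ioi (0 : ℝ),
      ‖((π * ampSlope γ σ u v) ^ 2 - 2 * π * (2 - γ)) * gaussAmp γ σ u v‖
      ≤ (25 * π ^ 2 + 5 * π) * rexp (9 * π) ^ 2 * rexp (-u) := by
    refine (setIntegral_mono_on hi2.norm ((integrableOn_exp_neg_Ioi 0).const_mul _) measurableSet_Ioi
      fun v hv => b2 v (le_of_lt hv)).trans (le_of_eq ?_)
    rw [integral_const_mul, integral_exp_neg_Ioi_zero, mul_one]
  have h3 := Real.pi_gt_three
  refine div_le_div₀ (by positivity) (by linarith) (by positivity) ?_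
  have : 0 < lam * u := by positivity
  rw [mul_pow (2 * π) (lam * u) 2]
  exact le_mul_of_one_le_left (by positivity) (by nlinarith)

theorem norm_gaussAmp_sub_one_le (hγ : ‖γ‖ ≤ 1 / 2) (hσ : ‖σ‖ ≤ 4) {u : ℝ} (hu : 0 ≤ u)
    (hu1 : u ≤ 1) : ‖gaussAmp γ σ u 0 - 1‖ ≤ 7 * π * rexp (7 * π) * u := by
  have h2 : ‖2 - γ‖ ≤ 5 / 2 := (norm_sub_le _ _).trans (by norm_num; linarith)
  set z : ℂ := π * (-(2 - γ) * (u ^ 2 + (0 : ℝ) ^ 2) + 2 * (1 - γ) * u * (0 : ℝ)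
    + σ * ((0 : ℝ) - u)) with hz
  have hzn : ‖z‖ ≤ 7 * π * u := by
    calc ‖z‖ = π * ‖(2 - γ) * u ^ 2 + σ * u‖ := by
          rw [hz, norm_mul, Complex.norm_real, Real.norm_of_nonneg Real.pi_pos.le, ← norm_neg]
          congr 2
          push_cast
          ring
      _ ≤ π * (5 / 2 * u ^ 2 + 4 * u) := by
          gcongr
          refine (norm_add_le _ _).trans ?_
          rw [norm_mul, norm_mul, norm_pow, Complex.norm_real, Real.norm_of_nonneg hu]
          gcongr
      _ ≤ π * (7 * u) := by
          refine mul_le_mul_of_nonneg_left ?_ Real.pi_pos.le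
          nlinarith
      _ = 7 * π * u := by ring
  have := Complex.norm_exp_sub_sum_le_norm_mul_exp z 1
  simp only [Finset.range_one, Finset.sum_singleton, pow_zero, Nat.factorial_zero, Nat.cast_one,
    div_one, pow_one] at this
  refine (this : ‖gaussAmp γ σ u 0 - 1‖ ≤ _).trans ?_
  have h7 : ‖z‖ ≤ 7 * π := hzn.trans (mul_le_of_le_one_right (by positivity) hu1)
  calc ‖z‖ * rexp ‖z‖ ≤ (7 * π * u) * rexp (7 * π) := by gcongr
    _ = _ := by ring

theorem integrableOn_innerInt (hγ : ‖γ‖ ≤ 1 / 2) (hσ : ‖σ‖ ≤ 4) (lam : ℝ) :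
    IntegrableOn (innerInt lam γ σ) (Set.Ioi 0) := by
  have hc : Continuous fun w : ℝ × ℝ =>
      cexp (-(2 * π * I * lam * w.1) * w.2) * gaussAmp γ σ w.1 w.2 := by
    have := continuous_gaussAmp (γ := γ) (σ := σ)
    unfold Function.uncurry at this
    fun_prop
  refine ((integrableOn_exp_neg_Ioi 0).const_mul (rexp (9 * π) ^ 2)).mono'
    (hc.stronglyMeasurable.integral_prod_right').aestronglyMeasurable
    ((ae_restrict_mem measurableSet_Ioi).mono fun u hu => norm_innerInt_le hγ hσ lam (le_of_lt hu))

/-- The model for `innerInt` carrying the logarithmic divergence. -/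
noncomputable def innerModel (lam : ℝ) : ℝ → ℂ :=
  (Set.Ioc lam⁻¹ 1).indicator fun u => (2 * π * I * lam)⁻¹ * ((u⁻¹ : ℝ) : ℂ)

theorem integrableOn_innerModel {lam : ℝ} (hl : 1 < lam) :
    IntegrableOn (innerModel lam) (Set.Ioi 0) := by
  have h0 : 0 < lam⁻¹ := by positivity
  have : IntegrableOn (fun u : ℝ => u⁻¹) (Set.Ioc lam⁻¹ 1) :=
    (ContinuousOn.integrableOn_Icc (continuousOn_inv₀.mono fun u hu =>
      (h0.trans_le hu.1).ne')).mono_set Set.Ioc_subset_Icc_self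
  have h2 : IntegrableOn (fun u : ℝ => (2 * π * I * lam)⁻¹ * ((u⁻¹ : ℝ) : ℂ))
      (Set.Ioc lam⁻¹ 1) := this.ofReal.const_mul _
  exact ((integrable_indicator_iff measurableSet_Ioc).2 h2).integrableOn

theorem integral_innerModel {lam : ℝ} (hl : 1 < lam) :
    ∫ u in Set.Ioi 0, innerModel lam u = (2 * π * I * lam)⁻¹ * (Real.log lam : ℂ) := by
  have h0 : 0 < lam⁻¹ := by positivity
  have h1 : lam⁻¹ ≤ 1 := inv_le_one_of_one_le₀ hl.le
  rw [innerModel, setIntegral_indicator measurableSet_Ioc,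
    Set.inter_eq_self_of_subset_right (Set.Ioc_subset_Ioi_self.trans (Set.Ioi_subset_Ioi h0.le)),
    integral_const_mul,
    integral_complex_ofReal, ← intervalIntegral.integral_of_le h1, integral_inv_of_pos h0 one_pos]
  simp

theorem norm_innerInt_sub_innerModel_le (hγ : ‖γ‖ ≤ 1 / 2) (hσ : ‖σ‖ ≤ 4) {lam u : ℝ}
    (hl : 1 < lam) (hu : 0 < u) :
    ‖innerInt lam γ σ u - innerModel lam u‖
      ≤ (Set.Ioc 0 lam⁻¹).indicator (fun _ => rexp (9 * π) ^ 2) u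
        + (Set.Ioi lam⁻¹).indicator
          (fun u => (25 * π ^ 2 + 10 * π) * rexp (9 * π) ^ 2 / lam ^ 2 * u ^ (-2 : ℝ)) u
        + (rexp (9 * π) ^ 2 + 7 * rexp (7 * π) * rexp 1) / lam * rexp (-u) := by
  have hl0 : 0 < lam := one_pos.trans hl
  have hlu : 0 < lam * u := by positivity
  have hpi := Real.pi_gt_three
  have hden : ‖(2 * π * I * lam * u : ℂ)‖ = 2 * π * (lam * u) := by
    simp [abs_of_pos, Real.pi_pos, hl0, hu]
    ring
  rcases le_or_gt u lam⁻¹ with h | h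
  · have hm : innerModel lam u = 0 := Set.indicator_of_notMem (fun hh => not_lt.2 h hh.1) _
    rw [hm, sub_zero, Set.indicator_of_mem (show u ∈ Set.Ioc 0 lam⁻¹ from ⟨hu, h⟩),
      Set.indicator_of_notMem (show u ∉ Set.Ioi lam⁻¹ from not_lt.2 h), add_zero]
    refine (norm_innerInt_le hγ hσ lam hu.le).trans ?_
    have : rexp (9 * π) ^ 2 * rexp (-u) ≤ rexp (9 * π) ^ 2 :=
      mul_le_of_le_one_right (by positivity) (Real.exp_le_one_iff.2 (by linarith))
    refine this.trans (le_add_of_nonneg_right (by positivity))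
  · rw [Set.indicator_of_notMem (show u ∉ Set.Ioc 0 lam⁻¹ from fun hh => not_lt.2 hh.2 h),
      Set.indicator_of_mem (show u ∈ Set.Ioi lam⁻¹ from h), zero_add]
    have e1 : ‖innerInt lam γ σ u - gaussAmp γ σ u 0 / (2 * π * I * lam * u)‖
        ≤ (25 * π ^ 2 + 10 * π) * rexp (9 * π) ^ 2 / lam ^ 2 * u ^ (-2 : ℝ) := by
      refine (norm_innerInt_sub_le hγ hσ hl0 hu).trans ?_
      rw [Real.rpow_neg hu.le, Real.rpow_two, mul_pow, ← div_div, ← div_eq_mul_inv,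
        ← div_mul_eq_mul_div]
      gcongr
      exact mul_le_of_le_one_right (by positivity) (Real.exp_le_one_iff.2 (by linarith))
    have e2 : ‖gaussAmp γ σ u 0 / (2 * π * I * lam * u) - innerModel lam u‖
        ≤ (rexp (9 * π) ^ 2 + 7 * rexp (7 * π) * rexp 1) / lam * rexp (-u) := by
      rcases le_or_gt u 1 with h1 | h1
      · have hm : innerModel lam u = (2 * π * I * lam)⁻¹ * ((u⁻¹ : ℝ) : ℂ) :=
          Set.indicator_of_mem (show u ∈ Set.Ioc lam⁻¹ 1 from ⟨h, h1⟩) _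
        have : gaussAmp γ σ u 0 / (2 * π * I * lam * u) - innerModel lam u
            = (gaussAmp γ σ u 0 - 1) / (2 * π * I * lam * u) := by
          rw [hm, ofReal_inv, ← mul_inv, sub_div, one_div]
        rw [this, norm_div, hden, div_le_iff₀ (by positivity)]
        refine (norm_gaussAmp_sub_one_le hγ hσ hu.le h1).trans ?_
        have h3 : 1 ≤ rexp 1 * rexp (-u) := by
          rw [← Real.exp_add]; exact Real.one_le_exp (by linarith)
        calc 7 * π * rexp (7 * π) * u = 7 * rexp (7 * π) * (π * u) * 1 := by ring
          _ ≤ 7 * rexp (7 * π) * (π * u) * (rexp 1 * rexp (-u)) := by gcongr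
          _ ≤ 7 * rexp (7 * π) * (π * u) * (rexp 1 * rexp (-u)) * 2
              + rexp (9 * π) ^ 2 * rexp (-u) * (2 * π * u) := by
            have p1 : 0 ≤ 7 * rexp (7 * π) * (π * u) * (rexp 1 * rexp (-u)) := by positivity
            have p2 : 0 ≤ rexp (9 * π) ^ 2 * rexp (-u) * (2 * π * u) := by positivity
            linarith
          _ = _ := by field_simp; ring
      · have hm : innerModel lam u = 0 := Set.indicator_of_notMem (fun hh => not_le.2 h1 hh.2) _
        rw [hm, sub_zero, norm_div, hden]
        have hb : ‖gaussAmp γ σ u 0‖ ≤ rexp (9 * π) ^ 2 * rexp (-u) := by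
          simpa using norm_gaussAmp_le' hγ hσ hu.le (le_refl 0)
        calc _ ≤ rexp (9 * π) ^ 2 * rexp (-u) / lam := by
              refine div_le_div₀ (by positivity) hb hl0 ?_
              nlinarith [mul_pos hl0 hu]
          _ ≤ (rexp (9 * π) ^ 2 + 7 * rexp (7 * π) * rexp 1) * rexp (-u) / lam := by
              gcongr
              exact le_add_of_nonneg_right (by positivity)
          _ = _ := by ring
    calc _ ≤ _ := norm_sub_le_norm_sub_add_norm_sub _ (gaussAmp γ σ u 0 / (2 * π * I * lam * u)) _
      _ ≤ _ := add_le_add e1 e2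

theorem exists_le_norm_integral_innerInt :
    ∃ E : ℝ, ∀ {γ σ : ℂ} {lam : ℝ}, ‖γ‖ ≤ 1 / 2 → ‖σ‖ ≤ 4 → 1 < lam →
      (Real.log lam / (2 * π) - E) / lam ≤ ‖∫ u in Set.Ioi 0, innerInt lam γ σ u‖ := by
  refine ⟨rexp (9 * π) ^ 2 + (25 * π ^ 2 + 10 * π) * rexp (9 * π) ^ 2
    + (rexp (9 * π) ^ 2 + 7 * rexp (7 * π) * rexp 1), fun {γ σ lam} hγ hσ hl => ?_⟩
  have hl0 : 0 < lam := one_pos.trans hl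
  have hli : 0 < lam⁻¹ := by positivity
  set A := (25 * π ^ 2 + 10 * π) * rexp (9 * π) ^ 2
  set D := rexp (9 * π) ^ 2 + 7 * rexp (7 * π) * rexp 1
  have i1 : IntegrableOn ((Set.Ioc 0 lam⁻¹).indicator fun _ => rexp (9 * π) ^ 2) (Set.Ioi 0) :=
    ((integrable_indicator_iff measurableSet_Ioc).2
      (integrableOn_const (by simp) (by simp))).integrableOn
  have i2 : IntegrableOn ((Set.Ioi lam⁻¹).indicator fun u => A / lam ^ 2 * u ^ (-2 : ℝ))
      (Set.Ioi 0) :=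
    ((integrable_indicator_iff measurableSet_Ioi).2
      ((integrableOn_Ioi_rpow_of_lt (by norm_num) hli).const_mul _)).integrableOn
  have i3 : IntegrableOn (fun u => D / lam * rexp (-u)) (Set.Ioi 0) :=
    (integrableOn_exp_neg_Ioi 0).const_mul _
  have hb := norm_integral_le_of_norm_le ((i1.add i2).add i3)
    ((ae_restrict_mem measurableSet_Ioi).mono fun u hu =>
      norm_innerInt_sub_innerModel_le hγ hσ hl hu)
  have v1 : ∫ u in Set.Ioi (0 : ℝ), (Set.Ioc 0 lam⁻¹).indicator (fun _ => rexp (9 * π) ^ 2) u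
      = rexp (9 * π) ^ 2 / lam := by
    rw [setIntegral_indicator measurableSet_Ioc,
      Set.inter_eq_self_of_subset_right Set.Ioc_subset_Ioi_self]
    simp [hli.le]
    ring
  have v2 : ∫ u in Set.Ioi (0 : ℝ), (Set.Ioi lam⁻¹).indicator
      (fun u => A / lam ^ 2 * u ^ (-2 : ℝ)) u = A / lam := by
    rw [setIntegral_indicator measurableSet_Ioi,
      Set.inter_eq_self_of_subset_right (Set.Ioi_subset_Ioi hli.le), integral_const_mul,
      integral_Ioi_rpow_of_lt (by norm_num) hli]
    norm_num
    rw [Real.rpow_neg_one]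
    field_simp
  rw [integral_add' (i1.add i2) i3, integral_add' i1 i2, v1, v2, integral_const_mul,
    integral_exp_neg_Ioi_zero, mul_one,
    integral_sub (integrableOn_innerInt hγ hσ lam) (integrableOn_innerModel hl),
    integral_innerModel hl] at hb
  have hn : ‖(2 * π * I * lam : ℂ)⁻¹ * (Real.log lam : ℂ)‖ = Real.log lam / (2 * π) / lam := by
    rw [norm_mul, norm_inv, Complex.norm_real, Real.norm_of_nonneg (Real.log_nonneg hl.le)]
    simp [abs_of_pos, Real.pi_pos, hl0]
    field_simp
  have := norm_sub_norm_le ((2 * π * I * lam : ℂ)⁻¹ * (Real.log lam : ℂ))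
    (∫ u in Set.Ioi 0, innerInt lam γ σ u)
  rw [norm_sub_rev] at this
  rw [sub_div, ← hn, add_div, add_div]
  linarith

end amplitude

/-- Integration over the ordered simplex in gap coordinates around the middle variable. -/
theorem setIntegral_strictMono_fin_three {Φ : (Fin 3 → ℝ) → ℂ} (hΦ : Integrable Φ) :
    ∫ t in {t : Fin 3 → ℝ | StrictMono t}, Φ t
      = ∫ u in Set.Ioi (0 : ℝ), ∫ v in Set.Ioi (0 : ℝ), ∫ k : ℝ, Φ ![k - u, k, k + v] := by
  set e : ℝ × (ℝ × ℝ) → Fin 3 → ℝ := fun z => ![z.1 - z.2.1, z.1, z.1 + z.2.2] with he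
  have hc : Continuous e := by
    refine continuous_pi fun i => ?_
    fin_cases i <;> simp [he] <;> fun_prop
  have hm : MeasurePreserving e volume volume := by
    have m1 : MeasurePreserving (fun z : ℝ × (ℝ × ℝ) => (id z.1, (z.1 - z.2.1, z.1 + z.2.2)))
        (volume.prod volume) (volume.prod volume) :=
      (MeasurePreserving.id (volume : Measure ℝ)).skew_product (g := fun k (w : ℝ × ℝ) =>
        (k - w.1, k + w.2)) (by fun_prop) (Filter.Eventually.of_forall fun k =>
          ((Measure.measurePreserving_sub_left volume k).prod
            (measurePreserving_add_left volume k)).map_eq)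
    have m2 := ((volume_preserving_piFinSuccAbove (fun _ : Fin 3 => ℝ) 1).symm).comp
      (((MeasurePreserving.id (volume : Measure ℝ)).prod
        (volume_preserving_finTwoArrow ℝ).symm).comp m1)
    refine m2.congr hc.measurable (Filter.Eventually.of_forall fun z => funext fun i => ?_)
    fin_cases i <;> rfl
  have hinj : Function.Injective e := by
    rintro ⟨k, u, v⟩ ⟨k', u', v'⟩ h
    have h0 := congrFun h 0
    have h1 := congrFun h 1
    have h2 := congrFun h 2
    simp [he] at h0 h1 h2
    subst h1
    simp_all
  have hemb : MeasurableEmbedding e := hc.measurableEmbedding hinj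
  have hpre : e ⁻¹' {t | StrictMono t} = Set.univ ×ˢ (Set.Ioi 0 ×ˢ Set.Ioi 0) := by
    ext ⟨k, u, v⟩
    simp [he, Fin.strictMono_iff_lt_succ, Fin.forall_fin_two]
  have hint : Integrable (Φ ∘ e) := hm.integrable_comp_of_integrable hΦ
  rw [← hm.setIntegral_preimage_emb hemb, hpre]
  have hmeas : (volume : Measure (ℝ × (ℝ × ℝ))).restrict (Set.univ ×ˢ (Set.Ioi 0 ×ˢ Set.Ioi 0))
      = (volume : Measure ℝ).prod
        (((volume : Measure ℝ).restrict (Set.Ioi 0)).prod (volume.restrict (Set.Ioi 0))) := by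
    rw [Measure.prod_restrict, Measure.volume_eq_prod, Measure.volume_eq_prod,
      ← Measure.prod_restrict, Measure.restrict_univ]
  have hint' := hint.restrict (s := Set.univ ×ˢ (Set.Ioi 0 ×ˢ Set.Ioi 0))
  rw [hmeas] at hint' ⊢
  refine (integral_prod_symm _ hint').trans ?_
  rw [integral_prod _ hint'.integral_prod_right]
  rfl

/-- The chirped Gaussian phase integrated over the ordered simplex. -/
noncomputable def chirpForm (a : ℂ) (x : ℝ) (t : Fin 3 → ℝ) : ℂ :=
  cexp (-π * (a * t 0 ^ 2 + (starRingEnd ℂ) a * t 1 ^ 2 + a * t 2 ^ 2)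
    + 2 * π * I * x * (t 0 - t 1 + t 2))

theorem norm_chirpForm (a : ℂ) (x : ℝ) (t : Fin 3 → ℝ) :
    ‖chirpForm a x t‖ = ∏ i, rexp (-(π * a.re) * t i ^ 2) := by
  rw [chirpForm, Complex.norm_exp, Fin.prod_univ_three, ← Real.exp_add, ← Real.exp_add]
  congr 1
  simp [← ofReal_pow]
  ring

theorem continuous_chirpForm (a : ℂ) (x : ℝ) : Continuous (chirpForm a x) := by
  unfold chirpForm
  fun_prop

theorem integrable_prod_gaussian {c : ℝ} (hc : 0 < c) :
    Integrable fun t : Fin 3 → ℝ => ∏ i, rexp (-c * t i ^ 2) :=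
  Integrable.fintype_prod (f := fun (_ : Fin 3) (s : ℝ) => rexp (-c * s ^ 2))
    fun _ => integrable_exp_neg_mul_sq hc

theorem integrable_chirpForm {a : ℂ} (ha : 0 < a.re) (x : ℝ) : Integrable (chirpForm a x) :=
  (integrable_prod_gaussian (mul_pos Real.pi_pos ha)).mono'
    (continuous_chirpForm a x).aestronglyMeasurable
    (Filter.Eventually.of_forall fun t => (norm_chirpForm a x t).le)

theorem integral_chirpForm_middle (lam x u v : ℝ) :
    ∫ k : ℝ, chirpForm (1 + lam * I) x ![k - u, k, k + v]
      = (1 / (3 + lam * I)) ^ (1 / 2 : ℂ) * cexp (-π * x ^ 2 / (3 + lam * I))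
        * (cexp (-(2 * π * I * lam * u) * v)
          * gaussAmp (4 / (3 + lam * I)) (I * x * (4 / (3 + lam * I))) u v) := by
  have hB : (3 + lam * I : ℂ) ≠ 0 := fun h => by simpa using congrArg Complex.re h
  have hpi : (π : ℂ) ≠ 0 := by exact_mod_cast Real.pi_ne_zero
  have hq := integral_cexp_quadratic (b := -π * (3 + lam * I)) (by simp [Real.pi_pos])
    (-2 * π * (1 + lam * I) * (v - u) + 2 * π * I * x)
    (-π * (1 + lam * I) * (u ^ 2 + v ^ 2) + 2 * π * I * x * (v - u))
  have e1 : (π : ℂ) / -(-π * (3 + lam * I)) = 1 / (3 + lam * I) := by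
    field_simp
  rw [e1] at hq
  rw [mul_assoc, gaussAmp, ← Complex.exp_add, ← Complex.exp_add]
  convert hq using 2
  · funext k
    unfold chirpForm
    congr 1
    simp
    ring
  · congr 1
    field_simp
    have := I_sq
    linear_combination (-4 * (x : ℂ) ^ 2) * this

theorem exists_le_norm_setIntegral_chirpForm_unscaled :
    ∃ E : ℝ, ∀ {lam x : ℝ}, 8 ≤ lam → x ^ 2 ≤ 1 + lam ^ 2 →
      E ≤ Real.log lam / (2 * π) →
      (3 * √(1 + lam ^ 2)) ^ (-(1 / 2) : ℝ) * rexp (-3 * π)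
          * ((Real.log lam / (2 * π) - E) / lam)
        ≤ ‖∫ t in {t : Fin 3 → ℝ | StrictMono t}, chirpForm (1 + lam * I) x t‖ := by
  obtain ⟨E, hE⟩ := exists_le_norm_integral_innerInt
  refine ⟨E, fun {lam x} hl hx hEl => ?_⟩
  have hB : (3 + lam * I : ℂ) ≠ 0 := fun h => by simpa using congrArg Complex.re h
  have hBn : ‖(3 + lam * I : ℂ)‖ = √(9 + lam ^ 2) := by
    rw [Complex.norm_eq_sqrt_sq_add_sq]
    norm_num
  have hBn0 : 0 < ‖(3 + lam * I : ℂ)‖ := norm_pos_iff.2 hB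
  have hBsq : ‖(3 + lam * I : ℂ)‖ ^ 2 = 9 + lam ^ 2 := by
    rw [hBn, Real.sq_sqrt (by positivity)]
  have hB8 : 8 ≤ ‖(3 + lam * I : ℂ)‖ := abs_le_of_sq_le_sq' (by nlinarith) hBn0.le |>.2
  have hγ : ‖(4 / (3 + lam * I) : ℂ)‖ ≤ 1 / 2 := by
    rw [norm_div, div_le_iff₀ hBn0]
    norm_num
    linarith
  have hσ : ‖(I * x * (4 / (3 + lam * I)) : ℂ)‖ ≤ 4 := by
    have hx' : |x| ≤ ‖(3 + lam * I : ℂ)‖ := abs_le_of_sq_le_sq (by nlinarith) hBn0.le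
    rw [norm_mul, norm_mul, norm_div, ← mul_div_assoc, div_le_iff₀ hBn0]
    simp
    linarith
  rw [setIntegral_strictMono_fin_three (integrable_chirpForm (by simp) x)]
  simp only [integral_chirpForm_middle, integral_const_mul]
  rw [norm_mul, norm_mul]
  have h1 : (3 * √(1 + lam ^ 2)) ^ (-(1 / 2) : ℝ) ≤ ‖(1 / (3 + lam * I) : ℂ) ^ (1 / 2 : ℂ)‖ := by
    have : ((1 / 2 : ℂ)) = ((1 / 2 : ℝ) : ℂ) := by simp
    rw [this, Complex.norm_cpow_real, norm_div, norm_one, Real.div_rpow zero_le_one hBn0.le,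
      Real.one_rpow, one_div (_ ^ _), ← Real.rpow_neg hBn0.le]
    refine Real.rpow_le_rpow_of_nonpos hBn0 ?_ (by norm_num)
    rw [hBn]
    refine Real.sqrt_le_iff.2 ⟨by positivity, ?_⟩
    rw [mul_pow, Real.sq_sqrt (by positivity)]
    nlinarith
  have h2 : rexp (-3 * π) ≤ ‖cexp (-π * x ^ 2 / (3 + lam * I))‖ := by
    rw [Complex.norm_exp]
    refine Real.exp_le_exp.2 ?_
    have : (-π * x ^ 2 / (3 + lam * I) : ℂ).re = -π * x ^ 2 * 3 / (9 + lam ^ 2) := by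
      rw [Complex.div_re, ← hBsq, Complex.sq_norm]
      simp [← ofReal_pow]
    rw [this, le_div_iff₀ (by positivity)]
    nlinarith [Real.pi_pos]
  have h3 := hE hγ hσ (lam := lam) (by linarith)
  simp only [innerInt] at h3
  have : 0 ≤ (Real.log lam / (2 * π) - E) / lam := div_nonneg (by linarith) (by linarith)
  gcongr

open scoped Pointwise in
theorem smul_setOf_strictMono {c : ℝ} (hc : 0 < c) :
    c • {t : Fin 3 → ℝ | StrictMono t} = {t | StrictMono t} := by
  ext t
  rw [Set.mem_smul_set_iff_inv_smul_mem₀ hc.ne']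
  have : 0 < c⁻¹ := inv_pos.2 hc
  simp [StrictMono, mul_lt_mul_iff_right₀ this]

theorem exists_le_norm_setIntegral_chirpForm :
    ∃ E : ℝ, ∀ {lam x : ℝ}, 8 ≤ lam → |x| ≤ 1 → E ≤ Real.log lam / (2 * π) →
      √(1 + lam ^ 2) * √(√(1 + lam ^ 2)) * (rexp (-3 * π) / 2 * (Real.log lam / (2 * π) - E))
        ≤ ‖∫ t in {t : Fin 3 → ℝ | StrictMono t},
            chirpForm ((1 + lam * I) / (1 + lam ^ 2)) x t‖ := by
  obtain ⟨E, hE⟩ := exists_le_norm_setIntegral_chirpForm_unscaled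
  refine ⟨E, fun {lam x} hl hx hEl => ?_⟩
  set L := √(1 + lam ^ 2) with hL
  have hL2 : L ^ 2 = 1 + lam ^ 2 := Real.sq_sqrt (by positivity)
  have hL0 : 0 < L := Real.sqrt_pos.2 (by positivity)
  have hLl : lam ≤ L := Real.le_sqrt_of_sq_le (by linarith)
  have hx2 : x ^ 2 ≤ 1 := (sq_le_one_iff_abs_le_one x).2 hx
  have h := hE (x := L * x) hl (by rw [mul_pow, hL2]; nlinarith [sq_nonneg lam]) hEl
  have hs := Measure.setIntegral_comp_smul_of_pos (volume : Measure (Fin 3 → ℝ))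
    (chirpForm ((1 + lam * I) / (1 + lam ^ 2)) x) {t | StrictMono t} hL0
  rw [smul_setOf_strictMono hL0] at hs
  have hLc : (L : ℂ) ^ 2 = 1 + lam ^ 2 := by exact_mod_cast hL2
  have hLc0 : (L : ℂ) ≠ 0 := by exact_mod_cast hL0.ne'
  have hf : ∀ t : Fin 3 → ℝ, chirpForm ((1 + lam * I) / (1 + lam ^ 2)) x (L • t)
      = chirpForm (1 + lam * I) (L * x) t := fun t => by
    unfold chirpForm
    congr 1
    rw [← hLc]
    simp
    field_simp
  simp only [hf] at hs
  rw [hs, norm_smul, Module.finrank_fin_fun, norm_inv, norm_pow, Real.norm_of_nonneg hL0.le,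
    inv_mul_eq_div, le_div_iff₀ (by positivity)] at h
  refine le_trans ?_ h
  set X := Real.log lam / (2 * π) - E
  have hX : 0 ≤ X := by simp only [X]; linarith
  set m := √L
  have hm : m ^ 2 = L := Real.sq_sqrt hL0.le
  have hm0 : 0 < m := Real.sqrt_pos.2 hL0
  have h3 : (2 * m)⁻¹ ≤ (3 * L) ^ (-(1 / 2) : ℝ) := by
    rw [Real.rpow_neg (by positivity), ← Real.sqrt_eq_rpow]
    refine inv_anti₀ (by positivity) (Real.sqrt_le_iff.2 ⟨by positivity, ?_⟩)
    nlinarith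
  have hl0 : 0 < lam := by linarith
  calc L * m * (rexp (-3 * π) / 2 * X)
      ≤ L * m * (rexp (-3 * π) / 2 * X) * (L / lam) :=
        le_mul_of_one_le_right (by positivity) ((one_le_div hl0).2 hLl)
    _ = (2 * m)⁻¹ * rexp (-3 * π) * (X / lam) * L ^ 3 := by
        rw [← hm]
        field_simp
    _ ≤ _ := by gcongr

/-- A Schwartz function whose Fourier transform is a truncated complex Gaussian. -/
theorem exists_schwartz_fourier_eq (χ : ContDiffBump (0 : ℝ)) (a : ℂ) {R : ℝ} (hR : 0 < R) :
    ∃ f : SchwartzMap ℝ ℂ, HasCompactSupport (𝓕 ⇑f) ∧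
      ∀ t, 𝓕 ⇑f t = (χ (t / R) : ℂ) * cexp (-(π * a) * t ^ 2) := by
  have hχ : ContDiff ℝ (⊤ : ℕ∞) fun t : ℝ => ((χ (t / R) : ℝ) : ℂ) :=
    ofRealCLM.contDiff.comp (χ.contDiff.comp (contDiff_id.div_const R))
  have hg : ContDiff ℝ (⊤ : ℕ∞) fun t : ℝ => (χ (t / R) : ℂ) * cexp (-(π * a) * t ^ 2) :=
    hχ.mul (contDiff_const.mul (ofRealCLM.contDiff.pow 2)).cexp
  have hs : HasCompactSupport fun t : ℝ => (χ (t / R) : ℂ) * cexp (-(π * a) * t ^ 2) := by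
    have h1 : HasCompactSupport fun t : ℝ => χ (t / R) := by
      simpa [Function.comp_def, div_eq_mul_inv] using
        χ.hasCompactSupport.comp_homeomorph (Homeomorph.mulRight₀ R⁻¹ (inv_ne_zero hR.ne'))
    exact (h1.comp_left (g := fun y : ℝ => (y : ℂ)) ofReal_zero).mul_right
  have he : 𝓕 ⇑(𝓕⁻ (hs.toSchwartzMap hg) : SchwartzMap ℝ ℂ) = fun t : ℝ =>
      (χ (t / R) : ℂ) * cexp (-(π * a) * t ^ 2) := by
    rw [← SchwartzMap.fourier_coe, FourierTransform.fourier_fourierInv_eq]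
    rfl
  exact ⟨𝓕⁻ (hs.toSchwartzMap hg), by rw [he]; exact hs, fun t => by rw [he]⟩

theorem one_add_sq_mul_exp_neg_pi_le {R : ℝ} (hR : 1 ≤ R) (x y : ℝ) :
    (1 + x ^ 2) * rexp (-π * (x - y / R) ^ 2) ≤ 2 * (1 + y ^ 2) := by
  set w := y / R with hw
  have hR0 : 0 < R := by linarith
  have hwy : w ^ 2 ≤ y ^ 2 := by
    rw [hw, div_pow]
    exact div_le_self (sq_nonneg y) (one_le_pow₀ hR)
  have h1 : (1 + (x - w) ^ 2) * rexp (-π * (x - w) ^ 2) ≤ 1 := by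
    have h2 : 1 + (x - w) ^ 2 ≤ rexp (π * (x - w) ^ 2) :=
      le_trans (by nlinarith [Real.pi_gt_three, sq_nonneg (x - w)])
        (Real.add_one_le_exp (π * (x - w) ^ 2))
    calc (1 + (x - w) ^ 2) * rexp (-π * (x - w) ^ 2)
        ≤ rexp (π * (x - w) ^ 2) * rexp (-π * (x - w) ^ 2) := by gcongr
      _ = 1 := by rw [← Real.exp_add]; simp
  have h3 : 1 + x ^ 2 ≤ 2 * (1 + y ^ 2) * (1 + (x - w) ^ 2) := by
    nlinarith [sq_nonneg (x - w - w), mul_nonneg (sq_nonneg y) (sq_nonneg (x - w))]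
  calc (1 + x ^ 2) * rexp (-π * (x - w) ^ 2)
      ≤ 2 * (1 + y ^ 2) * (1 + (x - w) ^ 2) * rexp (-π * (x - w) ^ 2) := by gcongr
    _ = 2 * (1 + y ^ 2) * ((1 + (x - w) ^ 2) * rexp (-π * (x - w) ^ 2)) := by ring
    _ ≤ 2 * (1 + y ^ 2) * 1 := by gcongr
    _ = _ := mul_one _

theorem norm_integral_exp_mul_gaussian {a : ℂ} (ha : 0 < a.re) (ha' : (1 / a).re = 1) (z : ℝ) :
    ‖∫ t : ℝ, cexp (I * (2 * π * z : ℂ) * t) * cexp (-(π * a) * t ^ 2)‖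
      = (√‖a‖)⁻¹ * rexp (-π * z ^ 2) := by
  have ha0 : a ≠ 0 := fun h => by simp [h] at ha
  have hpi : (π : ℂ) ≠ 0 := by exact_mod_cast Real.pi_ne_zero
  have hh : (1 / 2 : ℂ) = ((1 / 2 : ℝ) : ℂ) := by simp
  rw [fourierIntegral_gaussian (by simpa using mul_pos Real.pi_pos ha), norm_mul, hh,
    Complex.norm_cpow_real, Complex.norm_exp]
  congr 1
  · rw [norm_div, norm_mul, Complex.norm_real, Real.norm_of_nonneg Real.pi_pos.le,
      div_mul_cancel_left₀ Real.pi_ne_zero, ← Real.sqrt_eq_rpow, Real.sqrt_inv]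
  · congr 1
    have : (-(2 * π * z) ^ 2 / (4 * (π * a)) : ℂ) = ((-π * z ^ 2 : ℝ) : ℂ) * (1 / a) := by
      push_cast
      field_simp
      ring
    rw [this, re_ofReal_mul, ha', mul_one]

/-- Truncating the Fourier transform of a complex Gaussian preserves quadratic decay,
uniformly in the chirp and the truncation. -/
theorem exists_norm_schwartz_le (χ : ContDiffBump (0 : ℝ)) :
    ∃ D : ℝ, 0 < D ∧ ∀ {a : ℂ} {R : ℝ} {f : SchwartzMap ℝ ℂ}, 0 < a.re → (1 / a).re = 1 → 1 ≤ R →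
      (∀ t, 𝓕 ⇑f t = (χ (t / R) : ℂ) * cexp (-(π * a) * t ^ 2)) →
      ∀ x, ‖f x‖ ≤ (√‖a‖)⁻¹ * D * (1 + x ^ 2)⁻¹ := by
  obtain ⟨F, -, hF⟩ := exists_schwartz_fourier_eq χ 0 one_pos
  have hFχ : ∀ s, (χ s : ℂ) = ∫ y : ℝ, cexp (-(2 * π * I * y * s)) * F y := fun s => by
    have := hF s
    rw [Real.fourier_eq'] at this
    simp only [div_one, mul_zero, neg_zero, zero_mul, Complex.exp_zero, mul_one] at this
    rw [← this]
    refine integral_congr_ae (Filter.Eventually.of_forall fun y => ?_)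
    simp only [smul_eq_mul]
    congr 2
    simp
    ring
  have hw : Integrable fun y : ℝ => 2 * (1 + y ^ 2) * ‖F y‖ := by
    have h0 := SchwartzMap.integrable_pow_mul volume F 0
    have h2 := SchwartzMap.integrable_pow_mul volume F 2
    refine ((h0.add h2).const_mul 2).congr (Filter.Eventually.of_forall fun y => ?_)
    simp
    ring
  refine ⟨(∫ y : ℝ, 2 * (1 + y ^ 2) * ‖F y‖) + 1,
    add_pos_of_nonneg_of_pos (integral_nonneg fun y => by positivity) one_pos,
    fun {a R f} ha ha' hR hf x => ?_⟩
  have hR0 : 0 < R := by linarith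
  have hRc : (R : ℂ) ≠ 0 := by exact_mod_cast hR0.ne'
  have hG : Integrable fun t : ℝ => cexp (-(π * a) * t ^ 2) :=
    integrable_cexp_neg_mul_sq (by simpa using mul_pos Real.pi_pos ha)
  have hinv : f x = ∫ t : ℝ, ∫ y : ℝ,
      F y * (cexp (I * (2 * π * (x - y / R : ℝ) : ℂ) * t) * cexp (-(π * a) * t ^ 2)) := by
    have h1 : f x = 𝓕⁻ (𝓕 ⇑f) x := by
      rw [← SchwartzMap.fourier_coe, ← SchwartzMap.fourierInv_coe,
        FourierTransform.fourierInv_fourier_eq]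
    rw [h1, Real.fourierInv_eq']
    refine integral_congr_ae (Filter.Eventually.of_forall fun t => ?_)
    simp only [hf, hFχ, smul_eq_mul]
    rw [← integral_mul_const, ← integral_const_mul]
    refine integral_congr_ae (Filter.Eventually.of_forall fun y => ?_)
    simp only
    have : cexp (I * (2 * π * (x - y / R : ℝ) : ℂ) * t)
        = cexp ((2 * π * inner ℝ t x : ℝ) * I) * cexp (-(2 * π * I * y * (t / R : ℝ))) := by
      rw [← Complex.exp_add]
      congr 1
      simp
      field_simp
      ring
    rw [this]
    ring
  have hint : Integrable (Function.uncurry fun t y : ℝ =>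
      F y * (cexp (I * (2 * π * (x - y / R : ℝ) : ℂ) * t) * cexp (-(π * a) * t ^ 2)))
      (volume.prod volume) := by
    refine ((hG.norm.mul_prod F.integrable.norm)).mono'
      (Continuous.aestronglyMeasurable ?_) (Filter.Eventually.of_forall fun z => ?_)
    · have := F.continuous
      unfold Function.uncurry
      fun_prop
    · have : ‖cexp (I * (2 * π * (x - z.2 / R : ℝ) : ℂ) * z.1)‖ = 1 := by
        rw [Complex.norm_exp]
        simp
      simp only [Function.uncurry]
      rw [norm_mul, norm_mul, this, one_mul, mul_comm]
  rw [hinv, integral_integral_swap hint]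
  simp only [integral_const_mul]
  have hx : 0 < 1 + x ^ 2 := by positivity
  calc ‖∫ y : ℝ, F y * ∫ t : ℝ, cexp (I * (2 * π * (x - y / R : ℝ) : ℂ) * t)
          * cexp (-(π * a) * t ^ 2)‖
      ≤ ∫ y : ℝ, (√‖a‖)⁻¹ * (1 + x ^ 2)⁻¹ * (2 * (1 + y ^ 2) * ‖F y‖) := by
        refine norm_integral_le_of_norm_le (hw.const_mul _)
          (Filter.Eventually.of_forall fun y => ?_)
        rw [norm_mul, norm_integral_exp_mul_gaussian ha ha']
        have h := one_add_sq_mul_exp_neg_pi_le hR x y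
        rw [← le_div_iff₀' hx] at h
        calc ‖F y‖ * ((√‖a‖)⁻¹ * rexp (-π * (x - y / R) ^ 2))
            ≤ ‖F y‖ * ((√‖a‖)⁻¹ * (2 * (1 + y ^ 2) / (1 + x ^ 2))) := by gcongr
          _ = _ := by ring
    _ = (√‖a‖)⁻¹ * (∫ y : ℝ, 2 * (1 + y ^ 2) * ‖F y‖) * (1 + x ^ 2)⁻¹ := by
        rw [integral_const_mul]
        ring
    _ ≤ _ := by
        gcongr
        linarith

theorem memLp_inv_one_add_sq {p : ℝ} (hp : 1 ≤ p) :
    MemLp (fun x : ℝ => (1 + x ^ 2)⁻¹) (ENNReal.ofReal p) volume := by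
  have hc : Continuous fun x : ℝ => (1 + x ^ 2)⁻¹ :=
    Continuous.inv₀ (by fun_prop) fun x => by positivity
  have hp0 : 0 < p := by linarith
  refine (integrable_norm_rpow_iff hc.aestronglyMeasurable (by simpa using hp0)
    ENNReal.ofReal_ne_top).1 ?_
  rw [ENNReal.toReal_ofReal hp0.le]
  refine integrable_inv_one_add_sq.mono'
    (hc.norm.rpow_const fun x => Or.inr hp0.le).aestronglyMeasurable
    (Filter.Eventually.of_forall fun x => ?_)
  have h0 : 0 < (1 + x ^ 2)⁻¹ := by positivity
  have h1 : (1 + x ^ 2)⁻¹ ≤ 1 := inv_le_one_of_one_le₀ (by nlinarith [sq_nonneg x])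
  rw [Real.norm_of_nonneg (by positivity), Real.norm_of_nonneg h0.le]
  simpa using Real.rpow_le_rpow_of_exponent_ge h0 h1 hp

theorem Cop_eq_setIntegral_chirpForm {χ : ContDiffBump (0 : ℝ)} {a : ℂ} {R : ℝ} {f g : ℝ → ℂ}
    (hf : ∀ t, 𝓕 f t = (χ (t / R) : ℂ) * cexp (-(π * a) * t ^ 2))
    (hg : ∀ t, 𝓕 g t = (χ (t / R) : ℂ) * cexp (-(π * (starRingEnd ℂ) a) * t ^ 2)) (x : ℝ) :
    Cop ![(1 : ℝ), -1, 1] ![f, g, f] x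
      = ∫ t in {t : Fin 3 → ℝ | StrictMono t},
          ((∏ i, χ (t i / R) : ℝ) : ℂ) * chirpForm a x t := by
  rw [Cop]
  refine integral_congr_ae (Filter.Eventually.of_forall fun t => ?_)
  simp only [Fin.prod_univ_three, Fin.sum_univ_three, Matrix.cons_val_zero, Matrix.cons_val_one,
    Matrix.cons_val, hf, hg, chirpForm]
  have e : cexp (-π * (a * t 0 ^ 2 + (starRingEnd ℂ) a * t 1 ^ 2 + a * t 2 ^ 2)
      + 2 * π * I * x * (t 0 - t 1 + t 2))
      = cexp (-(π * a) * t 0 ^ 2) * cexp (-(π * (starRingEnd ℂ) a) * t 1 ^ 2)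
        * cexp (-(π * a) * t 2 ^ 2) * cexp (2 * π * I * x * (t 0 - t 1 + t 2)) := by
    rw [← Complex.exp_add, ← Complex.exp_add, ← Complex.exp_add]
    congr 1
    ring
  rw [e]
  push_cast
  rw [one_mul, neg_one_mul, one_mul, ← sub_eq_add_neg]
  ring

/-- Removing the frequency truncation, uniformly in the spatial variable. -/
theorem exists_truncation (χ : ContDiffBump (0 : ℝ)) {a : ℂ} (ha : 0 < a.re) {δ : ℝ} (hδ : 0 < δ) :
    ∃ R : ℝ, 1 ≤ R ∧ ∀ x : ℝ,
      ‖(∫ t in {t : Fin 3 → ℝ | StrictMono t}, chirpForm a x t)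
        - ∫ t in {t : Fin 3 → ℝ | StrictMono t},
            ((∏ i, χ (t i / R) : ℝ) : ℂ) * chirpForm a x t‖ ≤ δ := by
  set G : (Fin 3 → ℝ) → ℝ := fun t => ∏ i, rexp (-(π * a.re) * t i ^ 2) with hG
  have hGi : Integrable G := integrable_prod_gaussian (mul_pos Real.pi_pos ha)
  have hG0 : ∀ t, 0 ≤ G t := fun t => Finset.prod_nonneg fun i _ => (Real.exp_pos _).le
  have hGc : Continuous G := by fun_prop
  have hχ0 : ∀ (R : ℝ) (t : Fin 3 → ℝ), 0 ≤ ∏ i, χ (t i / R) :=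
    fun R t => Finset.prod_nonneg fun i _ => χ.nonneg
  have hχ1 : ∀ (R : ℝ) (t : Fin 3 → ℝ), ∏ i, χ (t i / R) ≤ 1 :=
    fun R t => Finset.prod_le_one (fun i _ => χ.nonneg) fun i _ => χ.le_one
  have hχc : ∀ R : ℝ, Continuous fun t : Fin 3 → ℝ => ∏ i, χ (t i / R) := fun R => by
    have := χ.continuous
    fun_prop
  have hbd : ∀ (R : ℝ) (t : Fin 3 → ℝ), ‖(1 - ∏ i, χ (t i / R)) * G t‖ ≤ G t := fun R t => by
    rw [norm_mul, Real.norm_of_nonneg (hG0 t), Real.norm_of_nonneg (sub_nonneg.2 (hχ1 R t))]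
    exact mul_le_of_le_one_left (hG0 t) (by linarith [hχ0 R t])
  have hint : ∀ R : ℝ, Integrable fun t : Fin 3 → ℝ => (1 - ∏ i, χ (t i / R)) * G t := fun R =>
    hGi.mono' (((continuous_const.sub (hχc R)).mul hGc).aestronglyMeasurable)
      (Filter.Eventually.of_forall (hbd R))
  have hlim : Filter.Tendsto (fun R : ℝ => ∫ t : Fin 3 → ℝ, (1 - ∏ i, χ (t i / R)) * G t)
      Filter.atTop (nhds (∫ _ : Fin 3 → ℝ, (0 : ℝ))) := by
    refine tendsto_integral_filter_of_dominated_convergence G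
      (Filter.Eventually.of_forall fun R => (hint R).aestronglyMeasurable)
      (Filter.Eventually.of_forall fun R => Filter.Eventually.of_forall (hbd R)) hGi
      (Filter.Eventually.of_forall fun t => ?_)
    have h1 : Filter.Tendsto (fun R : ℝ => ∏ i, χ (t i / R)) Filter.atTop
        (nhds (∏ _i : Fin 3, (1 : ℝ))) := by
      refine tendsto_finsetProd _ fun i _ => ?_
      have h2 : Filter.Tendsto (fun R : ℝ => t i / R) Filter.atTop (nhds 0) :=
        tendsto_const_nhds.div_atTop Filter.tendsto_id
      have h3 := (χ.continuous.tendsto 0).comp h2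
      rwa [χ.one_of_mem_closedBall (Metric.mem_closedBall_self χ.rIn_pos.le)] at h3
    simpa using (h1.const_sub 1).mul_const (G t)
  rw [integral_zero] at hlim
  obtain ⟨R, hR1, hR⟩ :=
    ((Filter.eventually_ge_atTop (1 : ℝ)).and (hlim.eventually_lt_const hδ)).exists
  refine ⟨R, hR1, fun x => ?_⟩
  have hi1 := (integrable_chirpForm ha x).integrableOn (s := {t : Fin 3 → ℝ | StrictMono t})
  have hi2 : IntegrableOn (fun t : Fin 3 → ℝ => ((∏ i, χ (t i / R) : ℝ) : ℂ) * chirpForm a x t)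
      {t | StrictMono t} := by
    refine Integrable.bdd_mul (c := 1) hi1
      (continuous_ofReal.comp (hχc R)).aestronglyMeasurable
      (Filter.Eventually.of_forall fun t => ?_)
    rw [Complex.norm_real, Real.norm_of_nonneg (hχ0 R t)]
    exact hχ1 R t
  rw [← integral_sub hi1 hi2]
  refine (norm_integral_le_of_norm_le (hint R).integrableOn
    (Filter.Eventually.of_forall fun t => ?_)).trans
    ((setIntegral_le_integral (hint R) (Filter.Eventually.of_forall fun t =>
      mul_nonneg (sub_nonneg.2 (hχ1 R t)) (hG0 t))).trans hR.le)
  have : chirpForm a x t - ((∏ i, χ (t i / R) : ℝ) : ℂ) * chirpForm a x t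
      = ((1 - ∏ i, χ (t i / R) : ℝ) : ℂ) * chirpForm a x t := by
    push_cast
    ring
  rw [this, norm_mul, norm_chirpForm, Complex.norm_real,
    Real.norm_of_nonneg (sub_nonneg.2 (hχ1 R t))]

theorem ofReal_le_eLpNorm_of_le_norm {F : ℝ → ℂ} {c s : ℝ} (hs : 0 < s) (hc : 0 ≤ c)
    (h : ∀ x, |x| ≤ 1 → c ≤ ‖F x‖) :
    ENNReal.ofReal c ≤ eLpNorm F (ENNReal.ofReal s) volume := by
  have h1 : eLpNorm ((Set.Icc (-1 : ℝ) 1).indicator fun _ => c) (ENNReal.ofReal s) volume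
      ≤ eLpNorm F (ENNReal.ofReal s) volume := by
    refine eLpNorm_mono fun x => ?_
    by_cases hx : x ∈ Set.Icc (-1 : ℝ) 1
    · rw [Set.indicator_of_mem hx, Real.norm_of_nonneg hc]
      exact h x (abs_le.2 hx)
    · simp [Set.indicator_of_notMem hx]
  refine le_trans ?_ h1
  rw [eLpNorm_indicator_const measurableSet_Icc (by simpa using hs) ENNReal.ofReal_ne_top,
    Real.enorm_of_nonneg hc, Real.volume_Icc]
  refine le_mul_of_one_le_right' (ENNReal.one_le_rpow ?_ ?_)
  · norm_num
  · rw [ENNReal.toReal_ofReal hs.le]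
    positivity

/-- `C₃^{(1,-1,1)}` is unbounded on Schwartz functions with compactly
supported Fourier transform, for every choice of exponents `p,q,r ≥ 1`. -/
theorem stmt6 (p q r : ℝ) (hp : 1 ≤ p) (hq : 1 ≤ q) (hr : 1 ≤ r)
    (C : ℝ) (hC : 0 < C) :
    ∃ f g h : SchwartzMap ℝ ℂ,
      HasCompactSupport (𝓕 ⇑f) ∧ HasCompactSupport (𝓕 ⇑g) ∧ HasCompactSupport (𝓕 ⇑h) ∧
      ENNReal.ofReal C *
          eLpNorm ⇑f (ENNReal.ofReal p) volume *
          eLpNorm ⇑g (ENNReal.ofReal q) volume *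
          eLpNorm ⇑h (ENNReal.ofReal r) volume <
        eLpNorm (Cop ![(1 : ℝ), -1, 1] ![⇑f, ⇑g, ⇑h])
          (ENNReal.ofReal (1 / (1 / p + 1 / q + 1 / r))) volume := by
  have χ : ContDiffBump (0 : ℝ) := default
  obtain ⟨E, hE⟩ := exists_le_norm_setIntegral_chirpForm
  obtain ⟨D, hD, hdecay⟩ := exists_norm_schwartz_le χ
  set N : ℝ → ℝ := fun p =>
    (eLpNorm (fun x : ℝ => (1 + x ^ 2)⁻¹) (ENNReal.ofReal p) volume).toReal with hN
  have hN0 : ∀ p, 0 ≤ N p := fun p => ENNReal.toReal_nonneg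
  set κ := rexp (-3 * π) / 4 with hκ
  have hκ0 : 0 < κ := by positivity
  set K := C * (D * N p) * (D * N q) * (D * N r) / κ with hK
  have hK0 : 0 ≤ K := by
    have := hN0 p
    have := hN0 q
    have := hN0 r
    positivity
  obtain ⟨lam, hlam, hlog⟩ := ((Filter.eventually_ge_atTop (8 : ℝ)).and
    (Real.tendsto_log_atTop.eventually_ge_atTop ((E + (K + 1)) * (2 * π)))).exists
  rw [← le_div_iff₀ (by positivity)] at hlog
  set X := Real.log lam / (2 * π) - E with hX
  have hXK : K + 1 ≤ X := by linarith
  have hX0 : 0 < X := by linarith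
  set L := √(1 + lam ^ 2) with hL
  have hL2 : L ^ 2 = 1 + lam ^ 2 := Real.sq_sqrt (by positivity)
  have hL0 : 0 < L := Real.sqrt_pos.2 (by positivity)
  set m := √L with hm
  have hm0 : 0 < m := Real.sqrt_pos.2 hL0
  have hm2 : m ^ 2 = L := Real.sq_sqrt hL0.le
  set a : ℂ := (1 + lam * I) / (1 + lam ^ 2) with ha
  have hLc : (1 + lam ^ 2 : ℂ) = ((L ^ 2 : ℝ) : ℂ) := by
    rw [hL2]
    push_cast
    rfl
  have hre : a.re = 1 / L ^ 2 := by
    rw [ha, hLc, div_ofReal_re]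
    simp
  have hnsq : normSq a = 1 / L ^ 2 := by
    rw [ha, hLc, normSq_div, normSq_ofReal, normSq_apply]
    simp
    rw [← sq, ← hL2]
    field_simp
  have hnorm : ‖a‖ = L⁻¹ := by
    rw [← Real.sqrt_sq (norm_nonneg a), Complex.sq_norm, hnsq, one_div, ← inv_pow,
      Real.sqrt_sq (by positivity)]
  have hare : 0 < a.re := by
    rw [hre]
    positivity
  have hinv : (1 / a).re = 1 := by
    rw [one_div, inv_re, hnsq, hre, div_self (by positivity)]
  have hmn : (√‖a‖)⁻¹ = m := by
    rw [hnorm, Real.sqrt_inv, inv_inv]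
  obtain ⟨R, hR1, hR⟩ := exists_truncation χ hare (δ := L * m * (κ * X)) (by positivity)
  obtain ⟨f, hfs, hf⟩ := exists_schwartz_fourier_eq χ a (by linarith : 0 < R)
  obtain ⟨g, hgs, hg⟩ := exists_schwartz_fourier_eq χ ((starRingEnd ℂ) a) (by linarith : 0 < R)
  have hNp : ∀ (F : SchwartzMap ℝ ℂ), (∀ x, ‖F x‖ ≤ m * D * (1 + x ^ 2)⁻¹) → ∀ p : ℝ, 1 ≤ p →
      eLpNorm F (ENNReal.ofReal p) volume ≤ ENNReal.ofReal (m * (D * N p)) := fun F hF p hp => by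
    rw [← mul_assoc, ENNReal.ofReal_mul (by positivity), hN,
      ENNReal.ofReal_toReal (memLp_inv_one_add_sq hp).2.ne]
    refine eLpNorm_le_mul_eLpNorm_of_ae_le_mul (Filter.Eventually.of_forall fun x => ?_) _
    rw [Real.norm_of_nonneg (by positivity : 0 ≤ (1 + x ^ 2)⁻¹)]
    exact hF x
  have hfd : ∀ x, ‖f x‖ ≤ m * D * (1 + x ^ 2)⁻¹ := by
    have := hdecay hare hinv hR1 hf
    rwa [hmn] at this
  have hgd : ∀ x, ‖g x‖ ≤ m * D * (1 + x ^ 2)⁻¹ := by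
    have hinv' : (1 / (starRingEnd ℂ) a).re = 1 := by
      rw [← map_one (starRingEnd ℂ), ← map_div₀, conj_re, hinv]
    have := hdecay (by rwa [conj_re]) hinv' hR1 hg
    rwa [RCLike.norm_conj, hmn] at this
  refine ⟨f, g, f, hfs, hgs, hfs, ?_⟩
  have hlow : ∀ x : ℝ, |x| ≤ 1 →
      L * m * (κ * X) ≤ ‖Cop ![(1 : ℝ), -1, 1] ![⇑f, ⇑g, ⇑f] x‖ := fun x hx => by
    have h1 := hE hlam hx (by linarith)
    have h2 := hR x
    rw [← Cop_eq_setIntegral_chirpForm hf hg x] at h2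
    have h3 := norm_sub_norm_le (∫ t in {t : Fin 3 → ℝ | StrictMono t}, chirpForm a x t)
      (Cop ![(1 : ℝ), -1, 1] ![⇑f, ⇑g, ⇑f] x)
    have h4 : L * m * (rexp (-3 * π) / 2 * X) = 2 * (L * m * (κ * X)) := by
      rw [hκ]
      ring
    rw [h4] at h1
    linarith
  have hp0 : 0 < p := by linarith
  have hq0 : 0 < q := by linarith
  have hr0 : 0 < r := by linarith
  refine lt_of_lt_of_le ?_ (ofReal_le_eLpNorm_of_le_norm (by positivity) (by positivity) hlow)
  calc ENNReal.ofReal C * eLpNorm f (ENNReal.ofReal p) volume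
        * eLpNorm g (ENNReal.ofReal q) volume * eLpNorm f (ENNReal.ofReal r) volume
      ≤ ENNReal.ofReal C * ENNReal.ofReal (m * (D * N p)) * ENNReal.ofReal (m * (D * N q))
          * ENNReal.ofReal (m * (D * N r)) := by
        gcongr
        · exact hNp f hfd p hp
        · exact hNp g hgd q hq
        · exact hNp f hfd r hr
    _ = ENNReal.ofReal (L * m * (κ * K)) := by
        have := hN0 p
        have := hN0 q
        have := hN0 r
        rw [← ENNReal.ofReal_mul (by positivity), ← ENNReal.ofReal_mul (by positivity),
          ← ENNReal.ofReal_mul (by positivity), hK, ← hm2]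
        congr 1
        field_simp
    _ < ENNReal.ofReal (L * m * (κ * X)) := by
        rw [ENNReal.ofReal_lt_ofReal_iff (by positivity)]
        gcongr
        linarith
end

section
/- For every p > 1 there exist constants c, C > 0 and N_0 such that for all N ≥ N_0, c N^{1/p} ≤ ( ∫_ℝ | ∫_{−N}^{N} e^{2πix²} e^{−2πixξ} dx |^p dξ )^{1/p} ≤ C N^{1/p}. In other words, the L^p norm of the Fourier transform of e^{2πix²} χ_{[−N,N]}(x) is comparable to N^{1/p}. -/
open MeasureTheory Complex
open scoped Real ENNReal

/-- The `L^p` norm in `ξ` of the Fourier transform of `e^{2πix²} χ_{[-N,N]}(x)`: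
`( ∫_ℝ | ∫_{-N}^{N} e^{2πix²} e^{-2πixξ} dx |^p dξ )^{1/p}`. -/
noncomputable def chirpNorm (N p : ℝ) : ℝ :=
  (∫ ξ : ℝ, ‖∫ x in Set.Icc (-N) N,
      Complex.exp (2 * π * Complex.I * x ^ 2) *
        Complex.exp (-(2 * π * Complex.I * x * ξ))‖ ^ p) ^ (1 / p)

/-- The quadratic chirp `e^{2πiu²}`. -/
noncomputable def chirp (u : ℝ) : ℂ := Complex.exp (2 * π * Complex.I * u ^ 2)

theorem continuous_chirp : Continuous chirp := by
  unfold chirp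
  fun_prop

theorem norm_chirp (u : ℝ) : ‖chirp u‖ = 1 := by
  rw [chirp, show (2 * π * Complex.I * u ^ 2 : ℂ) = ((2 * π * u ^ 2 : ℝ) : ℂ) * Complex.I by
    push_cast; ring]
  exact Complex.norm_exp_ofReal_mul_I _

theorem chirp_neg (u : ℝ) : chirp (-u) = chirp u := by
  simp [chirp]

theorem chirp_im (u : ℝ) : (chirp u).im = Real.sin (2 * π * u ^ 2) := by
  rw [chirp, show (2 * π * Complex.I * u ^ 2 : ℂ) = ((2 * π * u ^ 2 : ℝ) : ℂ) * Complex.I by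
    push_cast; ring]
  exact Complex.exp_ofReal_mul_I_im _

theorem intervalIntegrable_chirp (a b : ℝ) : IntervalIntegrable chirp volume a b :=
  continuous_chirp.intervalIntegrable a b

theorem integral_chirp_neg (a b : ℝ) :
    ∫ u in (-b)..(-a), chirp u = ∫ u in a..b, chirp u := by
  rw [← intervalIntegral.integral_comp_neg]
  simp only [chirp_neg]

/-- Completing the square in the phase. -/
theorem norm_integral_chirp_mul_exp {N : ℝ} (hN : 0 ≤ N) (ξ : ℝ) :
    ‖∫ x in Set.Icc (-N) N, Complex.exp (2 * π * Complex.I * x ^ 2) *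
        Complex.exp (-(2 * π * Complex.I * x * ξ))‖ =
      ‖∫ u in (-N - ξ / 2)..(N - ξ / 2), chirp u‖ := by
  rw [integral_Icc_eq_integral_Ioc, ← intervalIntegral.integral_of_le (by linarith),
    ← intervalIntegral.integral_comp_sub_right]
  have h : ∀ x : ℝ, Complex.exp (2 * π * Complex.I * x ^ 2) *
        Complex.exp (-(2 * π * Complex.I * x * ξ)) =
      Complex.exp ((-(π * ξ ^ 2 / 2) : ℝ) * Complex.I) * chirp (x - ξ / 2) := by
    intro x
    rw [chirp, ← Complex.exp_add, ← Complex.exp_add]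
    congr 1
    push_cast
    ring
  simp only [h]
  rw [intervalIntegral.integral_const_mul, norm_mul, Complex.norm_exp_ofReal_mul_I, one_mul]

theorem integral_inv_sq {a b : ℝ} (ha : 0 < a) (hab : a ≤ b) :
    ∫ u in a..b, 1 / (4 * π * u ^ 2) = 1 / (4 * π * a) - 1 / (4 * π * b) := by
  have hpos : ∀ u ∈ Set.uIcc a b, 0 < u := fun u hu => by
    rw [Set.uIcc_of_le hab] at hu
    exact ha.trans_le hu.1
  have hd : ∀ u ∈ Set.uIcc a b,
      HasDerivAt (fun u : ℝ => -(u⁻¹ / (4 * π))) (1 / (4 * π * u ^ 2)) u := fun u hu => by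
    have hu0 := (hpos u hu).ne'
    exact ((hasDerivAt_inv hu0).div_const (4 * π)).neg.congr_deriv (by field_simp)
  have hc : ContinuousOn (fun u : ℝ => 1 / (4 * π * u ^ 2)) (Set.uIcc a b) :=
    ContinuousOn.div (by fun_prop) (by fun_prop) fun u hu => by
      have := hpos u hu
      positivity
  rw [intervalIntegral.integral_eq_sub_of_hasDerivAt hd hc.intervalIntegrable]
  have hb := ha.trans_le hab
  field_simp
  ring

/-- First-derivative (van der Corput) bound away from the stationary point. -/
theorem norm_integral_chirp_le {a b : ℝ} (ha : 0 < a) (hab : a ≤ b) :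
    ‖∫ u in a..b, chirp u‖ ≤ 1 / (2 * π * a) := by
  have hb := ha.trans_le hab
  have hpos : ∀ u ∈ Set.uIcc a b, 0 < u := fun u hu => by
    rw [Set.uIcc_of_le hab] at hu
    exact ha.trans_le hu.1
  have hd : ∀ u ∈ Set.uIcc a b, HasDerivAt (fun u : ℝ => chirp u / (4 * π * Complex.I * u))
      (chirp u - chirp u / (4 * π * Complex.I * u ^ 2)) u := fun u hu => by
    have hu0 : (u : ℂ) ≠ 0 := by exact_mod_cast (hpos u hu).ne'
    have hπ : (π : ℂ) ≠ 0 := by exact_mod_cast Real.pi_ne_zero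
    have h1 : HasDerivAt (fun u : ℝ => (u : ℂ)) 1 u := Complex.ofRealCLM.hasDerivAt
    have h2 : HasDerivAt chirp (chirp u * (2 * π * Complex.I * (2 * u))) u :=
      ((h1.pow 2).const_mul (2 * π * Complex.I)).cexp.congr_deriv (by simp [chirp])
    refine (h2.div (h1.const_mul (4 * π * Complex.I)) (by simp [hu0, hπ])).congr_deriv ?_
    have hI := Complex.I_ne_zero
    field_simp
    ring
  have hc : ContinuousOn (fun u : ℝ => chirp u / (4 * π * Complex.I * u ^ 2)) (Set.uIcc a b) :=
    ContinuousOn.div continuous_chirp.continuousOn (by fun_prop) fun u hu => by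
      have hu0 : (u : ℂ) ≠ 0 := by exact_mod_cast (hpos u hu).ne'
      have hπ : (π : ℂ) ≠ 0 := by exact_mod_cast Real.pi_ne_zero
      simp [hu0, hπ]
  have hFTC := intervalIntegral.integral_eq_sub_of_hasDerivAt hd
    ((intervalIntegrable_chirp a b).sub hc.intervalIntegrable)
  rw [intervalIntegral.integral_sub (intervalIntegrable_chirp a b) hc.intervalIntegrable,
    sub_eq_iff_eq_add] at hFTC
  have hn : ∀ u : ℝ, 0 < u → ‖chirp u / (4 * π * Complex.I * u)‖ = 1 / (4 * π * u) :=
    fun u hu => by simp [norm_chirp, abs_of_pos hu, abs_of_pos Real.pi_pos]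
  have hr : ‖∫ u in a..b, chirp u / (4 * π * Complex.I * u ^ 2)‖ ≤
      1 / (4 * π * a) - 1 / (4 * π * b) := by
    rw [← integral_inv_sq ha hab]
    refine intervalIntegral.norm_integral_le_of_norm_le hab (.of_forall fun u _ => ?_) ?_
    · simp [norm_chirp, abs_of_pos Real.pi_pos]
    · refine (ContinuousOn.div (by fun_prop) (by fun_prop) fun u hu => ?_).intervalIntegrable
      have := hpos u hu
      positivity
  calc ‖∫ u in a..b, chirp u‖
      ≤ 1 / (4 * π * b) + 1 / (4 * π * a) + (1 / (4 * π * a) - 1 / (4 * π * b)) := by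
        rw [hFTC, ← hn a ha, ← hn b hb]
        exact (norm_add_le _ _).trans (add_le_add (norm_sub_le _ _) (by rwa [hn a ha, hn b hb]))
    _ = 1 / (2 * π * a) := by field_simp; ring

theorem norm_integral_chirp_zero_le_of_nonneg {b : ℝ} (hb : 0 ≤ b) :
    ‖∫ u in (0 : ℝ)..b, chirp u‖ ≤ 2 := by
  have hshort : ∀ c : ℝ, 0 ≤ c → c ≤ 1 → ‖∫ u in (0 : ℝ)..c, chirp u‖ ≤ 1 := fun c h0 h1 => by
    have := intervalIntegral.norm_integral_le_of_norm_le_const (a := 0) (b := c) (f := chirp)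
      (C := 1) fun u _ => (norm_chirp u).le
    rw [sub_zero, abs_of_nonneg h0, one_mul] at this
    exact this.trans h1
  rcases le_total b 1 with h | h
  · exact (hshort b hb h).trans one_le_two
  · rw [← intervalIntegral.integral_add_adjacent_intervals (intervalIntegrable_chirp 0 1)
      (intervalIntegrable_chirp 1 b)]
    have h1 := norm_integral_chirp_le one_pos h
    have h2 : 1 / (2 * π * 1) ≤ 1 := by
      rw [div_le_one (by positivity)]
      linarith [Real.pi_gt_three]
    exact (norm_add_le _ _).trans (by linarith [hshort 1 zero_le_one le_rfl])

theorem norm_integral_chirp_zero_le (b : ℝ) : ‖∫ u in (0 : ℝ)..b, chirp u‖ ≤ 2 := by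
  rcases le_total 0 b with h | h
  · exact norm_integral_chirp_zero_le_of_nonneg h
  · rw [intervalIntegral.integral_symm, norm_neg, ← neg_zero, ← neg_neg b, integral_chirp_neg]
    exact norm_integral_chirp_zero_le_of_nonneg (neg_nonneg.2 h)

theorem norm_integral_chirp_le_four (a b : ℝ) : ‖∫ u in a..b, chirp u‖ ≤ 4 := by
  rw [← intervalIntegral.integral_interval_sub_left (intervalIntegrable_chirp 0 b)
    (intervalIntegrable_chirp 0 a)]
  exact (norm_sub_le _ _).trans
    (by linarith [norm_integral_chirp_zero_le a, norm_integral_chirp_zero_le b])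

theorem norm_integral_chirp_window_neg (N ξ : ℝ) :
    ‖∫ u in (-N - -ξ / 2)..(N - -ξ / 2), chirp u‖ =
      ‖∫ u in (-N - ξ / 2)..(N - ξ / 2), chirp u‖ := by
  rw [← integral_chirp_neg (-N - ξ / 2)]
  congr 3 <;> ring

theorem norm_integral_chirp_window_le {N : ℝ} (hN : 1 ≤ N) (ξ : ℝ) :
    ‖∫ u in (-N - ξ / 2)..(N - ξ / 2), chirp u‖ ≤ 20 * (1 + ‖ξ / N‖)⁻¹ := by
  wlog hξ : ξ ≤ 0 generalizing ξ
  · have := this (-ξ) (by linarith)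
    rwa [norm_integral_chirp_window_neg, neg_div, norm_neg] at this
  have hN0 : 0 < N := by linarith
  rw [Real.norm_eq_abs, abs_div, abs_of_nonpos hξ, abs_of_pos hN0, ← div_eq_mul_inv]
  have hq : 0 ≤ -ξ / N := div_nonneg (by linarith) hN0.le
  rw [le_div_iff₀ (by positivity)]
  rcases le_total (-ξ) (4 * N) with h | h
  · have h4 : -ξ / N ≤ 4 := (div_le_iff₀ hN0).2 h
    nlinarith [norm_integral_chirp_le_four (-N - ξ / 2) (N - ξ / 2),
      norm_nonneg (∫ u in (-N - ξ / 2)..(N - ξ / 2), chirp u)]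
  · have ha : -ξ / 4 ≤ -N - ξ / 2 := by linarith
    have hξ4 : 0 < -ξ / 4 := by linarith
    have h1 := norm_integral_chirp_le (hξ4.trans_le ha) (show -N - ξ / 2 ≤ N - ξ / 2 by linarith)
    have h2 : 1 / (2 * π * (-N - ξ / 2)) ≤ 1 / -ξ :=
      one_div_le_one_div_of_le (by linarith) (by nlinarith [Real.pi_gt_three])
    have h3 : 1 + -ξ / N ≤ 20 * -ξ := by
      have : -ξ / N ≤ -ξ := div_le_self (by linarith) hN
      linarith
    calc _ ≤ 1 / -ξ * (20 * -ξ) := mul_le_mul (h1.trans h2) h3 (by positivity)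
          (one_div_nonneg.2 (by linarith))
      _ = 20 := by
        have : ξ ≠ 0 := by linarith
        field_simp

/-- The boundary term `(1 - cos (2πu²)) / (4πu)` has derivative at most `sin (2πu²)`. -/
theorem neg_le_integral_sin_sq {b : ℝ} (hb : 1 / 2 ≤ b) :
    -(1 / (2 * π)) ≤ ∫ u in (1 / 2 : ℝ)..b, Real.sin (2 * π * u ^ 2) := by
  have hpos : ∀ u ∈ Set.uIcc (1 / 2) b, 0 < u := fun u hu => by
    rw [Set.uIcc_of_le hb] at hu
    linarith [hu.1]
  have hd : ∀ u ∈ Set.uIcc (1 / 2) b,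
      HasDerivAt (fun u : ℝ => (1 - Real.cos (2 * π * u ^ 2)) / (4 * π * u))
        (Real.sin (2 * π * u ^ 2) - (1 - Real.cos (2 * π * u ^ 2)) / (4 * π * u ^ 2)) u :=
    fun u hu => by
      have hu0 := (hpos u hu).ne'
      have h1 : HasDerivAt (fun u : ℝ => 1 - Real.cos (2 * π * u ^ 2))
          (Real.sin (2 * π * u ^ 2) * (2 * π * (2 * u))) u := by
        refine ((((hasDerivAt_id' u).pow 2).const_mul (2 * π)).cos.const_sub 1).congr_deriv ?_
        simp
      refine (h1.div ((hasDerivAt_id' u).const_mul (4 * π)) (by simp [hu0])).congr_deriv ?_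
      field_simp
      ring
  have hs : IntervalIntegrable (fun u : ℝ => Real.sin (2 * π * u ^ 2)) volume (1 / 2) b :=
    Continuous.intervalIntegrable (by fun_prop) _ _
  have hc : IntervalIntegrable (fun u : ℝ => (1 - Real.cos (2 * π * u ^ 2)) / (4 * π * u ^ 2))
      volume (1 / 2) b :=
    (ContinuousOn.div (by fun_prop) (by fun_prop) fun u hu => by
      have := hpos u hu
      positivity).intervalIntegrable
  have hFTC := intervalIntegral.integral_eq_sub_of_hasDerivAt hd (hs.sub hc)
  rw [intervalIntegral.integral_sub hs hc, sub_eq_iff_eq_add] at hFTC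
  have h0 : 0 ≤ ∫ u in (1 / 2 : ℝ)..b, (1 - Real.cos (2 * π * u ^ 2)) / (4 * π * u ^ 2) :=
    intervalIntegral.integral_nonneg hb fun u _ =>
      div_nonneg (sub_nonneg.2 (Real.cos_le_one _)) (by positivity)
  have h1 : 0 ≤ (1 - Real.cos (2 * π * b ^ 2)) / (4 * π * b) :=
    div_nonneg (sub_nonneg.2 (Real.cos_le_one _)) (by positivity)
  have h2 : (1 - Real.cos (2 * π * (1 / 2) ^ 2)) / (4 * π * (1 / 2)) = 1 / (2 * π) := by
    rw [show 2 * π * (1 / 2) ^ 2 = π / 2 by ring, Real.cos_pi_div_two]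
    ring
  rw [hFTC, h2]
  linarith

theorem le_integral_sin_sq {b : ℝ} (hb : 1 / 2 ≤ b) :
    1 / 6 - 1 / (2 * π) ≤ ∫ u in (0 : ℝ)..b, Real.sin (2 * π * u ^ 2) := by
  have hc : Continuous fun u : ℝ => Real.sin (2 * π * u ^ 2) := by fun_prop
  rw [← intervalIntegral.integral_add_adjacent_intervals (hc.intervalIntegrable 0 (1 / 2))
    (hc.intervalIntegrable (1 / 2) b)]
  have h1 : ∫ u in (0 : ℝ)..(1 / 2), 4 * u ^ 2 = 1 / 6 := by
    rw [intervalIntegral.integral_const_mul, integral_pow]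
    norm_num
  have h2 : ∫ u in (0 : ℝ)..(1 / 2), 4 * u ^ 2 ≤
      ∫ u in (0 : ℝ)..(1 / 2), Real.sin (2 * π * u ^ 2) := by
    refine intervalIntegral.integral_mono_on (by norm_num)
      (Continuous.intervalIntegrable (by fun_prop) _ _) (hc.intervalIntegrable _ _) fun u hu => ?_
    have hsq : u ^ 2 ≤ 1 / 4 := by nlinarith [hu.1, hu.2]
    have := Real.mul_le_sin (x := 2 * π * u ^ 2) (by positivity) (by nlinarith [Real.pi_pos])
    calc 4 * u ^ 2 = 2 / π * (2 * π * u ^ 2) := by field_simp; ring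
      _ ≤ _ := this
  linarith [neg_le_integral_sin_sq hb]

theorem le_norm_integral_chirp {a b : ℝ} (ha : a ≤ -(1 / 2)) (hb : 1 / 2 ≤ b) :
    1 / 6 - 1 / (2 * π) ≤ ‖∫ u in a..b, chirp u‖ := by
  have him : ∀ c : ℝ, (∫ u in (0 : ℝ)..c, chirp u).im =
      ∫ u in (0 : ℝ)..c, Real.sin (2 * π * u ^ 2) := fun c => by
    have := Complex.imCLM.intervalIntegral_comp_comm (intervalIntegrable_chirp 0 c)
    simpa [chirp_im] using this.symm
  have hneg : ∫ u in a..0, chirp u = ∫ u in (0 : ℝ)..(-a), chirp u := by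
    rw [← integral_chirp_neg 0 (-a), neg_neg, neg_zero]
  rw [← intervalIntegral.integral_add_adjacent_intervals (intervalIntegrable_chirp a 0)
    (intervalIntegrable_chirp 0 b), hneg]
  refine le_trans ?_ (Complex.abs_im_le_norm _)
  refine le_trans ?_ (le_abs_self _)
  rw [Complex.add_im, him, him]
  have hpos : 0 ≤ 1 / 6 - 1 / (2 * π) :=
    sub_nonneg.2 (one_div_le_one_div_of_le (by norm_num) (by linarith [Real.pi_gt_three]))
  linarith [le_integral_sin_sq hb, le_integral_sin_sq (b := -a) (by linarith)]

theorem continuous_integral_chirp_window (N : ℝ) :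
    Continuous fun ξ : ℝ => ∫ u in (-N - ξ / 2)..(N - ξ / 2), chirp u := by
  have h : Continuous fun b : ℝ => ∫ u in (0 : ℝ)..b, chirp u :=
    intervalIntegral.continuous_primitive intervalIntegrable_chirp 0
  have h' : Continuous fun ξ : ℝ => (∫ u in (0 : ℝ)..(N - ξ / 2), chirp u) -
      ∫ u in (0 : ℝ)..(-N - ξ / 2), chirp u :=
    (h.comp (by fun_prop)).sub (h.comp (by fun_prop))
  simpa only [intervalIntegral.integral_interval_sub_left (intervalIntegrable_chirp 0 _)
    (intervalIntegrable_chirp 0 _)] using h'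

theorem norm_integral_chirp_window_rpow_le {N p : ℝ} (hN : 1 ≤ N) (hp : 0 ≤ p) (ξ : ℝ) :
    ‖∫ u in (-N - ξ / 2)..(N - ξ / 2), chirp u‖ ^ p ≤ 20 ^ p * (1 + ‖ξ / N‖) ^ (-p) := by
  refine (Real.rpow_le_rpow (norm_nonneg _) (norm_integral_chirp_window_le hN ξ) hp).trans_eq ?_
  rw [Real.mul_rpow (by norm_num) (by positivity), Real.inv_rpow (by positivity),
    Real.rpow_neg (by positivity)]

theorem integrable_one_add_norm_rpow_neg {p : ℝ} (hp : 1 < p) :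
    Integrable fun y : ℝ => (1 + ‖y‖) ^ (-p) :=
  integrable_one_add_norm (by simpa using hp)

theorem integrable_norm_integral_chirp_window_rpow {N p : ℝ} (hN : 1 ≤ N) (hp : 1 < p) :
    Integrable fun ξ : ℝ => ‖∫ u in (-N - ξ / 2)..(N - ξ / 2), chirp u‖ ^ p := by
  have hdom := ((integrable_one_add_norm_rpow_neg hp).comp_div (by linarith : N ≠ 0)).const_mul
    ((20 : ℝ) ^ p)
  refine hdom.mono' ?_ (.of_forall fun ξ => ?_)
  · exact ((continuous_integral_chirp_window N).norm.rpow_const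
      fun _ => Or.inr (by linarith)).aestronglyMeasurable
  · rw [Real.norm_of_nonneg (by positivity)]
    exact norm_integral_chirp_window_rpow_le hN (by linarith) ξ

theorem integral_norm_integral_chirp_window_rpow_le {N p : ℝ} (hN : 1 ≤ N) (hp : 1 < p) :
    ∫ ξ : ℝ, ‖∫ u in (-N - ξ / 2)..(N - ξ / 2), chirp u‖ ^ p ≤
      20 ^ p * (∫ y : ℝ, (1 + ‖y‖) ^ (-p)) * N := by
  have hdom := ((integrable_one_add_norm_rpow_neg hp).comp_div (by linarith : N ≠ 0)).const_mul
    ((20 : ℝ) ^ p)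
  refine (integral_mono (integrable_norm_integral_chirp_window_rpow hN hp) hdom
    fun ξ => norm_integral_chirp_window_rpow_le hN (by linarith) ξ).trans_eq ?_
  rw [integral_const_mul, Measure.integral_comp_div (fun y : ℝ => (1 + ‖y‖) ^ (-p)),
    abs_of_nonneg (by linarith), smul_eq_mul]
  ring

theorem le_integral_norm_integral_chirp_window_rpow {N p : ℝ} (hN : 1 ≤ N) (hp : 1 < p) :
    2 * (1 / 6 - 1 / (2 * π)) ^ p * N ≤
      ∫ ξ : ℝ, ‖∫ u in (-N - ξ / 2)..(N - ξ / 2), chirp u‖ ^ p := by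
  have hint := integrable_norm_integral_chirp_window_rpow hN hp
  have hpos : 0 ≤ 1 / 6 - 1 / (2 * π) :=
    sub_nonneg.2 (one_div_le_one_div_of_le (by norm_num) (by linarith [Real.pi_gt_three]))
  refine le_trans ?_ (setIntegral_le_integral (s := Set.Icc (-N) N) hint
    (.of_forall fun ξ => by positivity))
  have h := setIntegral_ge_of_const_le_real (μ := volume) (s := Set.Icc (-N) N)
    (c := (1 / 6 - 1 / (2 * π)) ^ p) measurableSet_Icc (by simp) (fun ξ hξ =>
      Real.rpow_le_rpow hpos (le_norm_integral_chirp (a := -N - ξ / 2) (b := N - ξ / 2)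
        (by linarith [hξ.1]) (by linarith [hξ.2])) (by linarith)) hint.integrableOn
  rw [Real.volume_real_Icc_of_le (by linarith)] at h
  linarith

/-- for `p > 1` the `L^p` norm of the Fourier transform of
`e^{2πix²} χ_{[-N,N]}` is comparable to `N^{1/p}`. -/
theorem stmt7 (p : ℝ) (hp : 1 < p) :
    ∃ c C N₀ : ℝ, 0 < c ∧ 0 < C ∧ 1 ≤ N₀ ∧ ∀ N : ℝ, N₀ ≤ N →
      c * N ^ (1 / p) ≤ chirpNorm N p ∧ chirpNorm N p ≤ C * N ^ (1 / p) := by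
  have hp0 : 0 ≤ 1 / p := by positivity
  have hc : 0 < 1 / 6 - 1 / (2 * π) :=
    sub_pos.2 (one_div_lt_one_div_of_lt (by norm_num) (by linarith [Real.pi_gt_three]))
  have hA : 0 < 2 * (1 / 6 - 1 / (2 * π)) ^ p := by positivity
  have hB : 0 < 20 ^ p * ∫ y : ℝ, (1 + ‖y‖) ^ (-p) := by
    have hl := le_integral_norm_integral_chirp_window_rpow le_rfl hp
    have hu := integral_norm_integral_chirp_window_rpow_le le_rfl hp
    linarith
  refine ⟨_, _, 1, Real.rpow_pos_of_pos hA (1 / p), Real.rpow_pos_of_pos hB (1 / p), le_rfl,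
    fun N hN => ?_⟩
  have hN0 : 0 ≤ N := by linarith
  simp only [chirpNorm, norm_integral_chirp_mul_exp hN0]
  rw [← Real.mul_rpow hA.le hN0, ← Real.mul_rpow hB.le hN0]
  exact ⟨Real.rpow_le_rpow (by positivity) (le_integral_norm_integral_chirp_window_rpow hN hp) hp0,
    Real.rpow_le_rpow (integral_nonneg fun ξ => by positivity)
      (integral_norm_integral_chirp_window_rpow_le hN hp) hp0⟩
end
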